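/- (Catlin) Let Ω be a bounded pseudoconvex domain with smooth boundary in ℂ^n, p ∈ Ω, and β₁,…,β_n positive numbers. Assume there exist a function φ ∈ C³(Ω̄) and positive constants M, C̃, C_α such that: (1) |φ(z)| ≤ M for z ∈ Ω; (2) φ is plurisubharmonic in Ω; (3) the polydisc P = P(p,β) = {z ∈ ℂ^n : |z_j − p_j| < β_j, 1 ≤ j ≤ n} is contained in Ω; (4) Σ_{j,k=1}^n ∂²φ(z)/∂z_j∂z̄_k · X_j X̄_k ≥ C̃ Σ_{j=1}^n |X_j|²/β_j² for all z ∈ P and X ∈ ℂ^n; and (5) for every multi-index α with |α| ≤ 3 and every z ∈ P, |D^α φ(z)| ≤ C_α ∏_{j=1}^n β_j^{−α_j}, where D^α denotes any derivative of order α_j in the variables z_j, z̄_j for each j. Then there exists a positive constant C, depending only on M, C̃ and the C_α, such that C^{−1} ∏_{j=1}^n β_j^{−2} ≤ K_Ω(p,p̄) ≤ C ∏_{j=1}^n β_j^{−2}. -/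

import Mathlib

open MeasureTheory Complex Topology Filter Set

noncomputable section

/-! ### Wirtinger derivatives and complex Hessians on ℂⁿ -/

/-- The Wirtinger derivative `∂u/∂z_j` of a function `u : ℂⁿ → ℂ` at `z`. -/
def wder (n : ℕ) (j : Fin n) (u : (Fin n → ℂ) → ℂ) (z : Fin n → ℂ) : ℂ :=
  (1 / 2) * (fderiv ℝ u z (Pi.single j 1) - Complex.I * fderiv ℝ u z (Pi.single j Complex.I))

/-- The conjugate Wirtinger derivative `∂u/∂z̄_j` of a function `u : ℂⁿ → ℂ` at `z`. -/
def wderBar (n : ℕ) (j : Fin n) (u : (Fin n → ℂ) → ℂ) (z : Fin n → ℂ) : ℂ :=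
  (1 / 2) * (fderiv ℝ u z (Pi.single j 1) + Complex.I * fderiv ℝ u z (Pi.single j Complex.I))

/-- The complex Hessian `∂²φ/∂z_j∂z̄_k` of a real-valued function `φ` at `z`. -/
def cHess (n : ℕ) (φ : (Fin n → ℂ) → ℝ) (z : Fin n → ℂ) (j k : Fin n) : ℂ :=
  wderBar n k (fun w => wder n j (fun v => (φ v : ℂ)) w) z

/-- The (real part of the) Hermitian form `Σ_{j,k} H_{jk} X_j conj (Y_k)`. -/
def hermForm (n : ℕ) (H : Fin n → Fin n → ℂ) (X Y : Fin n → ℂ) : ℝ :=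
  (∑ j, ∑ k, H j k * X j * starRingEnd ℂ (Y k)).re

/-! ### The Bergman space, Bergman kernel, minimum integrals -/

/-- Membership in the Bergman space `A²(Ω)`: holomorphic and square-integrable on `Ω`. -/
def InBergman (n : ℕ) (Ω : Set (Fin n → ℂ)) (f : (Fin n → ℂ) → ℂ) : Prop :=
  DifferentiableOn ℂ f Ω ∧ IntegrableOn (fun z => ‖f z‖ ^ 2) Ω

/-- The squared `L²(Ω)`-norm `∫_Ω |f|²`. -/
def l2sq (n : ℕ) (Ω : Set (Fin n → ℂ)) (f : (Fin n → ℂ) → ℂ) : ℝ :=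
  ∫ z in Ω, ‖f z‖ ^ 2

/-- The holomorphic directional derivative `Σ_i X_i ∂f/∂z_i(p)`. -/
def holDeriv (n : ℕ) (f : (Fin n → ℂ) → ℂ) (p X : Fin n → ℂ) : ℂ :=
  ∑ i, X i * fderiv ℂ f p (Pi.single i 1)

/-- The second-order holomorphic derivative `Σ_{j,k} X_j Y_k ∂²f/∂z_j∂z_k(p)`. -/
def holDeriv2 (n : ℕ) (f : (Fin n → ℂ) → ℂ) (p X Y : Fin n → ℂ) : ℂ :=
  ∑ j, ∑ k, X j * Y k * fderiv ℂ (fun z => fderiv ℂ f z (Pi.single k 1)) p (Pi.single j 1)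

/-- Bergman's minimum integral `I⁰_Ω(p)`. -/
def I0 (n : ℕ) (Ω : Set (Fin n → ℂ)) (p : Fin n → ℂ) : ℝ :=
  sInf {r | ∃ f, InBergman n Ω f ∧ f p = 1 ∧ r = l2sq n Ω f}

/-- Bergman's minimum integral `I¹_Ω(p; X)`. -/
def I1 (n : ℕ) (Ω : Set (Fin n → ℂ)) (p X : Fin n → ℂ) : ℝ :=
  sInf {r | ∃ f, InBergman n Ω f ∧ f p = 0 ∧ holDeriv n f p X = 1 ∧ r = l2sq n Ω f}

/-- Bergman's minimum integral `I²_Ω(p; X, Y)`. -/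
def I2 (n : ℕ) (Ω : Set (Fin n → ℂ)) (p X Y : Fin n → ℂ) : ℝ :=
  sInf {r | ∃ f, InBergman n Ω f ∧ f p = 0 ∧ fderiv ℂ f p = 0 ∧
    holDeriv2 n f p X Y = 1 ∧ r = l2sq n Ω f}

/-- The Bergman kernel on the diagonal,
`K_Ω(p, p̄) = sup {|f(p)|² : f ∈ A²(Ω), ‖f‖_{L²(Ω)} ≤ 1}`. -/
def bergmanKernel (n : ℕ) (Ω : Set (Fin n → ℂ)) (p : Fin n → ℂ) : ℝ :=
  sSup {r | ∃ f, InBergman n Ω f ∧ l2sq n Ω f ≤ 1 ∧ r = ‖f p‖ ^ 2}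

/-- The components `g_{jk̄}(z) = ∂² log K_Ω(z,z̄)/∂z_j∂z̄_k` of the Bergman metric. -/
def bergMetricMat (n : ℕ) (Ω : Set (Fin n → ℂ)) (z : Fin n → ℂ) (j k : Fin n) : ℂ :=
  cHess n (fun w => Real.log (bergmanKernel n Ω w)) z j k

/-- The Bergman metric `g_Ω(z; X) = Σ_{j,k} g_{jk̄}(z) X_j X̄_k`. -/
def bergMetric (n : ℕ) (Ω : Set (Fin n → ℂ)) (z X : Fin n → ℂ) : ℝ :=
  hermForm n (bergMetricMat n Ω z) X X

/-- The inverse matrix `(g^{νμ̄})` of the Bergman metric. -/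
def bergMetricInv (n : ℕ) (Ω : Set (Fin n → ℂ)) (z : Fin n → ℂ) : Matrix (Fin n) (Fin n) ℂ :=
  (Matrix.of (bergMetricMat n Ω z))⁻¹

/-- The curvature tensor of the Bergman metric,
`R_{h̄jkl̄} = −∂²g_{jh̄}/∂z_k∂z̄_l + g^{νμ̄} (∂g_{jμ̄}/∂z_k)(∂g_{νh̄}/∂z̄_l)`. -/
def bergCurvTensor (n : ℕ) (Ω : Set (Fin n → ℂ)) (z : Fin n → ℂ) (h j k l : Fin n) : ℂ :=
  - wderBar n l (fun w => wder n k (fun v => bergMetricMat n Ω v j h) w) z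
  + ∑ ν, ∑ μ, bergMetricInv n Ω z ν μ *
      wder n k (fun v => bergMetricMat n Ω v j μ) z *
      wderBar n l (fun v => bergMetricMat n Ω v ν h) z

/-- The bisectional curvature of the Bergman metric,
`B_Ω(z;X,Y) = R_{h̄jkl̄} X̄_h X_j Y_k Ȳ_l / (g(z;X) g(z;Y))`. -/
def bisecCurv (n : ℕ) (Ω : Set (Fin n → ℂ)) (z X Y : Fin n → ℂ) : ℝ :=
  (∑ h, ∑ j, ∑ k, ∑ l, bergCurvTensor n Ω z h j k l *
      starRingEnd ℂ (X h) * X j * Y k * starRingEnd ℂ (Y l)).re /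
    (bergMetric n Ω z X * bergMetric n Ω z Y)

/-- The holomorphic sectional curvature `H_Ω(z;X) = B_Ω(z;X,X)`. -/
def holSecCurv (n : ℕ) (Ω : Set (Fin n → ℂ)) (z X : Fin n → ℂ) : ℝ := bisecCurv n Ω z X X

/-- The Ricci curvature `Ric_Ω(z;X) = Σ_j B_Ω(z;E^j,X)` (standard basis). -/
def ricciCurv (n : ℕ) (Ω : Set (Fin n → ℂ)) (z X : Fin n → ℂ) : ℝ :=
  ∑ j, bisecCurv n Ω z (Pi.single j 1) X

/-! ### Plurisubharmonicity and pseudoconvexity -/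

/-- `u` is plurisubharmonic on `Ω`: upper semicontinuous and satisfying the sub-mean value
inequality on circles in complex lines contained in `Ω`. -/
def PSHOn (n : ℕ) (u : (Fin n → ℂ) → ℝ) (Ω : Set (Fin n → ℂ)) : Prop :=
  UpperSemicontinuousOn u Ω ∧
  ∀ z ∈ Ω, ∀ w : Fin n → ℂ, ∀ r : ℝ, 0 < r →
    (∀ t : ℂ, ‖t‖ ≤ r → z + t • w ∈ Ω) →
    u z ≤ (1 / (2 * Real.pi)) *
      ∫ θ in (0:ℝ)..(2 * Real.pi), u (z + ((r : ℂ) * Complex.exp ((θ : ℂ) * Complex.I)) • w)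

/-- A `C²` function `φ` is plurisubharmonic on `Ω` iff its complex Hessian is
positive semidefinite at every point of `Ω`. -/
def PSHOnC2 (n : ℕ) (φ : (Fin n → ℂ) → ℝ) (Ω : Set (Fin n → ℂ)) : Prop :=
  ∀ z ∈ Ω, ∀ X : Fin n → ℂ, 0 ≤ hermForm n (cHess n φ z) X X

/-- `Ω` is pseudoconvex: it admits a continuous plurisubharmonic exhaustion function. -/
def PseudoconvexExh (n : ℕ) (Ω : Set (Fin n → ℂ)) : Prop :=
  ∃ u : (Fin n → ℂ) → ℝ, ContinuousOn u Ω ∧ PSHOn n u Ω ∧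
    ∀ c : ℝ, ∃ K : Set (Fin n → ℂ), IsCompact K ∧ K ⊆ Ω ∧ {z ∈ Ω | u z ≤ c} ⊆ K

/-! ### Smooth boundary, Levi form, Levi rank -/

/-- `ρ` is a (global) smooth defining function for the domain `Ω`. -/
def IsDefining (n : ℕ) (Ω : Set (Fin n → ℂ)) (ρ : (Fin n → ℂ) → ℝ) : Prop :=
  ContDiff ℝ (⊤ : ℕ∞) ρ ∧ (∀ z ∈ Ω, ρ z < 0) ∧ (∀ z ∈ frontier Ω, ρ z = 0) ∧
    ∀ z ∈ frontier Ω, fderiv ℝ ρ z ≠ 0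

/-- The coefficient `∂ρ/∂z_j(q)` of `∂ρ` (for a real-valued `ρ`). -/
def dzCoef (n : ℕ) (ρ : (Fin n → ℂ) → ℝ) (q : Fin n → ℂ) (j : Fin n) : ℂ :=
  wder n j (fun v => (ρ v : ℂ)) q

/-- The ℂ-linear map `X ↦ Σ_j ∂ρ/∂z_j(q) X_j`. -/
def cTangentMap (n : ℕ) (ρ : (Fin n → ℂ) → ℝ) (q : Fin n → ℂ) : (Fin n → ℂ) →ₗ[ℂ] ℂ :=
  ∑ j, dzCoef n ρ q j • (LinearMap.proj j : (Fin n → ℂ) →ₗ[ℂ] ℂ)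

/-- The complex tangent space `T^{1,0}_q(∂Ω) = {X : Σ_j ∂ρ/∂z_j(q) X_j = 0}`. -/
def cTangent (n : ℕ) (ρ : (Fin n → ℂ) → ℝ) (q : Fin n → ℂ) : Submodule ℂ (Fin n → ℂ) :=
  LinearMap.ker (cTangentMap n ρ q)

/-- The Levi form of `ρ` at `q` is positive semidefinite on the complex tangent space. -/
def LeviPSDAt (n : ℕ) (ρ : (Fin n → ℂ) → ℝ) (q : Fin n → ℂ) : Prop :=
  ∀ X ∈ cTangent n ρ q, 0 ≤ hermForm n (cHess n ρ q) X X

/-- The ℂ-linear map `X ↦ Σ_{j,k} ρ_{jk̄}(q) X_j conj (Y_k)` (Levi pairing against `Y`). -/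
def leviPairMap (n : ℕ) (ρ : (Fin n → ℂ) → ℝ) (q Y : Fin n → ℂ) : (Fin n → ℂ) →ₗ[ℂ] ℂ :=
  ∑ j, (∑ k, cHess n ρ q j k * starRingEnd ℂ (Y k)) • (LinearMap.proj j : (Fin n → ℂ) →ₗ[ℂ] ℂ)

/-- The kernel of the Levi form of `ρ` at `q`, as a Hermitian form on `T^{1,0}_q(∂Ω)`. -/
def leviKernel (n : ℕ) (ρ : (Fin n → ℂ) → ℝ) (q : Fin n → ℂ) : Submodule ℂ (Fin n → ℂ) :=
  cTangent n ρ q ⊓ ⨅ Y ∈ cTangent n ρ q, LinearMap.ker (leviPairMap n ρ q Y)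

/-- The Levi form of `ρ` at `q`, as a Hermitian form on `T^{1,0}_q(∂Ω)`, has rank `l`. -/
def LeviRankAt (n : ℕ) (ρ : (Fin n → ℂ) → ℝ) (q : Fin n → ℂ) (l : ℕ) : Prop :=
  Module.finrank ℂ ↥(cTangent n ρ q) - Module.finrank ℂ ↥(leviKernel n ρ q) = l

/-! ### Test functions, polydiscs, Euclidean norms, biholomorphisms -/

/-- A smooth test function compactly supported in `Ω`. -/
def IsTestFun (n : ℕ) (ψ : (Fin n → ℂ) → ℂ) (Ω : Set (Fin n → ℂ)) : Prop :=
  ContDiff ℝ (⊤ : ℕ∞) ψ ∧ HasCompactSupport ψ ∧ tsupport ψ ⊆ Ω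

/-- The polydisc `P(c, β) = {z : |z_j − c_j| < β_j for all j}`. -/
def polydisc (n : ℕ) (c : Fin n → ℂ) (β : Fin n → ℝ) : Set (Fin n → ℂ) :=
  {z | ∀ j, ‖z j - c j‖ < β j}

/-- The Euclidean norm of the components of `ζ` indexed by `s`. -/
def eucNormOn (n : ℕ) (s : Finset (Fin n)) (ζ : Fin n → ℂ) : ℝ :=
  Real.sqrt (∑ j ∈ s, ‖ζ j‖ ^ 2)

/-- The Euclidean ball of radius `r` centered at the origin in ℂⁿ. -/
def eball (n : ℕ) (r : ℝ) : Set (Fin n → ℂ) :=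
  {ζ | eucNormOn n Finset.univ ζ < r}

/-- `f` is a biholomorphism from `A` onto `B`. -/
def Biholo (n : ℕ) (f : (Fin n → ℂ) → (Fin n → ℂ)) (A B : Set (Fin n → ℂ)) : Prop :=
  DifferentiableOn ℂ f A ∧ Set.BijOn f A B ∧
    ∃ g, DifferentiableOn ℂ g B ∧ ∀ z ∈ A, g (f z) = z

/-- The determinant of the complex Jacobian of `f` at `p`. -/
def cJacDet (n : ℕ) (f : (Fin n → ℂ) → (Fin n → ℂ)) (p : Fin n → ℂ) : ℂ :=
  LinearMap.det ((fderiv ℂ f p).toLinearMap)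

/-! ### Mixed derivatives `D^α` in the variables `z_j`, `z̄_j` -/

/-- The multi-index `α : Fin n → ℕ` recording how many of the directions `ι i` hit slot `j`. -/
def multiIdxOf (n : ℕ) {m : ℕ} (ι : Fin m → Fin n) : Fin n → ℕ :=
  fun j => (Finset.univ.filter fun i => ι i = j).card

/-- All mixed derivatives `D^α φ` of total order `≤ mmax`, where in each slot `j` one may
differentiate in the real directions underlying `z_j` and `z̄_j` (i.e. `e_j` and `i·e_j`),
are bounded on `P` by `bound α`. -/
def MixedDerivBound (n : ℕ) (φ : (Fin n → ℂ) → ℝ) (P : Set (Fin n → ℂ))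
    (mmax : ℕ) (bound : (Fin n → ℕ) → ℝ) : Prop :=
  ∀ m : ℕ, m ≤ mmax → ∀ ι : Fin m → Fin n, ∀ ε : Fin m → ℂ,
    (∀ i, ε i = 1 ∨ ε i = Complex.I) → ∀ z ∈ P,
      ‖iteratedFDeriv ℝ m φ z (fun i => Pi.single (ι i) (ε i))‖ ≤ bound (multiIdxOf n ι)

/-- All mixed derivatives `D^α φ` (of any order) are bounded on `P` by `bound α`. -/
def MixedDerivBoundAll (n : ℕ) (φ : (Fin n → ℂ) → ℝ) (P : Set (Fin n → ℂ))
    (bound : (Fin n → ℕ) → ℝ) : Prop :=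
  ∀ m : ℕ, ∀ ι : Fin m → Fin n, ∀ ε : Fin m → ℂ,
    (∀ i, ε i = 1 ∨ ε i = Complex.I) → ∀ z ∈ P,
      ‖iteratedFDeriv ℝ m φ z (fun i => Pi.single (ι i) (ε i))‖ ≤ bound (multiIdxOf n ι)

/-! ### Fu's centering maps and normal forms (constant Levi rank `l`) -/

/-- Lean indices `1,…,l`, i.e. the coordinates `ζ_2,…,ζ_{l+1}` (the block `ζ'`). -/
def primIdx (n l : ℕ) : Finset (Fin n) := Finset.univ.filter fun j => 1 ≤ j.val ∧ j.val ≤ l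

/-- Lean indices `l+1,…,n−1`, i.e. the coordinates `ζ_{l+2},…,ζ_n` (the block `ζ''`). -/
def dprimIdx (n l : ℕ) : Finset (Fin n) := Finset.univ.filter fun j => l + 1 ≤ j.val

/-- Lean indices `1,…,n−l−1`, i.e. the coordinates `ζ_2,…,ζ_{n−l}`. -/
def midIdx (n l : ℕ) : Finset (Fin n) :=
  Finset.univ.filter fun j => 1 ≤ j.val ∧ j.val ≤ n - l - 1

/-- Lean indices `n−l,…,n−1`, i.e. the coordinates `ζ_{n−l+1},…,ζ_n`. -/
def tailIdx (n l : ℕ) : Finset (Fin n) := Finset.univ.filter fun j => n - l ≤ j.val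

/-- `ρ` is a smooth local defining function for the real hypersurface `S` near `0`
(on the Euclidean ball of radius `ε`). -/
def IsLocalDefining (n : ℕ) (S : Set (Fin n → ℂ)) (ρ : (Fin n → ℂ) → ℝ) (ε : ℝ) : Prop :=
  ContDiffOn ℝ (⊤ : ℕ∞) ρ (eball n ε) ∧
    S ∩ eball n ε = {ζ ∈ eball n ε | ρ ζ = 0} ∧
    ∀ ζ ∈ S ∩ eball n ε, fderiv ℝ ρ ζ ≠ 0

/-- `ρ(ζ) = Re ζ₁ + Σ_{j=2}^{l+1} λ_j |ζ_j|² + O(|ζ'|²·|ζ''| + |ζ'|³ + |Im ζ₁|·|ζ|)` near `0`. -/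
def NormalForm (n l : ℕ) [NeZero n] (lam : Fin n → ℝ) (ρ : (Fin n → ℂ) → ℝ) (ε : ℝ) : Prop :=
  ∃ C > (0:ℝ), ∀ ζ ∈ eball n ε,
    |ρ ζ - ((ζ 0).re + ∑ j ∈ primIdx n l, lam j * ‖ζ j‖ ^ 2)| ≤
      C * ((eucNormOn n (primIdx n l) ζ) ^ 2 * eucNormOn n (dprimIdx n l) ζ +
        (eucNormOn n (primIdx n l) ζ) ^ 3 + |(ζ 0).im| * eucNormOn n Finset.univ ζ)

/-- Fu's centering data near a boundary point: for each `q ∈ U ∩ ∂Ω`, `Φ q` is a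
biholomorphism of `U` onto the unit ball with `Φ q q = 0`, depending smoothly on `q`,
such that `Φ q (U ∩ ∂Ω)` has, near `0`, a defining function `ρloc q` in normal form with
positive coefficients `lam q j` (for `j` in the block `ζ'`) depending smoothly on `q`. -/
def CenteringData (n l : ℕ) [NeZero n] (Ω U : Set (Fin n → ℂ))
    (Φ : (Fin n → ℂ) → (Fin n → ℂ) → (Fin n → ℂ))
    (lam : (Fin n → ℂ) → Fin n → ℝ)
    (ρloc : (Fin n → ℂ) → (Fin n → ℂ) → ℝ) (ε : ℝ) : Prop :=
  ContDiffOn ℝ (⊤ : ℕ∞) (fun pq : (Fin n → ℂ) × (Fin n → ℂ) => Φ pq.1 pq.2)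
      ((U ∩ frontier Ω) ×ˢ U) ∧
  (∀ j : Fin n, ContDiffOn ℝ (⊤ : ℕ∞) (fun q => lam q j) (U ∩ frontier Ω)) ∧
  ∀ q ∈ U ∩ frontier Ω,
    Φ q q = 0 ∧ Biholo n (Φ q) U (eball n 1) ∧
    (∀ j ∈ primIdx n l, 0 < lam q j) ∧
    IsLocalDefining n (Φ q '' (U ∩ frontier Ω)) (ρloc q) ε ∧
    NormalForm n l (lam q) (ρloc q) ε

/-- Fu's polydisc-type region
`P_{δ,a} = {ζ : |ζ₁| < aδ, |ζ_j| < aδ^{1/2} (2 ≤ j ≤ n−l), |ζ_k| < a (n−l+1 ≤ k ≤ n)}`. -/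
def PdaSet (n l : ℕ) [NeZero n] (δ a : ℝ) : Set (Fin n → ℂ) :=
  {ζ | ‖ζ 0‖ < a * δ ∧ (∀ j ∈ midIdx n l, ‖ζ j‖ < a * Real.sqrt δ) ∧
    ∀ j ∈ tailIdx n l, ‖ζ j‖ < a}

/-! ### Finite type in the sense of D'Angelo -/

/-- `h` vanishes to order at least `k` at `0`. -/
def vanishGe (E : Type*) [Norm E] (h : ℂ → E) (k : ℕ) : Prop :=
  ∃ C > (0:ℝ), ∃ ε > (0:ℝ), ∀ t : ℂ, ‖t‖ < ε → ‖h t‖ ≤ C * ‖t‖ ^ k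

/-- The vanishing order of `h` at `0`, as an extended natural number. -/
def vOrder (E : Type*) [Norm E] (h : ℂ → E) : ℕ∞ :=
  sSup ((fun k : ℕ => (k : ℕ∞)) '' {k | vanishGe E h k})

/-- `z₀ ∈ ∂Ω` is a point of finite type in the sense of D'Angelo (w.r.t. the defining
function `ρ`): the order of contact of `∂Ω` with nonconstant holomorphic curves through
`z₀` is uniformly bounded. -/
def FiniteTypeAt (n : ℕ) (ρ : (Fin n → ℂ) → ℝ) (z₀ : Fin n → ℂ) : Prop :=
  ∃ T : ℕ, ∀ γ : ℂ → (Fin n → ℂ), AnalyticAt ℂ γ 0 → γ 0 = z₀ →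
    ¬ (∀ᶠ t in 𝓝 (0:ℂ), γ t = z₀) →
    vOrder ℝ (fun t => ρ (γ t)) ≤ (T : ℕ∞) * vOrder (Fin n → ℂ) (fun t => γ t - z₀)

end

/-- The first order operator `(∂_{e_j} + c ∂_{i e_j}) / 2`; both Wirtinger derivatives are of this
form. -/
noncomputable def dW (n : ℕ) (c : ℂ) (j : Fin n) (u : (Fin n → ℂ) → ℂ) (z : Fin n → ℂ) : ℂ :=
  (1 / 2) * (fderiv ℝ u z (Pi.single j 1) + c * fderiv ℝ u z (Pi.single j Complex.I))

section WirtingerCalculus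

variable {n : ℕ}

theorem wder_eq_dW (j : Fin n) (u : (Fin n → ℂ) → ℂ) : wder n j u = dW n (-Complex.I) j u := by
  ext z; simp [wder, dW, sub_eq_add_neg]

theorem wderBar_eq_dW (j : Fin n) (u : (Fin n → ℂ) → ℂ) : wderBar n j u = dW n Complex.I j u := by
  ext z; simp [wderBar, dW]

variable (c d : ℂ) (j k : Fin n) {u v : (Fin n → ℂ) → ℂ} {z : Fin n → ℂ}

theorem dW_congr (h : u =ᶠ[𝓝 z] v) : dW n c j u z = dW n c j v z := by
  simp only [dW, h.fderiv_eq]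

theorem dW_add (hu : DifferentiableAt ℝ u z) (hv : DifferentiableAt ℝ v z) :
    dW n c j (fun w => u w + v w) z = dW n c j u z + dW n c j v z := by
  simp only [dW]
  rw [fderiv_fun_add hu hv]
  simp only [add_apply]; ring

theorem dW_sub (hu : DifferentiableAt ℝ u z) (hv : DifferentiableAt ℝ v z) :
    dW n c j (fun w => u w - v w) z = dW n c j u z - dW n c j v z := by
  simp only [dW]
  rw [fderiv_fun_sub hu hv]
  simp only [sub_apply]; ring

theorem dW_mul (hu : DifferentiableAt ℝ u z) (hv : DifferentiableAt ℝ v z) :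
    dW n c j (fun w => u w * v w) z = dW n c j u z * v z + u z * dW n c j v z := by
  simp only [dW]
  rw [fderiv_fun_mul hu hv]
  simp only [add_apply, smul_apply, smul_eq_mul]; ring

theorem dW_const (a : ℂ) : dW n c j (fun _ => a) z = 0 := by
  simp [dW]

theorem dW_conj :
    dW n c j (fun w => (starRingEnd ℂ) (u w)) z
      = (starRingEnd ℂ) (dW n ((starRingEnd ℂ) c) j u z) := by
  have h : fderiv ℝ (fun w => (starRingEnd ℂ) (u w)) z
      = (Complex.conjCLE : ℂ →L[ℝ] ℂ).comp (fderiv ℝ u z) := by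
    have := Complex.conjCLE.comp_fderiv (f := u) (x := z)
    exact this
  have h2 : (starRingEnd ℂ) (1 / 2) = 1 / 2 := by
    rw [map_div₀, map_one, Complex.conj_ofNat]
  simp only [dW, h, map_mul, map_add, h2, Complex.conj_conj]
  rfl

theorem dW_sum {ι : Type*} (s : Finset ι) {f : ι → (Fin n → ℂ) → ℂ}
    (hf : ∀ i ∈ s, DifferentiableAt ℝ (f i) z) :
    dW n c j (fun w => ∑ i ∈ s, f i w) z = ∑ i ∈ s, dW n c j (f i) z := by
  simp only [dW]
  rw [fderiv_fun_sum hf]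
  simp only [FunLike.coe_sum, Finset.sum_apply, Finset.mul_sum, ← Finset.sum_add_distrib]

theorem dW_contDiffAt {m m' : WithTop ℕ∞} (hu : ContDiffAt ℝ m u z) (hm : m' + 1 ≤ m) :
    ContDiffAt ℝ m' (dW n c j u) z := by
  have h := hu.fderiv_right hm
  unfold dW
  fun_prop

theorem dW_contDiffOn {m m' : WithTop ℕ∞} {Ω : Set (Fin n → ℂ)} (hΩ : IsOpen Ω)
    (hu : ContDiffOn ℝ m u Ω) (hm : m' + 1 ≤ m) : ContDiffOn ℝ m' (dW n c j u) Ω := fun _ hz =>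
  (dW_contDiffAt c j (hu.contDiffAt (hΩ.mem_nhds hz)) hm).contDiffWithinAt

theorem dW_contDiff {m m' : WithTop ℕ∞} (hu : ContDiff ℝ m u) (hm : m' + 1 ≤ m) :
    ContDiff ℝ m' (dW n c j u) :=
  contDiff_iff_contDiffAt.2 fun _ => dW_contDiffAt c j hu.contDiffAt hm

theorem dW_continuous (hu : ContDiff ℝ 1 u) : Continuous (dW n c j u) :=
  (dW_contDiff (m' := 0) c j hu (by simp)).continuous

theorem dW_eq_zero_of_notMem (hz : z ∉ tsupport u) : dW n c j u z = 0 := by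
  have h : u =ᶠ[𝓝 z] fun _ => 0 := notMem_tsupport_iff_eventuallyEq.1 hz
  rw [dW_congr c j h, dW_const]

theorem tsupport_dW_subset : tsupport (dW n c j u) ⊆ tsupport u :=
  closure_minimal (fun _ hz => by
    by_contra h; exact hz (dW_eq_zero_of_notMem c j h)) (isClosed_tsupport u)

theorem dW_hasCompactSupport (hu : HasCompactSupport u) : HasCompactSupport (dW n c j u) :=
  hu.of_isClosed_subset (isClosed_tsupport _) (tsupport_dW_subset c j)

theorem dW_comm (hu : ContDiffAt ℝ 2 u z) :
    dW n c j (dW n d k u) z = dW n d k (dW n c j u) z := by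
  have hd : DifferentiableAt ℝ (fderiv ℝ u) z :=
    (hu.fderiv_right (m := 1) (by norm_num)).differentiableAt (by norm_num)
  have key : ∀ (a : ℂ) (i : Fin n) (x : Fin n → ℂ), fderiv ℝ (dW n a i u) z x
      = (1 / 2) * (fderiv ℝ (fderiv ℝ u) z x (Pi.single i 1)
          + a * fderiv ℝ (fderiv ℝ u) z x (Pi.single i Complex.I)) := by
    intro a i x
    have h1 : ∀ y : Fin n → ℂ, HasFDerivAt (fun w => fderiv ℝ u w y)
        ((fderiv ℝ (fderiv ℝ u) z).flip y) z := fun y => by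
      have := hd.hasFDerivAt.clm_apply (hasFDerivAt_const y z)
      simpa using this
    have h2 : HasFDerivAt (dW n a i u) ((1 / 2 : ℂ) • ((fderiv ℝ (fderiv ℝ u) z).flip (Pi.single i 1)
        + a • (fderiv ℝ (fderiv ℝ u) z).flip (Pi.single i Complex.I))) z :=
      ((h1 _).add ((h1 _).const_mul a)).const_mul _
    rw [h2.fderiv]
    simp only [smul_apply, add_apply, ContinuousLinearMap.flip_apply, smul_eq_mul]
  have hs : IsSymmSndFDerivAt ℝ u z := hu.isSymmSndFDerivAt (by simp)
  rw [dW, key, key, dW, key, key, hs.eq (Pi.single j 1) (Pi.single k 1),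
    hs.eq (Pi.single j 1) (Pi.single k I), hs.eq (Pi.single j I) (Pi.single k 1),
    hs.eq (Pi.single j I) (Pi.single k I)]
  ring

theorem integral_fderiv_apply_eq_zero (hu : ContDiff ℝ 1 u) (hc : HasCompactSupport u)
    (x : Fin n → ℂ) : ∫ z, fderiv ℝ u z x = 0 := by
  have hi : Integrable (fun z => fderiv ℝ u z x) :=
    ((hu.continuous_fderiv (by norm_num)).clm_apply continuous_const).integrable_of_hasCompactSupport
      (hc.fderiv_apply (𝕜 := ℝ) x)
  have := integral_mul_fderiv_eq_neg_fderiv_mul_of_integrable (𝕜 := ℂ) (μ := volume)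
    (f := fun _ => (1 : ℂ)) (g := u) (v := x) (by simp) (by simpa using hi)
    (by simpa using hu.continuous.integrable_of_hasCompactSupport hc) (by fun_prop)
    (fun w _ => hu.differentiable (by norm_num) w)
  simpa using this

theorem integral_dW_eq_zero (hu : ContDiff ℝ 1 u) (hc : HasCompactSupport u) :
    ∫ z, dW n c j u z = 0 := by
  have hi : ∀ x, Integrable (fun z => fderiv ℝ u z x) := fun x =>
    ((hu.continuous_fderiv (by norm_num)).clm_apply continuous_const).integrable_of_hasCompactSupport
      (hc.fderiv_apply (𝕜 := ℝ) x)
  simp only [dW]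
  rw [integral_const_mul, integral_add (hi _) ((hi _).const_mul c), integral_const_mul,
    integral_fderiv_apply_eq_zero hu hc, integral_fderiv_apply_eq_zero hu hc]
  simp

theorem integral_dW_mul (hu : ContDiff ℝ 1 u) (hv : ContDiff ℝ 1 v) (hc : HasCompactSupport v) :
    ∫ z, dW n c j u z * v z = - ∫ z, u z * dW n c j v z := by
  have h := integral_dW_eq_zero c j (hu.mul hv) hc.mul_left
  have h2 : ∀ z, dW n c j (fun w => u w * v w) z = dW n c j u z * v z + u z * dW n c j v z :=
    fun z => dW_mul c j (hu.differentiable (by norm_num) z) (hv.differentiable (by norm_num) z)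
  have h' : ∫ z, (dW n c j u z * v z + u z * dW n c j v z) = 0 := by
    rw [← h]; exact integral_congr_ae (ae_of_all _ fun z => (h2 z).symm)
  rw [integral_add] at h'
  · exact eq_neg_of_add_eq_zero_left h'
  · exact ((dW_continuous c j hu).mul hv.continuous).integrable_of_hasCompactSupport hc.mul_left
  · exact (hu.continuous.mul (dW_continuous c j hv)).integrable_of_hasCompactSupport
      (dW_hasCompactSupport c j hc).mul_left

end WirtingerCalculus

section BasicEstimate

variable {n : ℕ}

theorem dW_cexp (c : ℂ) (j : Fin n) {u : (Fin n → ℂ) → ℂ} {z : Fin n → ℂ}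
    (hu : DifferentiableAt ℝ u z) :
    dW n c j (fun w => Complex.exp (u w)) z = Complex.exp (u z) * dW n c j u z := by
  have h : HasFDerivAt (fun w => Complex.exp (u w)) (Complex.exp (u z) • fderiv ℝ u z) z :=
    hu.hasFDerivAt.cexp
  simp only [dW, h.fderiv, smul_apply, smul_eq_mul]; ring

/-- The twisted derivative `∂u/∂z_j - (∂φ/∂z_j) u`. -/
noncomputable def twDer (n : ℕ) (φ : (Fin n → ℂ) → ℝ) (j : Fin n) (u : (Fin n → ℂ) → ℂ)
    (z : Fin n → ℂ) : ℂ :=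
  wder n j u z - wder n j (fun v => (φ v : ℂ)) z * u z

variable {φ : (Fin n → ℂ) → ℝ} {u v : (Fin n → ℂ) → ℂ}

theorem contDiff_ofReal_comp {m : WithTop ℕ∞} (hφ : ContDiff ℝ m φ) :
    ContDiff ℝ m (fun z => (φ z : ℂ)) :=
  Complex.ofRealCLM.contDiff.comp hφ

theorem contDiff_conj {m : WithTop ℕ∞} (hu : ContDiff ℝ m u) :
    ContDiff ℝ m (fun z => (starRingEnd ℂ) (u z)) :=
  Complex.conjCLE.contDiff.comp hu

theorem contDiff_weight {m : WithTop ℕ∞} (hφ : ContDiff ℝ m φ) :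
    ContDiff ℝ m (fun z => Complex.exp (-(φ z : ℂ))) :=
  (contDiff_ofReal_comp hφ).neg.cexp

theorem dW_weight_mul (c : ℂ) (j : Fin n) (hφ : ContDiff ℝ 1 φ) (hv : ContDiff ℝ 1 v)
    (z : Fin n → ℂ) :
    dW n c j (fun w => v w * Complex.exp (-(φ w : ℂ))) z
      = (dW n c j v z - dW n c j (fun w => (φ w : ℂ)) z * v z) * Complex.exp (-(φ z : ℂ)) := by
  have h1 := (contDiff_ofReal_comp hφ).differentiable (by norm_num) z
  have h3 : dW n c j (fun w => -(φ w : ℂ)) z = - dW n c j (fun w => (φ w : ℂ)) z := by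
    have := dW_sub c j (differentiableAt_const (0 : ℂ)) h1
    simpa [dW_const] using this
  rw [dW_mul c j (hv.differentiable (by norm_num) z)
    ((contDiff_weight hφ).differentiable (by norm_num) z), dW_cexp c j (by fun_prop), h3]
  ring

theorem wder_conj (j : Fin n) (z : Fin n → ℂ) :
    wder n j (fun w => (starRingEnd ℂ) (u w)) z = (starRingEnd ℂ) (wderBar n j u z) := by
  rw [wder_eq_dW, wderBar_eq_dW, dW_conj]; simp

theorem wderBar_conj (j : Fin n) (z : Fin n → ℂ) :
    wderBar n j (fun w => (starRingEnd ℂ) (u w)) z = (starRingEnd ℂ) (wder n j u z) := by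
  rw [wder_eq_dW, wderBar_eq_dW, dW_conj]; simp

theorem wderBar_ofReal (j : Fin n) (φ : (Fin n → ℂ) → ℝ) (z : Fin n → ℂ) :
    wderBar n j (fun w => (φ w : ℂ)) z = (starRingEnd ℂ) (wder n j (fun w => (φ w : ℂ)) z) := by
  rw [← wderBar_conj]; simp

theorem integral_twDer_mul (j : Fin n) (hφ : ContDiff ℝ 1 φ) (hu : ContDiff ℝ 1 u)
    (hv : ContDiff ℝ 1 v) (hc : HasCompactSupport v) :
    ∫ z, twDer n φ j u z * (starRingEnd ℂ) (v z) * Complex.exp (-(φ z : ℂ))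
      = - ∫ z, u z * (starRingEnd ℂ) (wderBar n j v z) * Complex.exp (-(φ z : ℂ)) := by
  have hcv : HasCompactSupport (fun z => (starRingEnd ℂ) (v z)) :=
    hc.comp_left (g := starRingEnd ℂ) (by simp)
  have hV : ContDiff ℝ 1 (fun z => (starRingEnd ℂ) (v z) * Complex.exp (-(φ z : ℂ))) :=
    (contDiff_conj hv).mul (contDiff_weight hφ)
  have hVc : HasCompactSupport (fun z => (starRingEnd ℂ) (v z) * Complex.exp (-(φ z : ℂ))) :=
    hcv.mul_right
  have h := integral_dW_mul (-I) j hu hV hVc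
  simp only [dW_weight_mul (-I) j hφ (contDiff_conj hv)] at h
  simp only [← wder_eq_dW, wder_conj] at h
  have i1 : Integrable (fun z => wder n j u z * ((starRingEnd ℂ) (v z) * cexp (-(φ z : ℂ)))) := by
    rw [wder_eq_dW]
    exact ((dW_continuous _ _ hu).mul hV.continuous).integrable_of_hasCompactSupport hVc.mul_left
  have i2 : Integrable (fun z => wder n j (fun w => (φ w : ℂ)) z * u z *
      ((starRingEnd ℂ) (v z) * cexp (-(φ z : ℂ)))) := by
    rw [wder_eq_dW]
    exact (((dW_continuous _ _ (contDiff_ofReal_comp hφ)).mul hu.continuous).mul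
      hV.continuous).integrable_of_hasCompactSupport hVc.mul_left
  have i3 : Integrable (fun z => u z * (starRingEnd ℂ) (wderBar n j v z) *
      cexp (-(φ z : ℂ))) := by
    rw [wderBar_eq_dW]
    have : HasCompactSupport (fun z => (starRingEnd ℂ) (dW n I j v z)) :=
      (dW_hasCompactSupport I j hc).comp_left (g := starRingEnd ℂ) (by simp)
    exact ((hu.continuous.mul (Complex.continuous_conj.comp (dW_continuous _ _ hv))).mul
      (contDiff_weight hφ).continuous).integrable_of_hasCompactSupport this.mul_left.mul_right
  have e1 : ∫ z, twDer n φ j u z * (starRingEnd ℂ) (v z) * Complex.exp (-(φ z : ℂ))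
      = (∫ z, wder n j u z * ((starRingEnd ℂ) (v z) * cexp (-(φ z : ℂ))))
        - ∫ z, wder n j (fun w => (φ w : ℂ)) z * u z *
            ((starRingEnd ℂ) (v z) * cexp (-(φ z : ℂ))) := by
    rw [← integral_sub i1 i2]
    refine integral_congr_ae (ae_of_all _ fun z => ?_)
    simp only [twDer]; ring
  have e2 : ∫ z, u z * (((starRingEnd ℂ) (wderBar n j v z)
        - wder n j (fun w => (φ w : ℂ)) z * (starRingEnd ℂ) (v z)) * cexp (-(φ z : ℂ)))
      = (∫ z, u z * (starRingEnd ℂ) (wderBar n j v z) * cexp (-(φ z : ℂ)))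
        - ∫ z, wder n j (fun w => (φ w : ℂ)) z * u z *
            ((starRingEnd ℂ) (v z) * cexp (-(φ z : ℂ))) := by
    rw [← integral_sub i3 i2]
    refine integral_congr_ae (ae_of_all _ fun z => ?_)
    simp only []; ring
  rw [e1, h, e2]; ring

theorem integral_mul_twDer (k : Fin n) (hφ : ContDiff ℝ 1 φ) (hu : ContDiff ℝ 1 u)
    (hv : ContDiff ℝ 1 v) (hc : HasCompactSupport v) :
    ∫ z, u z * (starRingEnd ℂ) (twDer n φ k v z) * Complex.exp (-(φ z : ℂ))
      = - ∫ z, wderBar n k u z * (starRingEnd ℂ) (v z) * Complex.exp (-(φ z : ℂ)) := by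
  have hcv : HasCompactSupport (fun z => (starRingEnd ℂ) (v z)) :=
    hc.comp_left (g := starRingEnd ℂ) (by simp)
  have h := integral_dW_mul I k hu ((contDiff_conj hv).mul (contDiff_weight hφ)) hcv.mul_right
  simp only [dW_weight_mul I k hφ (contDiff_conj hv)] at h
  simp only [← wderBar_eq_dW, wderBar_conj, wderBar_ofReal] at h
  rw [eq_neg_iff_add_eq_zero, add_comm, ← eq_neg_iff_add_eq_zero]
  refine Eq.trans (integral_congr_ae (ae_of_all _ fun z => ?_))
    (h.trans (congrArg Neg.neg (integral_congr_ae (ae_of_all _ fun z => ?_))))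
  · simp only []; ring
  · simp only [twDer, map_sub, map_mul]; ring

theorem twDer_wderBar (j k : Fin n) (hφ : ContDiff ℝ 2 φ) (hu : ContDiff ℝ 2 u) (z : Fin n → ℂ) :
    twDer n φ j (wderBar n k u) z - wderBar n k (twDer n φ j u) z = cHess n φ z j k * u z := by
  have hP : ContDiff ℝ 1 (wder n j (fun v => (φ v : ℂ))) := by
    rw [wder_eq_dW]; exact dW_contDiff _ _ (contDiff_ofReal_comp hφ) (by norm_num)
  have hw : ContDiff ℝ 1 (wder n j u) := by
    rw [wder_eq_dW]; exact dW_contDiff _ _ hu (by norm_num)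
  have hu1 : ContDiff ℝ 1 u := hu.of_le (by norm_num)
  have h1 : wderBar n k (twDer n φ j u) z = wderBar n k (wder n j u) z
      - (cHess n φ z j k * u z + wder n j (fun v => (φ v : ℂ)) z * wderBar n k u z) := by
    simp only [cHess, wderBar_eq_dW]
    rw [← dW_mul I k (hP.differentiable (by norm_num) z) (hu1.differentiable (by norm_num) z),
      ← dW_sub I k (hw.differentiable (by norm_num) z)
        ((hP.mul hu1).differentiable (by norm_num) z)]
    rfl
  rw [h1, twDer]
  have h2 : wder n j (wderBar n k u) z = wderBar n k (wder n j u) z := by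
    simp only [wder_eq_dW, wderBar_eq_dW]
    exact dW_comm _ _ _ _ hu.contDiffAt
  rw [h2]; ring

theorem sum_curl_sq (a : Fin n → Fin n → ℂ) :
    (1 / 2 : ℝ) * ∑ j, ∑ k, ‖a j k - a k j‖ ^ 2
      = ∑ j, ∑ k, ‖a j k‖ ^ 2 - (∑ j, ∑ k, a k j * (starRingEnd ℂ) (a j k)).re := by
  have h : ∀ x y : ℂ, ‖x - y‖ ^ 2 = ‖x‖ ^ 2 + ‖y‖ ^ 2 - 2 * (y * (starRingEnd ℂ) x).re := by
    intro x y
    simp only [← Complex.normSq_eq_norm_sq, Complex.normSq_apply]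
    simp; ring
  simp only [h, Finset.sum_sub_distrib, Finset.sum_add_distrib, Complex.re_sum, ← Finset.mul_sum]
  rw [Finset.sum_comm (f := fun j k => ‖a k j‖ ^ 2)]
  ring

/-- The Kohn–Morrey–Hörmander inequality for compactly supported `(0,1)`-forms of class `C²`. -/
theorem kohn_morrey_hormander (hφ : ContDiff ℝ 2 φ) {α : Fin n → (Fin n → ℂ) → ℂ}
    (hα : ∀ j, ContDiff ℝ 2 (α j)) (hc : ∀ j, HasCompactSupport (α j)) :
    ∫ z, hermForm n (cHess n φ z) (fun j => α j z) (fun j => α j z) * Real.exp (-φ z)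
      ≤ ∫ z, (‖∑ j, twDer n φ j (α j) z‖ ^ 2
        + (1 / 2 : ℝ) * ∑ j, ∑ k, ‖wderBar n j (α k) z - wderBar n k (α j) z‖ ^ 2)
          * Real.exp (-φ z) := by
  have hφ1 : ContDiff ℝ 1 φ := hφ.of_le (by norm_num)
  have hα1 : ∀ j, ContDiff ℝ 1 (α j) := fun j => (hα j).of_le (by norm_num)
  have hW : Continuous (fun z => cexp (-(φ z : ℂ))) := (contDiff_weight hφ).continuous
  have hP : ∀ j, ContDiff ℝ 1 (wder n j (fun v => (φ v : ℂ))) := fun j => by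
    rw [wder_eq_dW]; exact dW_contDiff _ _ (contDiff_ofReal_comp hφ) (by norm_num)
  have hb : ∀ j k, ContDiff ℝ 1 (wderBar n k (α j)) := fun j k => by
    rw [wderBar_eq_dW]; exact dW_contDiff _ _ (hα j) (by norm_num)
  have hd : ∀ j, ContDiff ℝ 1 (twDer n φ j (α j)) := fun j => by
    have : ContDiff ℝ 1 (wder n j (α j)) := by
      rw [wder_eq_dW]; exact dW_contDiff _ _ (hα j) (by norm_num)
    exact this.sub ((hP j).mul (hα1 j))
  have hH : ∀ j k, Continuous (fun z => cHess n φ z j k) := fun j k => by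
    simp only [cHess, wderBar_eq_dW]
    exact dW_continuous _ _ (hP j)
  have hdc : ∀ j, HasCompactSupport (twDer n φ j (α j)) := fun j => by
    have h1 : HasCompactSupport (wder n j (α j)) := by
      rw [wder_eq_dW]; exact dW_hasCompactSupport _ _ (hc j)
    exact h1.sub (hc j).mul_left
  have hbc : ∀ j k, HasCompactSupport (wderBar n k (α j)) := fun j k => by
    rw [wderBar_eq_dW]; exact dW_hasCompactSupport _ _ (hc j)
  have conjc : ∀ f : (Fin n → ℂ) → ℂ, Continuous f →
      Continuous (fun z => (starRingEnd ℂ) (f z)) := fun f hf => Complex.continuous_conj.comp hf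
  set A : Fin n → Fin n → (Fin n → ℂ) → ℂ := fun j k z =>
    twDer n φ j (α j) z * (starRingEnd ℂ) (twDer n φ k (α k) z) * cexp (-(φ z : ℂ)) with hA
  set B : Fin n → Fin n → (Fin n → ℂ) → ℂ := fun j k z =>
    wderBar n k (α j) z * (starRingEnd ℂ) (wderBar n j (α k) z) * cexp (-(φ z : ℂ)) with hB
  set C : Fin n → Fin n → (Fin n → ℂ) → ℂ := fun j k z =>
    cHess n φ z j k * α j z * (starRingEnd ℂ) (α k z) * cexp (-(φ z : ℂ)) with hC
  have iA : ∀ j k, Integrable (A j k) := fun j k =>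
    (((hd j).continuous.mul (conjc _ (hd k).continuous)).mul hW).integrable_of_hasCompactSupport
      (hdc j).mul_right.mul_right
  have iB : ∀ j k, Integrable (B j k) := fun j k =>
    (((hb j k).continuous.mul (conjc _ (hb k j).continuous)).mul
      hW).integrable_of_hasCompactSupport (hbc j k).mul_right.mul_right
  have iC : ∀ j k, Integrable (C j k) := fun j k =>
    ((((hH j k).mul (hα j).continuous).mul (conjc _ (hα k).continuous)).mul
      hW).integrable_of_hasCompactSupport (hc j).mul_left.mul_right.mul_right
  have key : ∀ j k, ∫ z, (A j k z - B j k z - C j k z) = 0 := by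
    intro j k
    have e1 := integral_mul_twDer k hφ1 (hd j) (hα1 k) (hc k)
    have e2 := integral_twDer_mul j hφ1 (hb j k) (hα1 k) (hc k)
    have i3 : Integrable (fun z => twDer n φ j (wderBar n k (α j)) z * (starRingEnd ℂ) (α k z) *
        cexp (-(φ z : ℂ))) := by
      have : Continuous (twDer n φ j (wderBar n k (α j))) := by
        have h1 : Continuous (wder n j (wderBar n k (α j))) := by
          rw [wder_eq_dW]; exact dW_continuous _ _ (hb j k)
        exact h1.sub ((hP j).continuous.mul (hb j k).continuous)
      have h2 : HasCompactSupport (fun z => (starRingEnd ℂ) (α k z)) :=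
        (hc k).comp_left (g := starRingEnd ℂ) (by simp)
      exact ((this.mul (conjc _ (hα k).continuous)).mul hW).integrable_of_hasCompactSupport
        h2.mul_left.mul_right
    have e3 : ∫ z, wderBar n k (twDer n φ j (α j)) z * (starRingEnd ℂ) (α k z) *
        cexp (-(φ z : ℂ)) = (∫ z, twDer n φ j (wderBar n k (α j)) z * (starRingEnd ℂ) (α k z) *
        cexp (-(φ z : ℂ))) - ∫ z, C j k z := by
      rw [← integral_sub i3 (iC j k)]
      refine integral_congr_ae (ae_of_all _ fun z => ?_)
      have := twDer_wderBar j k hφ (hα j) z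
      simp only [hC]
      rw [← this]; ring
    have s1 : ∫ z, (A j k z - B j k z - C j k z) = (∫ z, (A j k z - B j k z)) - ∫ z, C j k z :=
      integral_sub ((iA j k).sub (iB j k)) (iC j k)
    rw [s1, integral_sub (iA j k) (iB j k)]
    have s2 : ∫ z, A j k z = - ∫ z, wderBar n k (twDer n φ j (α j)) z *
      (starRingEnd ℂ) (α k z) * cexp (-(φ z : ℂ)) := e1
    have s3 : _ = - ∫ z, B j k z := e2
    rw [s2, e3, s3]
    ring
  have hWr : Continuous (fun z => Real.exp (-φ z)) := Real.continuous_exp.comp hφ.continuous.neg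
  have iR : Integrable (fun z => (‖∑ j, twDer n φ j (α j) z‖ ^ 2
        + (1 / 2 : ℝ) * ∑ j, ∑ k, ‖wderBar n j (α k) z - wderBar n k (α j) z‖ ^ 2)
          * Real.exp (-φ z)) := by
    have h1 : Continuous (fun z => ∑ j, twDer n φ j (α j) z) :=
      continuous_finsetSum _ fun j _ => (hd j).continuous
    have h2 : Continuous (fun z => ∑ j, ∑ k, ‖wderBar n j (α k) z - wderBar n k (α j) z‖ ^ 2) :=
      continuous_finsetSum _ fun j _ => continuous_finsetSum _ fun k _ =>
        (((hb k j).continuous.sub (hb j k).continuous).norm.pow 2)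
    refine (((h1.norm.pow 2).add (continuous_const.mul h2)).mul
      hWr).integrable_of_hasCompactSupport ?_
    refine HasCompactSupport.intro (isCompact_iUnion fun j => hc j) fun z hz => ?_
    simp only [mem_iUnion, not_exists] at hz
    have h3 : ∀ j, α j z = 0 := fun j => image_eq_zero_of_notMem_tsupport (hz j)
    simp [twDer, wder_eq_dW, wderBar_eq_dW, dW_eq_zero_of_notMem _ _ (hz _), h3]
  have hL : ∀ z, hermForm n (cHess n φ z) (fun j => α j z) (fun j => α j z) * Real.exp (-φ z)
      = (∑ j, ∑ k, C j k z).re := by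
    intro z
    simp only [hermForm, hC, ← Finset.sum_mul]
    rw [← Complex.ofReal_neg, ← Complex.ofReal_exp, Complex.re_mul_ofReal]
  have iL : Integrable (fun z => hermForm n (cHess n φ z) (fun j => α j z) (fun j => α j z)
      * Real.exp (-φ z)) := by
    simp only [hL]
    exact (integrable_finsetSum _ fun j _ => integrable_finsetSum _ fun k _ => iC j k).re
  rw [← sub_nonneg, ← integral_sub iR iL]
  have hpt : ∀ z, (‖∑ j, twDer n φ j (α j) z‖ ^ 2
        + (1 / 2 : ℝ) * ∑ j, ∑ k, ‖wderBar n j (α k) z - wderBar n k (α j) z‖ ^ 2)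
          * Real.exp (-φ z) - hermForm n (cHess n φ z) (fun j => α j z) (fun j => α j z)
          * Real.exp (-φ z) = (∑ j, ∑ k, (A j k z - B j k z - C j k z)).re
          + (∑ j, ∑ k, ‖wderBar n j (α k) z‖ ^ 2) * Real.exp (-φ z) := by
    intro z
    rw [hL, sum_curl_sq (fun j k => wderBar n j (α k) z)]
    simp only [Finset.sum_sub_distrib, Complex.sub_re]
    have e1 : (∑ j, ∑ k, A j k z).re = ‖∑ j, twDer n φ j (α j) z‖ ^ 2 * Real.exp (-φ z) := by
      simp only [hA, ← Finset.sum_mul, ← Finset.mul_sum, ← map_sum]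
      rw [← Complex.ofReal_neg, ← Complex.ofReal_exp, Complex.re_mul_ofReal, Complex.mul_conj,
        Complex.ofReal_re, Complex.normSq_eq_norm_sq]
    have e2 : (∑ j, ∑ k, B j k z).re = (∑ j, ∑ k, wderBar n k (α j) z *
        (starRingEnd ℂ) (wderBar n j (α k) z)).re * Real.exp (-φ z) := by
      simp only [hB, ← Finset.sum_mul]
      rw [← Complex.ofReal_neg, ← Complex.ofReal_exp, Complex.re_mul_ofReal]
    rw [e1, e2]; ring
  simp only [hpt]
  have iS : Integrable (fun z => ∑ j, ∑ k, (A j k z - B j k z - C j k z)) :=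
    integrable_finsetSum _ fun j _ => integrable_finsetSum _ fun k _ =>
      ((iA j k).sub (iB j k)).sub (iC j k)
  have iN : Integrable (fun z => (∑ j, ∑ k, ‖wderBar n j (α k) z‖ ^ 2) * Real.exp (-φ z)) := by
    refine (iR.sub iL).sub iS.re |>.congr (ae_of_all _ fun z => ?_)
    have := hpt z
    simp only [Pi.sub_apply, RCLike.re_to_complex]
    linarith
  have iS' : Integrable (fun z => (∑ j, ∑ k, (A j k z - B j k z - C j k z)).re) := iS.re
  rw [integral_add iS' iN]
  have : ∫ z, (∑ j, ∑ k, (A j k z - B j k z - C j k z)).re = 0 := by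
    have h1 := integral_re iS
    simp only [RCLike.re_to_complex] at h1
    have h4 : ∀ j ∈ Finset.univ, Integrable (fun z => ∑ k, (A j k z - B j k z - C j k z)) :=
      fun j _ => integrable_finsetSum _ fun k _ => ((iA j k).sub (iB j k)).sub (iC j k)
    rw [h1, integral_finsetSum _ h4]
    have h2 : ∀ j, ∫ z, ∑ k, (A j k z - B j k z - C j k z) = 0 := fun j => by
      have h3 : ∀ k ∈ Finset.univ, Integrable (fun z => A j k z - B j k z - C j k z) :=
        fun k _ => ((iA j k).sub (iB j k)).sub (iC j k)
      rw [integral_finsetSum _ h3]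
      exact Finset.sum_eq_zero fun k _ => key j k
    rw [Finset.sum_eq_zero fun j _ => h2 j, Complex.zero_re]
  rw [this, zero_add]
  exact integral_nonneg fun z => by positivity

end BasicEstimate

section Mollifiers

open scoped Convolution ENNReal

variable {n : ℕ}

/-- A nonnegative smooth kernel of mass one, invariant under multiplication by unit complex
numbers and vanishing outside the ball of radius `δ`. -/
structure IsMollifier (n : ℕ) (δ : ℝ) (κ : (Fin n → ℂ) → ℝ) : Prop where
  contDiff : ContDiff ℝ (⊤ : ℕ∞) κ
  nonneg : ∀ z, 0 ≤ κ z
  eq_zero : ∀ z, δ ≤ ‖z‖ → κ z = 0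
  integral_eq_one : ∫ z, κ z = 1
  circle : ∀ (a : ℂ) (z : Fin n → ℂ), ‖a‖ = 1 → κ (a • z) = κ z

theorem exists_isMollifier (n : ℕ) {δ : ℝ} (hδ : 0 < δ) : ∃ κ, IsMollifier n δ κ := by
  set q : (Fin n → ℂ) → ℝ := fun z => ∑ j, ‖z j‖ ^ 2 with hq
  set b : (Fin n → ℂ) → ℝ := fun z => Real.smoothTransition (1 - q z / δ ^ 2) with hb
  have hqc : ContDiff ℝ (⊤ : ℕ∞) q :=
    ContDiff.sum fun j _ => (contDiff_apply ℝ ℂ j).norm_sq ℝ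
  have hbc : ContDiff ℝ (⊤ : ℕ∞) b :=
    Real.smoothTransition.contDiff.comp (contDiff_const.sub (hqc.div_const _))
  have hb0 : ∀ z, 0 ≤ b z := fun z => Real.smoothTransition.nonneg _
  have hbz : ∀ z, δ ≤ ‖z‖ → b z = 0 := by
    intro z hz
    refine Real.smoothTransition.zero_of_nonpos ?_
    rw [sub_nonpos, le_div_iff₀ (by positivity), one_mul]
    by_contra! h
    have h2 : ∀ j, ‖z j‖ < δ := fun j => by
      have : ‖z j‖ ^ 2 ≤ q z :=
        Finset.single_le_sum (f := fun j => ‖z j‖ ^ 2) (fun i _ => by positivity)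
          (Finset.mem_univ j)
      exact lt_of_pow_lt_pow_left₀ 2 hδ.le (this.trans_lt h)
    exact absurd ((pi_norm_lt_iff hδ).2 h2) (not_lt.2 hz)
  have hbs : HasCompactSupport b := by
    refine HasCompactSupport.intro (isCompact_closedBall (0 : Fin n → ℂ) δ) fun z hz => hbz z ?_
    rw [mem_closedBall_zero_iff, not_le] at hz
    exact hz.le
  have hpos : 0 < ∫ z, b z := by
    refine (hbc.continuous.integral_pos_of_hasCompactSupport_nonneg_nonzero hbs hb0 (x := 0) ?_)
    simp [hb, hq]
  refine ⟨fun z => (∫ z, b z)⁻¹ * b z, contDiff_const.mul hbc,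
    fun z => mul_nonneg (inv_nonneg.2 hpos.le) (hb0 z), fun z hz => by simp [hbz z hz], ?_, ?_⟩
  · rw [integral_const_mul, inv_mul_cancel₀ hpos.ne']
  · intro a z ha
    simp [hb, hq, ha]

variable {δ : ℝ} {κ : (Fin n → ℂ) → ℝ}

theorem IsMollifier.hasCompactSupport (h : IsMollifier n δ κ) : HasCompactSupport κ := by
  refine HasCompactSupport.intro (isCompact_closedBall (0 : Fin n → ℂ) δ) fun z hz => h.eq_zero z ?_
  rw [mem_closedBall_zero_iff, not_le] at hz
  exact hz.le

theorem IsMollifier.even (h : IsMollifier n δ κ) (z : Fin n → ℂ) : κ (-z) = κ z := by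
  simpa using h.circle (-1) z (by simp)

/-- The mollification `z ↦ ∫ f(w) κ(z - w) dw`. -/
noncomputable def moll (n : ℕ) (κ : (Fin n → ℂ) → ℝ) (f : (Fin n → ℂ) → ℂ) (z : Fin n → ℂ) : ℂ :=
  ∫ w, f w * (κ (z - w) : ℂ)

variable {f : (Fin n → ℂ) → ℂ}

theorem moll_eq_convolution (κ : (Fin n → ℂ) → ℝ) (f : (Fin n → ℂ) → ℂ) :
    moll n κ f = f ⋆[ContinuousLinearMap.mul ℝ ℂ, volume] (fun z => (κ z : ℂ)) := rfl

theorem moll_eq (κ : (Fin n → ℂ) → ℝ) (f : (Fin n → ℂ) → ℂ) (z : Fin n → ℂ) :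
    moll n κ f z = ∫ t, (κ t : ℂ) * f (z - t) := by
  rw [moll, ← integral_sub_left_eq_self (fun w => f w * (κ (z - w) : ℂ)) volume z]
  simp [mul_comm]

theorem IsMollifier.contDiff_moll (h : IsMollifier n δ κ) (hf : LocallyIntegrable f) :
    ContDiff ℝ (⊤ : ℕ∞) (moll n κ f) := by
  rw [moll_eq_convolution]
  exact (h.hasCompactSupport.comp_left (g := ((↑) : ℝ → ℂ)) (by simp)).contDiff_convolution_right _
    hf (contDiff_ofReal_comp h.contDiff)

theorem IsMollifier.dW_moll (h : IsMollifier n δ κ) (hf : LocallyIntegrable f) (c : ℂ) (j : Fin n)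
    (z : Fin n → ℂ) :
    dW n c j (moll n κ f) z = ∫ w, f w * dW n c j (fun z => (κ z : ℂ)) (z - w) := by
  have hs : HasCompactSupport (fun z => (κ z : ℂ)) :=
    h.hasCompactSupport.comp_left (g := ((↑) : ℝ → ℂ)) (by simp)
  have hk : ContDiff ℝ 1 (fun z => (κ z : ℂ)) :=
    (contDiff_ofReal_comp h.contDiff).of_le (by exact_mod_cast le_top)
  have h1 := hs.hasFDerivAt_convolution_right (ContinuousLinearMap.mul ℝ ℂ) hf hk z
  have h2 := fun x => convolution_precompR_apply (ContinuousLinearMap.mul ℝ ℂ) hf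
    (hs.fderiv ℝ) (hk.continuous_fderiv (by norm_num)) z x
  have hex : ∀ x : Fin n → ℂ, Integrable (fun w => f w * fderiv ℝ (fun z => (κ z : ℂ)) (z - w) x) :=
    fun x => HasCompactSupport.convolutionExists_right
      (g := fun y => fderiv ℝ (fun z => (κ z : ℂ)) y x) (ContinuousLinearMap.mul ℝ ℂ)
      ((hs.fderiv ℝ).comp_left (g := fun L : (Fin n → ℂ) →L[ℝ] ℂ => L x) (by simp)) hf
      ((hk.continuous_fderiv (by norm_num)).clm_apply continuous_const) z
  simp only [dW]
  rw [moll_eq_convolution, h1.fderiv, h2, h2]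
  simp only [convolution_def, ContinuousLinearMap.mul_apply']
  rw [← integral_const_mul c, ← integral_add (hex _) ((hex _).const_mul c), ← integral_const_mul]
  refine integral_congr_ae (ae_of_all _ fun w => ?_)
  simp only []; ring

theorem dW_comp_const_sub (c : ℂ) (j : Fin n) {u : (Fin n → ℂ) → ℂ} (hu : ContDiff ℝ 1 u)
    (z w : Fin n → ℂ) : dW n c j (fun w => u (z - w)) w = - dW n c j u (z - w) := by
  have h : HasFDerivAt (fun w => u (z - w)) ((fderiv ℝ u (z - w)).comp
      (-ContinuousLinearMap.id ℝ (Fin n → ℂ))) w :=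
    ((hu.differentiable (by norm_num) (z - w)).hasFDerivAt).comp w
      ((hasFDerivAt_id w).const_sub z)
  simp only [dW, h.fderiv]
  simp; ring

theorem IsMollifier.moll_eq_zero (h : IsMollifier n δ κ) {z : Fin n → ℂ}
    (hz : ∀ w, ‖z - w‖ < δ → f w = 0) : moll n κ f z = 0 := by
  rw [moll]
  refine integral_eq_zero_of_ae (ae_of_all _ fun w => ?_)
  by_cases hw : ‖z - w‖ < δ
  · simp [hz w hw]
  · simp [h.eq_zero _ (not_lt.1 hw)]

theorem IsMollifier.hasCompactSupport_moll (h : IsMollifier n δ κ) {L : Set (Fin n → ℂ)}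
    (hL : IsCompact L) (hf : ∀ z ∉ L, f z = 0) : HasCompactSupport (moll n κ f) := by
  refine HasCompactSupport.intro (hL.cthickening (r := δ)) fun z hz => h.moll_eq_zero fun w hw => ?_
  refine hf w fun hwL => hz ?_
  exact Metric.mem_cthickening_of_dist_le z w δ L hwL (by rw [dist_eq_norm]; exact hw.le)

theorem tendsto_eLpNorm_translate (hf : MemLp f 2) :
    Tendsto (fun t : Fin n → ℂ => eLpNorm (fun z => f (t + z) - f z) 2) (𝓝 0) (𝓝 0) := by
  have hg : Continuous fun t : Fin n → ℂ => (⟨fun z => t + z, by fun_prop⟩ :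
      C(Fin n → ℂ, Fin n → ℂ)) :=
    (ContinuousMap.curry ⟨fun p : (Fin n → ℂ) × (Fin n → ℂ) => p.1 + p.2, by fun_prop⟩).continuous
  have h1 := (continuous_const (y := hf.toLp f)).compMeasurePreservingLp hg
    (fun t => measurePreserving_add_left volume t) (by norm_num)
  have h2 := (h1.tendsto 0).edist (tendsto_const_nhds (x := hf.toLp f))
  simp only [Lp.toLp_compMeasurePreserving, Lp.edist_toLp_toLp] at h2
  simpa [Pi.sub_def, Function.comp_def] using h2

theorem IsMollifier.eLpNorm_moll_sub_le (h : IsMollifier n δ κ) (hf : MemLp f 2) {η : ℝ≥0∞}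
    (hη : ∀ t : Fin n → ℂ, ‖t‖ < δ → eLpNorm (fun z => f (t + z) - f z) 2 ≤ η) :
    eLpNorm (fun z => moll n κ f z - f z) 2 ≤ η := by
  wlog hm : StronglyMeasurable f generalizing f
  · obtain ⟨g, hg, hfg⟩ := hf.1
    have h1 : moll n κ f = moll n κ g := by
      ext z
      exact integral_congr_ae (hfg.mono fun w hw => by simp only [hw])
    have h2 : ∀ t : Fin n → ℂ, (fun z => f (t + z) - f z) =ᵐ[volume] fun z => g (t + z) - g z :=
      fun t => ((measurePreserving_add_left volume t).quasiMeasurePreserving.ae_eq_comp hfg).sub hfg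
    rw [eLpNorm_congr_ae (g := fun z => moll n κ g z - g z)
      (by rw [h1]; exact hfg.mono fun w hw => by simp only [hw])]
    exact this ((memLp_congr_ae hfg).1 hf)
      (fun t ht => by rw [← eLpNorm_congr_ae (h2 t)]; exact hη t ht) hg
  set μ : Measure (Fin n → ℂ) := volume.withDensity fun t => ENNReal.ofReal (κ t) with hμ
  have hκm : Measurable fun t => ENNReal.ofReal (κ t) :=
    ENNReal.measurable_ofReal.comp h.contDiff.continuous.measurable
  have hκi : Integrable κ := h.contDiff.continuous.integrable_of_hasCompactSupport h.hasCompactSupport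
  have hκc : Integrable fun t => (κ t : ℂ) := hκi.ofReal
  have : IsProbabilityMeasure μ := ⟨by
    rw [hμ, withDensity_apply _ MeasurableSet.univ, Measure.restrict_univ,
      ← ofReal_integral_eq_lintegral_ofReal hκi (ae_of_all _ h.nonneg), h.integral_eq_one,
      ENNReal.ofReal_one]⟩
  have hloc : LocallyIntegrable f := hf.locallyIntegrable (by norm_num)
  have hInt : ∀ z, Integrable (fun t => (κ t : ℂ) * f (z - t)) := fun z => by
    have : Integrable fun w => f w * (κ (z - w) : ℂ) :=
      HasCompactSupport.convolutionExists_right (ContinuousLinearMap.mul ℝ ℂ)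
        (h.hasCompactSupport.comp_left (g := ((↑) : ℝ → ℂ)) (by simp)) hloc
        (contDiff_ofReal_comp h.contDiff).continuous z
    have := this.comp_sub_left z
    simpa [mul_comm] using this
  have hpt : ∀ z, ‖moll n κ f z - f z‖ₑ ≤ ∫⁻ t, ‖f (z - t) - f z‖ₑ ∂μ := fun z => by
    have e1 : f z = ∫ t, (κ t : ℂ) * f z := by
      rw [integral_mul_const, integral_complex_ofReal, h.integral_eq_one]; simp
    have e2 : moll n κ f z - f z = ∫ t, (κ t : ℂ) * (f (z - t) - f z) := by
      conv_lhs => rw [e1]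
      rw [moll_eq, ← integral_sub (hInt z) (hκc.mul_const _)]
      simp only [mul_sub]
    rw [e2, hμ, lintegral_withDensity_eq_lintegral_mul _ hκm (by fun_prop)]
    refine (enorm_integral_le_lintegral_enorm _).trans (lintegral_mono fun t => ?_)
    rw [enorm_mul, Pi.mul_apply]
    gcongr
    rw [← ofReal_norm, Complex.norm_real, Real.norm_of_nonneg (h.nonneg t)]
  have hsq : ∀ z, (∫⁻ t, ‖f (z - t) - f z‖ₑ ∂μ) ^ (2 : ℝ)
      ≤ ∫⁻ t, ‖f (z - t) - f z‖ₑ ^ (2 : ℝ) ∂μ := fun z => by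
    have := eLpNorm_le_eLpNorm_of_exponent_le (μ := μ) (p := 1) (q := 2) (by norm_num)
      (f := fun t => f (z - t) - f z)
      ((hm.comp_measurable (by fun_prop)).sub stronglyMeasurable_const).aestronglyMeasurable
    rw [eLpNorm_one_eq_lintegral_enorm, eLpNorm_eq_lintegral_rpow_enorm_toReal (by norm_num)
      (by norm_num)] at this
    have h3 := ENNReal.rpow_le_rpow this (z := 2) (by norm_num)
    rw [← ENNReal.rpow_mul] at h3
    simpa using h3
  have hsupp : ∀ᵐ t ∂μ, ‖t‖ < δ := by
    rw [hμ, ae_withDensity_iff hκm]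
    refine ae_of_all _ fun t ht => ?_
    by_contra hlt
    exact ht (by rw [h.eq_zero t (not_lt.1 hlt), ENNReal.ofReal_zero])
  have hmain : ∫⁻ z, ‖moll n κ f z - f z‖ₑ ^ (2 : ℝ) ≤ η ^ (2 : ℝ) := by
    calc ∫⁻ z, ‖moll n κ f z - f z‖ₑ ^ (2 : ℝ)
        ≤ ∫⁻ z, ∫⁻ t, ‖f (z - t) - f z‖ₑ ^ (2 : ℝ) ∂μ := by
          refine lintegral_mono fun z => le_trans ?_ (hsq z)
          exact ENNReal.rpow_le_rpow (hpt z) (by norm_num)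
      _ = ∫⁻ t, ∫⁻ z, ‖f (z - t) - f z‖ₑ ^ (2 : ℝ) ∂volume ∂μ :=
          lintegral_lintegral_swap (by fun_prop)
      _ ≤ ∫⁻ t, η ^ (2 : ℝ) ∂μ := by
          refine lintegral_mono_ae (hsupp.mono fun t ht => ?_)
          have h4 := ENNReal.rpow_le_rpow (hη (-t) (by rwa [norm_neg])) (z := 2) (by norm_num)
          rw [eLpNorm_eq_lintegral_rpow_enorm_toReal (by norm_num) (by norm_num),
            ← ENNReal.rpow_mul] at h4
          simpa [neg_add_eq_sub] using h4
      _ = η ^ (2 : ℝ) := by simp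
  rw [eLpNorm_eq_lintegral_rpow_enorm_toReal (by norm_num) (by norm_num)]
  have h5 := ENNReal.rpow_le_rpow hmain (z := 1 / 2) (by norm_num)
  rw [← ENNReal.rpow_mul] at h5
  simpa using h5

end Mollifiers

section SquareIntegrable

open scoped ENNReal

variable {n : ℕ}

/-- The functions `F i` are square integrable and converge in mean square to `f`. -/
structure L2Tendsto (n : ℕ) (F : ℕ → (Fin n → ℂ) → ℂ) (f : (Fin n → ℂ) → ℂ) : Prop where
  memLp : ∀ i, MemLp (F i) 2
  memLp_lim : MemLp f 2
  tendsto : Tendsto (fun i => eLpNorm (fun z => F i z - f z) 2) atTop (𝓝 0)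

variable {F G : ℕ → (Fin n → ℂ) → ℂ} {f g m : (Fin n → ℂ) → ℂ} {C : ℝ}

theorem L2Tendsto.sub (hF : L2Tendsto n F f) (hG : L2Tendsto n G g) :
    L2Tendsto n (fun i z => F i z - G i z) (fun z => f z - g z) := by
  refine ⟨fun i => (hF.memLp i).sub (hG.memLp i), hF.memLp_lim.sub hG.memLp_lim, ?_⟩
  have h := hF.tendsto.add hG.tendsto
  rw [add_zero] at h
  refine tendsto_of_tendsto_of_tendsto_of_le_of_le tendsto_const_nhds h (fun _ => zero_le) fun i => ?_
  have e : (fun z => F i z - G i z - (f z - g z))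
      = (fun z => F i z - f z) - fun z => G i z - g z := by
    ext z
    rw [Pi.sub_apply]
    ring
  have h1 : MemLp (fun z => F i z - f z) 2 := (hF.memLp i).sub hF.memLp_lim
  have h2 : MemLp (fun z => G i z - g z) 2 := (hG.memLp i).sub hG.memLp_lim
  simp only [e]
  exact eLpNorm_sub_le h1.1 h2.1 (by norm_num)

theorem L2Tendsto.add (hF : L2Tendsto n F f) (hG : L2Tendsto n G g) :
    L2Tendsto n (fun i z => F i z + G i z) (fun z => f z + g z) := by
  refine ⟨fun i => (hF.memLp i).add (hG.memLp i), hF.memLp_lim.add hG.memLp_lim, ?_⟩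
  have h := hF.tendsto.add hG.tendsto
  rw [add_zero] at h
  refine tendsto_of_tendsto_of_tendsto_of_le_of_le tendsto_const_nhds h (fun _ => zero_le) fun i => ?_
  have e : (fun z => F i z + G i z - (f z + g z))
      = (fun z => F i z - f z) + fun z => G i z - g z := by
    ext z
    rw [Pi.add_apply]
    ring
  have h1 : MemLp (fun z => F i z - f z) 2 := (hF.memLp i).sub hF.memLp_lim
  have h2 : MemLp (fun z => G i z - g z) 2 := (hG.memLp i).sub hG.memLp_lim
  simp only [e]
  exact eLpNorm_add_le h1.1 h2.1 (by norm_num)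

theorem L2Tendsto.zero : L2Tendsto n (fun _ _ => 0) (fun _ => 0) where
  memLp _ := MemLp.zero'
  memLp_lim := MemLp.zero'
  tendsto := by simp

theorem L2Tendsto.sum {ι : Type*} (s : Finset ι) {F : ι → ℕ → (Fin n → ℂ) → ℂ}
    {f : ι → (Fin n → ℂ) → ℂ} (h : ∀ j, L2Tendsto n (F j) (f j)) :
    L2Tendsto n (fun i z => ∑ j ∈ s, F j i z) (fun z => ∑ j ∈ s, f j z) := by
  classical
  induction s using Finset.induction_on with
  | empty => simpa using L2Tendsto.zero
  | insert a s ha ih => simpa [Finset.sum_insert ha] using (h a).add ih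

theorem memLp_two_bdd_mul (hf : MemLp f 2) (hm : Continuous m) (hb : ∀ z, ‖m z‖ ≤ C) :
    MemLp (fun z => m z * f z) 2 :=
  hf.of_le_mul (hm.aestronglyMeasurable.mul hf.1) (c := C) (ae_of_all _ fun z => by
    rw [norm_mul]
    exact mul_le_mul_of_nonneg_right (hb z) (norm_nonneg _))

theorem L2Tendsto.bdd_mul (hF : L2Tendsto n F f) (hm : Continuous m) (hb : ∀ z, ‖m z‖ ≤ C) :
    L2Tendsto n (fun i z => m z * F i z) (fun z => m z * f z) where
  memLp i := memLp_two_bdd_mul (hF.memLp i) hm hb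
  memLp_lim := memLp_two_bdd_mul hF.memLp_lim hm hb
  tendsto := by
    have h := ENNReal.Tendsto.const_mul (a := ENNReal.ofReal C) hF.tendsto
      (Or.inr ENNReal.ofReal_ne_top)
    rw [mul_zero] at h
    refine tendsto_of_tendsto_of_tendsto_of_le_of_le tendsto_const_nhds h (fun _ => zero_le) ?_
    intro i
    refine eLpNorm_le_mul_eLpNorm_of_ae_le_mul (ae_of_all _ fun z => ?_) 2
    rw [← mul_sub, norm_mul]
    exact mul_le_mul_of_nonneg_right (hb z) (norm_nonneg _)

theorem integrable_mul_conj (hf : MemLp f 2) (hg : MemLp g 2) :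
    Integrable fun z => f z * (starRingEnd ℂ) (g z) := by
  have h2 : MemLp (fun z => (starRingEnd ℂ) (g z)) 2 := hg.star
  exact MemLp.integrable_mul hf h2

theorem inner_toLp_eq (hf : MemLp f 2) (hg : MemLp g 2) :
    inner ℂ (hg.toLp g) (hf.toLp f) = ∫ z, f z * (starRingEnd ℂ) (g z) := by
  rw [L2.inner_def]
  refine integral_congr_ae ?_
  filter_upwards [hf.coeFn_toLp, hg.coeFn_toLp] with z h1 h2
  rw [h1, h2]
  simp [inner]

theorem L2Tendsto.toLp (hF : L2Tendsto n F f) :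
    Tendsto (fun i => (hF.memLp i).toLp (F i)) atTop (𝓝 (hF.memLp_lim.toLp f)) := by
  rw [tendsto_iff_edist_tendsto_0]
  simp only [Lp.edist_toLp_toLp]
  exact hF.tendsto

theorem L2Tendsto.integral_mul_conj (hF : L2Tendsto n F f) (hG : L2Tendsto n G g) :
    Tendsto (fun i => ∫ z, F i z * (starRingEnd ℂ) (G i z)) atTop
      (𝓝 (∫ z, f z * (starRingEnd ℂ) (g z))) := by
  simp only [← inner_toLp_eq (hF.memLp _) (hG.memLp _), ← inner_toLp_eq hF.memLp_lim hG.memLp_lim]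
  exact hG.toLp.inner hF.toLp

/-- Weighted square norms converge along mean-square convergent sequences. -/
theorem L2Tendsto.integral_norm_sq (hF : L2Tendsto n F f) {w : (Fin n → ℂ) → ℝ}
    (hw : Continuous w) (hb : ∀ z, |w z| ≤ C) :
    Tendsto (fun i => ∫ z, ‖F i z‖ ^ 2 * w z) atTop (𝓝 (∫ z, ‖f z‖ ^ 2 * w z)) := by
  have h := (hF.bdd_mul (m := fun z => (w z : ℂ)) (by fun_prop) (C := C)
    (fun z => by simpa using hb z)).integral_mul_conj hF
  have key : ∀ u : (Fin n → ℂ) → ℂ,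
      ((∫ z, (w z : ℂ) * u z * (starRingEnd ℂ) (u z)) : ℂ) = ((∫ z, ‖u z‖ ^ 2 * w z : ℝ) : ℂ) := by
    intro u
    rw [← integral_complex_ofReal]
    refine integral_congr_ae (ae_of_all _ fun z => ?_)
    simp only [mul_assoc, Complex.mul_conj, Complex.normSq_eq_norm_sq]
    push_cast; ring
  simp only [key] at h
  exact (Complex.continuous_re.tendsto _).comp h

theorem integrable_norm_sq_mul (hf : MemLp f 2) {w : (Fin n → ℂ) → ℝ}
    (hw : Continuous w) (hb : ∀ z, |w z| ≤ C) : Integrable fun z => ‖f z‖ ^ 2 * w z :=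
  Integrable.mul_bdd (c := C) hf.norm.integrable_sq hw.aestronglyMeasurable
    (ae_of_all _ fun z => by simpa using hb z)

theorem IsMollifier.memLp_moll {δ : ℝ} {κ : (Fin n → ℂ) → ℝ} (h : IsMollifier n δ κ)
    (hf : MemLp f 2) : MemLp (moll n κ f) 2 := by
  have h1 : eLpNorm (fun z => moll n κ f z - f z) 2 ≤ eLpNorm f 2 + eLpNorm f 2 := by
    refine h.eLpNorm_moll_sub_le hf fun t _ => ?_
    have hp := measurePreserving_add_left (volume : Measure (Fin n → ℂ)) t
    have h2 := eLpNorm_sub_le (hf.comp_measurePreserving hp).1 hf.1 (p := 2) (by norm_num)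
    rw [eLpNorm_comp_measurePreserving hf.1 hp] at h2
    exact h2
  have hm : AEStronglyMeasurable (moll n κ f) :=
    (h.contDiff_moll (hf.locallyIntegrable (by norm_num))).continuous.aestronglyMeasurable
  have h3 : MemLp (fun z => moll n κ f z - f z) 2 :=
    ⟨hm.sub hf.1, h1.trans_lt (ENNReal.add_lt_top.2 ⟨hf.2, hf.2⟩)⟩
  have h4 := h3.add hf
  have e : (fun z => moll n κ f z - f z) + f = moll n κ f := by
    ext z; simp
  rwa [e] at h4

theorem l2Tendsto_moll {κ : ℕ → (Fin n → ℂ) → ℝ}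
    (h : ∀ i : ℕ, IsMollifier n (1 / ((i : ℝ) + 1)) (κ i)) (hf : MemLp f 2) :
    L2Tendsto n (fun i => moll n (κ i) f) f where
  memLp i := (h i).memLp_moll hf
  memLp_lim := hf
  tendsto := by
    rw [ENNReal.tendsto_atTop_zero]
    intro ε hε
    obtain ⟨r, hr, hball⟩ := Metric.eventually_nhds_iff.1
      ((tendsto_eLpNorm_translate hf).eventually (ge_mem_nhds hε))
    obtain ⟨N, hN⟩ := exists_nat_one_div_lt hr
    refine ⟨N, fun i hi => (h i).eLpNorm_moll_sub_le hf fun t ht => hball ?_⟩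
    rw [dist_zero_right]
    refine ht.trans (lt_of_le_of_lt ?_ hN)
    gcongr

theorem exists_smooth_cutoff {Ω K : Set (Fin n → ℂ)} (hΩ : IsOpen Ω) (hK : IsCompact K)
    (hKΩ : K ⊆ Ω) : ∃ χ : (Fin n → ℂ) → ℝ, ContDiff ℝ (⊤ : ℕ∞) χ ∧ HasCompactSupport χ ∧
      tsupport χ ⊆ Ω ∧ (∀ᶠ z in 𝓝ˢ K, χ z = 1) ∧ ∀ z, χ z ∈ Icc (0 : ℝ) 1 := by
  obtain ⟨L, hL, hKL, hLΩ⟩ := exists_compact_between hK hΩ hKΩ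
  obtain ⟨f, h0, h1, hf⟩ := exists_contMDiffMap_zero_one_nhds_of_isClosed
    (n := (⊤ : ℕ∞)) (modelWithCornersSelf ℝ (Fin n → ℂ))
    (isOpen_interior (s := L)).isClosed_compl hK.isClosed
    (disjoint_compl_left_iff_subset.2 hKL)
  have hz : ∀ z ∉ L, f z = 0 := fun z hz =>
    h0.self_of_nhdsSet _ fun h => hz (interior_subset h)
  have hs : tsupport f ⊆ L :=
    closure_minimal (fun z hz' => by_contra fun h => hz' (hz z h)) hL.isClosed
  exact ⟨f, f.contMDiff.contDiff, HasCompactSupport.intro hL hz, hs.trans hLΩ, h1, hf⟩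

end SquareIntegrable

section WeakBasicEstimate

open scoped ENNReal

variable {n : ℕ}

theorem contDiff_mollifier_translate {δ : ℝ} {κ : (Fin n → ℂ) → ℝ} (h : IsMollifier n δ κ)
    (z : Fin n → ℂ) : ContDiff ℝ (⊤ : ℕ∞) (fun w => (κ (z - w) : ℂ)) :=
  (contDiff_ofReal_comp h.contDiff).comp (contDiff_const.sub contDiff_id)

theorem hasCompactSupport_mollifier_translate {δ : ℝ} {κ : (Fin n → ℂ) → ℝ}
    (h : IsMollifier n δ κ) (z : Fin n → ℂ) : HasCompactSupport (fun w => (κ (z - w) : ℂ)) := by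
  have h1 := h.hasCompactSupport.comp_left (g := ((↑) : ℝ → ℂ)) (by simp)
  exact h1.comp_homeomorph (Homeomorph.subLeft z)

theorem LocallyIntegrable.integrable_mul_of_hasCompactSupport {f g : (Fin n → ℂ) → ℂ}
    (hf : LocallyIntegrable f) (hg : Continuous g) (hc : HasCompactSupport g) :
    Integrable fun z => f z * g z := by
  have := hf.integrable_smul_left_of_hasCompactSupport hg hc
  simpa [mul_comm] using this

theorem IsMollifier.dW_moll_eq {δ : ℝ} {κ : (Fin n → ℂ) → ℝ} (h : IsMollifier n δ κ)
    {f : (Fin n → ℂ) → ℂ} (hf : LocallyIntegrable f) (c : ℂ) (j : Fin n) (z : Fin n → ℂ) :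
    dW n c j (moll n κ f) z = - ∫ w, f w * dW n c j (fun w => (κ (z - w) : ℂ)) w := by
  have hk : ContDiff ℝ 1 (fun z => (κ z : ℂ)) :=
    (contDiff_ofReal_comp h.contDiff).of_le (by exact_mod_cast le_top)
  rw [h.dW_moll hf, ← integral_neg]
  simp only [dW_comp_const_sub c j hk, mul_neg, neg_neg]

theorem integrable_mul_dW_translate {δ : ℝ} {κ : (Fin n → ℂ) → ℝ} (h : IsMollifier n δ κ)
    {f : (Fin n → ℂ) → ℂ} (hf : LocallyIntegrable f) (c : ℂ) (j : Fin n) (z : Fin n → ℂ) :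
    Integrable fun w => f w * dW n c j (fun w => (κ (z - w) : ℂ)) w :=
  LocallyIntegrable.integrable_mul_of_hasCompactSupport hf
    (dW_continuous c j ((contDiff_mollifier_translate h z).of_le (by exact_mod_cast le_top)))
    (dW_hasCompactSupport c j (hasCompactSupport_mollifier_translate h z))

variable {γ : Fin n → (Fin n → ℂ) → ℂ} {D : (Fin n → ℂ) → ℂ} {R : Fin n → Fin n → (Fin n → ℂ) → ℂ}

/-- `D` is the weak divergence `∑ ∂γ_j/∂z_j`. -/
def HasWeakDiv (n : ℕ) (γ : Fin n → (Fin n → ℂ) → ℂ) (D : (Fin n → ℂ) → ℂ) : Prop :=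
  ∀ ψ : (Fin n → ℂ) → ℂ, ContDiff ℝ (⊤ : ℕ∞) ψ → HasCompactSupport ψ →
    ∫ z, ∑ j, γ j z * wder n j ψ z = - ∫ z, D z * ψ z

/-- `R j k` is the weak derivative `∂γ_k/∂z̄_j - ∂γ_j/∂z̄_k`. -/
def HasWeakCurl (n : ℕ) (γ : Fin n → (Fin n → ℂ) → ℂ) (R : Fin n → Fin n → (Fin n → ℂ) → ℂ) :
    Prop :=
  ∀ j k, ∀ ψ : (Fin n → ℂ) → ℂ, ContDiff ℝ (⊤ : ℕ∞) ψ → HasCompactSupport ψ →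
    ∫ z, (γ k z * wderBar n j ψ z - γ j z * wderBar n k ψ z) = - ∫ z, R j k z * ψ z

theorem HasWeakDiv.moll {δ : ℝ} {κ : (Fin n → ℂ) → ℝ} (h : IsMollifier n δ κ)
    (hγ : ∀ j, MemLp (γ j) 2) (hD : HasWeakDiv n γ D) (z : Fin n → ℂ) :
    ∑ j, wder n j (moll n κ (γ j)) z = moll n κ D z := by
  have hl : ∀ j, LocallyIntegrable (γ j) := fun j => (hγ j).locallyIntegrable (by norm_num)
  have h1 := hD _ (contDiff_mollifier_translate h z) (hasCompactSupport_mollifier_translate h z)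
  simp only [wder_eq_dW] at h1 ⊢
  simp only [h.dW_moll_eq (hl _), Finset.sum_neg_distrib]
  rw [integral_finsetSum _ fun j _ => integrable_mul_dW_translate h (hl j) _ j z] at h1
  rw [h1, neg_neg]; rfl

theorem HasWeakCurl.moll {δ : ℝ} {κ : (Fin n → ℂ) → ℝ} (h : IsMollifier n δ κ)
    (hγ : ∀ j, MemLp (γ j) 2) (hR : HasWeakCurl n γ R) (j k : Fin n) (z : Fin n → ℂ) :
    wderBar n j (moll n κ (γ k)) z - wderBar n k (moll n κ (γ j)) z = moll n κ (R j k) z := by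
  have hl : ∀ j, LocallyIntegrable (γ j) := fun j => (hγ j).locallyIntegrable (by norm_num)
  have h1 := hR j k _ (contDiff_mollifier_translate h z)
    (hasCompactSupport_mollifier_translate h z)
  simp only [wderBar_eq_dW] at h1 ⊢
  simp only [h.dW_moll_eq (hl _)]
  rw [integral_sub (integrable_mul_dW_translate h (hl k) _ j z)
    (integrable_mul_dW_translate h (hl j) _ k z)] at h1
  rw [show _root_.moll n κ (R j k) z = ∫ w, R j k w * (κ (z - w) : ℂ) from rfl]
  linear_combination -h1

variable {φ : (Fin n → ℂ) → ℝ}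

theorem exists_bound_of_hasCompactSupport {m : (Fin n → ℂ) → ℂ} (hm : Continuous m)
    (hc : HasCompactSupport m) : ∃ C, ∀ z, ‖m z‖ ≤ C := hc.exists_bound_of_continuous hm

theorem integrable_hermForm_mul {H : (Fin n → ℂ) → Fin n → Fin n → ℂ} {w : (Fin n → ℂ) → ℝ}
    (hHc : ∀ j k, Continuous fun z => H z j k * (w z : ℂ)) {C : ℝ}
    (hHb : ∀ j k z, ‖H z j k * (w z : ℂ)‖ ≤ C) (hγ : ∀ j, MemLp (γ j) 2) :
    Integrable (fun z => hermForm n (H z) (fun j => γ j z) (fun j => γ j z) * w z) ∧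
    ∫ z, hermForm n (H z) (fun j => γ j z) (fun j => γ j z) * w z
      = (∑ j, ∑ k, ∫ z, H z j k * (w z : ℂ) * γ j z * (starRingEnd ℂ) (γ k z)).re := by
  have h1 : ∀ z, hermForm n (H z) (fun j => γ j z) (fun j => γ j z) * w z
      = (∑ j, ∑ k, H z j k * (w z : ℂ) * γ j z * (starRingEnd ℂ) (γ k z)).re := by
    intro z
    rw [hermForm, ← Complex.re_mul_ofReal, Finset.sum_mul]
    congr 1
    refine Finset.sum_congr rfl fun j _ => ?_
    rw [Finset.sum_mul]
    exact Finset.sum_congr rfl fun k _ => by ring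
  have hi : ∀ j k, Integrable fun z => H z j k * (w z : ℂ) * γ j z * (starRingEnd ℂ) (γ k z) :=
    fun j k => integrable_mul_conj (memLp_two_bdd_mul (hγ j) (hHc j k) (hHb j k)) (hγ k)
  have hj : ∀ j ∈ Finset.univ, Integrable fun z =>
      ∑ k, H z j k * (w z : ℂ) * γ j z * (starRingEnd ℂ) (γ k z) :=
    fun j _ => integrable_finsetSum _ fun k _ => hi j k
  simp only [h1]
  have hI := integrable_finsetSum _ hj
  refine ⟨hI.re, ?_⟩
  have h2 := integral_re hI
  simp only [RCLike.re_to_complex] at h2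
  rw [h2, integral_finsetSum _ hj]
  congr 2
  ext j
  exact integral_finsetSum _ fun k _ => hi j k

theorem tendsto_integral_hermForm_mul {H : (Fin n → ℂ) → Fin n → Fin n → ℂ}
    {w : (Fin n → ℂ) → ℝ}
    (hHc : ∀ j k, Continuous fun z => H z j k * (w z : ℂ)) {C : ℝ}
    (hHb : ∀ j k z, ‖H z j k * (w z : ℂ)‖ ≤ C) {Γ : Fin n → ℕ → (Fin n → ℂ) → ℂ}
    (h : ∀ j, L2Tendsto n (Γ j) (γ j)) :
    Tendsto (fun i => ∫ z, hermForm n (H z) (fun j => Γ j i z) (fun j => Γ j i z) * w z) atTop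
      (𝓝 (∫ z, hermForm n (H z) (fun j => γ j z) (fun j => γ j z) * w z)) := by
  rw [(integrable_hermForm_mul hHc hHb fun j => (h j).memLp_lim).2]
  simp only [fun i => (integrable_hermForm_mul hHc hHb (γ := fun j => Γ j i)
    fun j => (h j).memLp i).2]
  refine (Complex.continuous_re.tendsto _).comp ?_
  refine tendsto_finsetSum _ fun j _ => tendsto_finsetSum _ fun k _ => ?_
  exact ((h j).bdd_mul (hHc j k) (hHb j k)).integral_mul_conj (h k)

theorem integral_rhs_eq {T : (Fin n → ℂ) → ℂ} {w : (Fin n → ℂ) → ℝ} (hw : Continuous w) {C : ℝ}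
    (hb : ∀ z, |w z| ≤ C) (hT : MemLp T 2) (hR : ∀ j k, MemLp (R j k) 2) :
    ∫ z, (‖T z‖ ^ 2 + (1 / 2 : ℝ) * ∑ j, ∑ k, ‖R j k z‖ ^ 2) * w z
      = (∫ z, ‖T z‖ ^ 2 * w z) + (1 / 2 : ℝ) * ∑ j, ∑ k, ∫ z, ‖R j k z‖ ^ 2 * w z := by
  have i1 := integrable_norm_sq_mul hT hw hb
  have i2 := fun j k => integrable_norm_sq_mul (hR j k) hw hb
  have i3 : ∀ j ∈ Finset.univ, Integrable fun z => ∑ k, ‖R j k z‖ ^ 2 * w z :=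
    fun j _ => integrable_finsetSum _ fun k _ => i2 j k
  have e : ∀ z, (‖T z‖ ^ 2 + (1 / 2 : ℝ) * ∑ j, ∑ k, ‖R j k z‖ ^ 2) * w z
      = ‖T z‖ ^ 2 * w z + (1 / 2 : ℝ) * ∑ j, ∑ k, ‖R j k z‖ ^ 2 * w z := by
    intro z
    simp only [← Finset.sum_mul]; ring
  simp only [e]
  rw [integral_add i1 ((integrable_finsetSum _ i3).const_mul _), integral_const_mul,
    integral_finsetSum _ i3]
  congr 3
  ext j
  exact integral_finsetSum _ fun k _ => i2 j k

/-- The basic estimate for compactly supported square-integrable forms with square-integrable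
weak divergence and weak curl, for a compactly supported weight. -/
theorem basic_estimate_of_hasCompactSupport (hφ : ContDiff ℝ 2 φ) (hφc : HasCompactSupport φ)
    (hγ : ∀ j, MemLp (γ j) 2) {L : Set (Fin n → ℂ)} (hL : IsCompact L)
    (hγL : ∀ j, ∀ z ∉ L, γ j z = 0) (hD : MemLp D 2) (hR : ∀ j k, MemLp (R j k) 2)
    (hwD : HasWeakDiv n γ D) (hwR : HasWeakCurl n γ R) :
    ∫ z, hermForm n (cHess n φ z) (fun j => γ j z) (fun j => γ j z) * Real.exp (-φ z)
      ≤ ∫ z, (‖D z - ∑ j, wder n j (fun v => (φ v : ℂ)) z * γ j z‖ ^ 2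
        + (1 / 2 : ℝ) * ∑ j, ∑ k, ‖R j k z‖ ^ 2) * Real.exp (-φ z) := by
  choose κ hκ using fun i : ℕ => exists_isMollifier n (δ := 1 / ((i : ℝ) + 1)) (by positivity)
  have hφcc : HasCompactSupport (fun v => (φ v : ℂ)) :=
    hφc.comp_left (g := ((↑) : ℝ → ℂ)) (by simp)
  have hP : ∀ j, ContDiff ℝ 1 (wder n j (fun v => (φ v : ℂ))) := fun j => by
    rw [wder_eq_dW]; exact dW_contDiff _ _ (contDiff_ofReal_comp hφ) (by norm_num)
  have hPc : ∀ j, HasCompactSupport (wder n j (fun v => (φ v : ℂ))) := fun j => by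
    rw [wder_eq_dW]; exact dW_hasCompactSupport _ _ hφcc
  have hH : ∀ j k, Continuous (fun z => cHess n φ z j k) := fun j k => by
    simp only [cHess, wderBar_eq_dW]
    exact dW_continuous _ _ (hP j)
  have hHc : ∀ j k, HasCompactSupport (fun z => cHess n φ z j k) := fun j k => by
    simp only [cHess, wderBar_eq_dW]
    exact dW_hasCompactSupport _ _ (hPc j)
  have hw : Continuous fun z => Real.exp (-φ z) := Real.continuous_exp.comp hφ.continuous.neg
  obtain ⟨C0, hC0⟩ := hφc.exists_bound_of_continuous hφ.continuous
  have hwb : ∀ z, |Real.exp (-φ z)| ≤ Real.exp C0 := fun z => by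
    rw [abs_of_pos (Real.exp_pos _)]
    exact Real.exp_le_exp.2 ((neg_le_abs _).trans (hC0 z))
  have hHw : ∀ j k, Continuous fun z => cHess n φ z j k * ((Real.exp (-φ z) : ℝ) : ℂ) :=
    fun j k => (hH j k).mul (Complex.continuous_ofReal.comp hw)
  choose C1 hC1 using fun j k => exists_bound_of_hasCompactSupport (hHw j k) (hHc j k).mul_right
  choose C2 hC2 using fun j => exists_bound_of_hasCompactSupport (hP j).continuous (hPc j)
  have hC1' : ∀ j k z, ‖cHess n φ z j k * ((Real.exp (-φ z) : ℝ) : ℂ)‖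
      ≤ ∑ j, ∑ k, |C1 j k| := fun j k z => by
    refine (hC1 j k z).trans ((le_abs_self _).trans ?_)
    refine (Finset.single_le_sum (f := fun k => |C1 j k|) (fun _ _ => abs_nonneg _)
      (Finset.mem_univ k)).trans ?_
    exact Finset.single_le_sum (f := fun j => ∑ k, |C1 j k|)
      (fun _ _ => Finset.sum_nonneg fun _ _ => abs_nonneg _) (Finset.mem_univ j)
  have hΓ : ∀ j, L2Tendsto n (fun i => moll n (κ i) (γ j)) (γ j) :=
    fun j => l2Tendsto_moll hκ (hγ j)
  have hDt : L2Tendsto n (fun i => moll n (κ i) D) D := l2Tendsto_moll hκ hD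
  have hRt : ∀ j k, L2Tendsto n (fun i => moll n (κ i) (R j k)) (R j k) :=
    fun j k => l2Tendsto_moll hκ (hR j k)
  have hT := hDt.sub (L2Tendsto.sum Finset.univ fun j => (hΓ j).bdd_mul (hP j).continuous (hC2 j))
  have hlhs := tendsto_integral_hermForm_mul hHw hC1' hΓ
  have hrhs := (hT.integral_norm_sq hw hwb).add ((tendsto_finsetSum Finset.univ fun j _ =>
    tendsto_finsetSum Finset.univ fun k _ => (hRt j k).integral_norm_sq hw hwb).const_mul
      (1 / 2 : ℝ))
  rw [integral_rhs_eq hw hwb hT.memLp_lim hR]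
  refine le_of_tendsto_of_tendsto' hlhs hrhs fun i => ?_
  rw [← integral_rhs_eq hw hwb (hT.memLp i) fun j k => (hRt j k).memLp i]
  have hl : ∀ j, LocallyIntegrable (γ j) := fun j => (hγ j).locallyIntegrable (by norm_num)
  have h := kohn_morrey_hormander hφ (α := fun j => moll n (κ i) (γ j))
    (fun j => ((hκ i).contDiff_moll (hl j)).of_le (by norm_cast))
    (fun j => (hκ i).hasCompactSupport_moll hL (hγL j))
  refine h.trans (le_of_eq (integral_congr_ae (ae_of_all _ fun z => ?_)))
  simp only [twDer, Finset.sum_sub_distrib, hwD.moll (hκ i) hγ, hwR.moll (hκ i) hγ]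

theorem cHess_congr {φ ψ : (Fin n → ℂ) → ℝ} {z : Fin n → ℂ} (h : φ =ᶠ[𝓝 z] ψ) (j k : Fin n) :
    cHess n φ z j k = cHess n ψ z j k := by
  simp only [cHess, wder_eq_dW, wderBar_eq_dW]
  refine dW_congr _ _ ?_
  filter_upwards [h.eventuallyEq_nhds] with w hw
  exact dW_congr _ _ (hw.mono fun v hv => by simp only [hv])

theorem wder_congr {u v : (Fin n → ℂ) → ℂ} {z : Fin n → ℂ} (h : u =ᶠ[𝓝 z] v) (j : Fin n) :
    wder n j u z = wder n j v z := by
  simp only [wder_eq_dW]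
  exact dW_congr _ _ h

end WeakBasicEstimate

section Projection

variable {n : ℕ}

theorem l2Tendsto_of_tendsto_Lp {x : ℕ → Lp ℂ 2 (volume : Measure (Fin n → ℂ))}
    {b : Lp ℂ 2 (volume : Measure (Fin n → ℂ))} {F : ℕ → (Fin n → ℂ) → ℂ}
    (hF : ∀ i, x i =ᵐ[volume] F i) (h : Tendsto x atTop (𝓝 b)) : L2Tendsto n F b := by
  refine ⟨fun i => (Lp.memLp (x i)).ae_eq (hF i), Lp.memLp b, ?_⟩
  rw [tendsto_iff_edist_tendsto_0] at h
  refine h.congr fun i => ?_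
  rw [Lp.edist_def]
  refine eLpNorm_congr_ae ?_
  filter_upwards [hF i] with z hz
  rw [Pi.sub_apply, hz]

/-- Orthogonal projection in `L²`, phrased with functions. -/
theorem exists_l2_projection {ι : Type*} [Fintype ι] (S : Set (ι → (Fin n → ℂ) → ℂ))
    (h0 : (fun _ _ => 0) ∈ S) (hadd : ∀ s ∈ S, ∀ t ∈ S, (fun j z => s j z + t j z) ∈ S)
    (hsmul : ∀ (c : ℂ), ∀ s ∈ S, (fun j z => c * s j z) ∈ S)
    (hS : ∀ s ∈ S, ∀ j, MemLp (s j) 2) (a : ι → (Fin n → ℂ) → ℂ) (ha : ∀ j, MemLp (a j) 2) :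
    ∃ (B : ι → (Fin n → ℂ) → ℂ) (s : ℕ → ι → (Fin n → ℂ) → ℂ), (∀ i, s i ∈ S) ∧
      (∀ j, L2Tendsto n (fun i => s i j) (B j)) ∧
      ∀ t ∈ S, ∑ j, ∫ z, (a j z - B j z) * (starRingEnd ℂ) (t j z) = 0 := by
  let H := PiLp 2 (fun _ : ι => Lp ℂ 2 (volume : Measure (Fin n → ℂ)))
  let V : Submodule ℂ H :=
    { carrier := {x | ∃ t ∈ S, ∀ j, x j =ᵐ[volume] t j}
      zero_mem' := ⟨_, h0, fun j => Lp.coeFn_zero ℂ 2 volume⟩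
      add_mem' := by
        rintro x y ⟨s, hs, hxs⟩ ⟨t, ht, hyt⟩
        refine ⟨_, hadd s hs t ht, fun j => (Lp.coeFn_add (x j) (y j)).trans ?_⟩
        filter_upwards [hxs j, hyt j] with z h1 h2
        rw [Pi.add_apply, h1, h2]
      smul_mem' := by
        rintro c x ⟨s, hs, hxs⟩
        refine ⟨_, hsmul c s hs, fun j => (Lp.coeFn_smul c (x j)).trans ?_⟩
        filter_upwards [hxs j] with z h1
        rw [Pi.smul_apply, h1, smul_eq_mul] }
  have hcomplete : IsComplete (V.topologicalClosure : Set H) :=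
    V.isClosed_topologicalClosure.isComplete
  have hcs : CompleteSpace V.topologicalClosure := hcomplete.completeSpace_coe
  let a' : H := WithLp.toLp 2 fun j => (ha j).toLp (a j)
  let b : H := V.topologicalClosure.starProjection a'
  have hb : b ∈ V.topologicalClosure := V.topologicalClosure.starProjection_apply_mem a'
  have horth : a' - b ∈ V.topologicalClosureᗮ := V.topologicalClosure.sub_starProjection_mem_orthogonal a'
  obtain ⟨x, hxV, hxb⟩ := mem_closure_iff_seq_limit.1 (show b ∈ closure (V : Set H) from hb)
  choose s hsS hxs using hxV
  refine ⟨fun j => b j, s, hsS, fun j => ?_, fun t ht => ?_⟩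
  · refine l2Tendsto_of_tendsto_Lp (x := fun i => x i j) (fun i => hxs i j) ?_
    exact ((PiLp.continuous_apply 2 _ j).tendsto b).comp hxb
  · let t' : H := WithLp.toLp 2 fun j => (hS t ht j).toLp (t j)
    have ht' : t' ∈ V.topologicalClosure :=
      V.le_topologicalClosure ⟨t, ht, fun j => (hS t ht j).coeFn_toLp⟩
    have h := Submodule.inner_right_of_mem_orthogonal ht' horth
    rw [PiLp.inner_apply] at h
    rw [← h]
    refine Finset.sum_congr rfl fun j _ => ?_
    have hm : MemLp (fun z => a j z - b j z) 2 := (ha j).sub (Lp.memLp _)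
    rw [← inner_toLp_eq hm (hS t ht j)]
    congr 1
    refine Lp.ext (hm.coeFn_toLp.trans ?_)
    refine EventuallyEq.trans ?_ (Lp.coeFn_sub _ _).symm
    filter_upwards [(ha j).coeFn_toLp] with z hz
    exact congrArg (· - b j z) hz.symm

end Projection

section Cutoff

open scoped ENNReal

variable {n : ℕ} {E Φ η : (Fin n → ℂ) → ℝ} {α B : Fin n → (Fin n → ℂ) → ℂ}

theorem wder_continuous (j : Fin n) {u : (Fin n → ℂ) → ℂ} (hu : ContDiff ℝ 1 u) :
    Continuous (wder n j u) := by
  rw [wder_eq_dW]; exact dW_continuous _ _ hu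

theorem wderBar_continuous (j : Fin n) {u : (Fin n → ℂ) → ℂ} (hu : ContDiff ℝ 1 u) :
    Continuous (wderBar n j u) := by
  rw [wderBar_eq_dW]; exact dW_continuous _ _ hu

theorem continuous_halfWeight (hE : Continuous E) (s : ℂ) :
    Continuous fun z => cexp (s * (E z : ℂ) / 2) := by fun_prop

theorem integral_twDer_mul_eq (j : Fin n) {a ψ : (Fin n → ℂ) → ℂ} (hΦ : ContDiff ℝ 1 Φ)
    (ha : ContDiff ℝ 1 a) (hac : HasCompactSupport a) (hψ : ContDiff ℝ 1 ψ) :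
    ∫ z, twDer n Φ j a z * ψ z
      = - ∫ z, a z * (wder n j ψ z + wder n j (fun v => (Φ v : ℂ)) z * ψ z) := by
  have hP := wder_continuous j (contDiff_ofReal_comp hΦ)
  have h := integral_dW_mul (-I) j hψ ha hac
  rw [← wder_eq_dW, ← wder_eq_dW] at h
  have i1 : Integrable fun z => wder n j a z * ψ z := by
    rw [wder_eq_dW]
    exact ((dW_continuous _ _ ha).mul hψ.continuous).integrable_of_hasCompactSupport
      (dW_hasCompactSupport _ _ hac).mul_right
  have i2 : Integrable fun z => wder n j (fun v => (Φ v : ℂ)) z * a z * ψ z :=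
    ((hP.mul ha.continuous).mul hψ.continuous).integrable_of_hasCompactSupport
      hac.mul_left.mul_right
  have i3 : Integrable fun z => a z * wder n j ψ z :=
    (ha.continuous.mul (wder_continuous j hψ)).integrable_of_hasCompactSupport hac.mul_right
  have i4 : Integrable fun z => a z * (wder n j (fun v => (Φ v : ℂ)) z * ψ z) :=
    (ha.continuous.mul (hP.mul hψ.continuous)).integrable_of_hasCompactSupport hac.mul_right
  simp only [twDer, sub_mul, mul_add]
  rw [integral_sub i1 i2, integral_add i3 i4]
  have e1 : ∫ z, wder n j a z * ψ z = - ∫ z, a z * wder n j ψ z := by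
    have e : ∀ z, ψ z * wder n j a z = wder n j a z * ψ z := fun z => mul_comm _ _
    have e' : ∀ z, wder n j ψ z * a z = a z * wder n j ψ z := fun z => mul_comm _ _
    simp only [e, e'] at h
    rw [h, neg_neg]
  have e2 : ∫ z, wder n j (fun v => (Φ v : ℂ)) z * a z * ψ z
      = ∫ z, a z * (wder n j (fun v => (Φ v : ℂ)) z * ψ z) := by
    congr 1; ext z; ring
  rw [e1, e2]; ring

theorem hasWeakDiv_cutoff (hE : ContDiff ℝ 2 E) (hΦ : ContDiff ℝ 2 Φ) (hη : ContDiff ℝ 2 η)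
    (hηc : HasCompactSupport η) (hα : ∀ j, ContDiff ℝ 2 (α j))
    (hαc : ∀ j, HasCompactSupport (α j)) (hB : ∀ j, MemLp (B j) 2)
    (h1 : ∀ v : (Fin n → ℂ) → ℂ, ContDiff ℝ 2 v → tsupport v ⊆ tsupport η →
      ∑ j, ∫ z, (cexp (1 * (E z : ℂ) / 2) * α j z - B j z)
        * (starRingEnd ℂ) (cexp (1 * (E z : ℂ) / 2) * wderBar n j v z) = 0)
    (hKα : ∀ j, ∀ z ∈ tsupport (α j), ∀ᶠ w in 𝓝 z, η w = 1 ∧ E w = -Φ w) :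
    HasWeakDiv n (fun j z => (η z : ℂ) * (cexp (-1 * (E z : ℂ) / 2) * B j z))
      (fun z => ∑ j, twDer n Φ j (α j) z + ∑ j, (wder n j (fun v => (η v : ℂ)) z
        - wder n j (fun v => (E v : ℂ)) z * η z) * (cexp (-1 * (E z : ℂ) / 2) * B j z)) := by
  intro ψ hψ hψc
  have hψ2 : ContDiff ℝ 2 ψ := hψ.of_le (by norm_cast)
  have hψ1 : ContDiff ℝ 1 ψ := hψ2.of_le (by norm_num)
  have hη2 := contDiff_ofReal_comp hη
  have hη1 : ContDiff ℝ 1 (fun v => (η v : ℂ)) := hη2.of_le (by norm_num)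
  have hE1 : ContDiff ℝ 1 E := hE.of_le (by norm_num)
  have hΦ1 : ContDiff ℝ 1 Φ := hΦ.of_le (by norm_num)
  have hα1 : ∀ j, ContDiff ℝ 1 (α j) := fun j => (hα j).of_le (by norm_num)
  let v : (Fin n → ℂ) → ℂ := fun z => (starRingEnd ℂ) (ψ z * η z * cexp (-(E z : ℂ)))
  have hv : ContDiff ℝ 2 v := contDiff_conj ((hψ2.mul hη2).mul (contDiff_weight hE))
  have hvs : tsupport v ⊆ tsupport η := by
    refine closure_mono fun z hz => ?_
    contrapose! hz
    rw [Function.notMem_support] at hz ⊢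
    simp [v, hz]
  let Q : Fin n → (Fin n → ℂ) → ℂ := fun j z => wder n j ψ z * η z
    + ψ z * wder n j (fun v => (η v : ℂ)) z - wder n j (fun v => (E v : ℂ)) z * (ψ z * η z)
  have hηcc : HasCompactSupport (fun v => (η v : ℂ)) :=
    hηc.comp_left (g := ((↑) : ℝ → ℂ)) (by simp)
  have hdv : ∀ j z, wderBar n j v z = (starRingEnd ℂ) (Q j z * cexp (-(E z : ℂ))) := by
    intro j z
    rw [wderBar_conj, wder_eq_dW, dW_weight_mul _ _ hE1 (hψ1.mul hη1),
      dW_mul _ _ (hψ1.differentiable (by norm_num) z) (hη1.differentiable (by norm_num) z)]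
    simp only [Q, wder_eq_dW]
  have hQc : ∀ j, Continuous (Q j) := fun j => by
    have a1 := wder_continuous j hψ1
    have a2 := wder_continuous j hη1
    have a3 := wder_continuous j (contDiff_ofReal_comp hE1)
    exact ((a1.mul hη1.continuous).add (hψ1.continuous.mul a2)).sub
      (a3.mul (hψ1.continuous.mul hη1.continuous))
  have hQs : ∀ j, HasCompactSupport (Q j) := fun j => by
    have a2 : HasCompactSupport (wder n j (fun v => (η v : ℂ))) := by
      rw [wder_eq_dW]; exact dW_hasCompactSupport _ _ hηcc
    refine HasCompactSupport.sub (HasCompactSupport.add ?_ ?_) ?_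
    · exact hηcc.mul_left
    · exact a2.mul_left
    · exact hηcc.mul_left.mul_left
  have hexp : ∀ z, cexp (1 * (E z : ℂ) / 2) * cexp (1 * (E z : ℂ) / 2) * cexp (-(E z : ℂ)) = 1 := by
    intro z
    rw [← Complex.exp_add, ← Complex.exp_add]
    convert Complex.exp_zero using 2
    ring
  have hexp2 : ∀ z, cexp (1 * (E z : ℂ) / 2) * cexp (-(E z : ℂ)) = cexp (-1 * (E z : ℂ) / 2) := by
    intro z
    rw [← Complex.exp_add]
    congr 1
    ring
  have hcj : ∀ z, (starRingEnd ℂ) (cexp (1 * (E z : ℂ) / 2)) = cexp (1 * (E z : ℂ) / 2) := by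
    intro z
    rw [← Complex.exp_conj]
    simp [map_div₀, map_ofNat]
  have h := h1 v hv hvs
  have hB1 : ∀ j, Integrable fun z => B j z * (cexp (-1 * (E z : ℂ) / 2) * Q j z) := fun j =>
    LocallyIntegrable.integrable_mul_of_hasCompactSupport ((hB j).locallyIntegrable (by norm_num))
      ((continuous_halfWeight hE.continuous _).mul (hQc j)) (hQs j).mul_left
  have hA1 : ∀ j, Integrable fun z => α j z * Q j z := fun j =>
    ((hα j).continuous.mul (hQc j)).integrable_of_hasCompactSupport (hQs j).mul_left
  have hterm : ∀ j, ∫ z, (cexp (1 * (E z : ℂ) / 2) * α j z - B j z)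
        * (starRingEnd ℂ) (cexp (1 * (E z : ℂ) / 2) * wderBar n j v z)
      = - (∫ z, twDer n Φ j (α j) z * ψ z)
        - ∫ z, B j z * (cexp (-1 * (E z : ℂ) / 2) * Q j z) := by
    intro j
    have e1 : ∫ z, α j z * Q j z = - ∫ z, twDer n Φ j (α j) z * ψ z := by
      rw [integral_twDer_mul_eq j hΦ1 (hα1 j) (hαc j) hψ1, neg_neg]
      refine integral_congr_ae (ae_of_all _ fun z => ?_)
      by_cases hz : z ∈ tsupport (α j)
      · have hw := hKα j z hz
        have g1 : wder n j (fun v => (η v : ℂ)) z = 0 := by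
          rw [wder_congr (v := fun _ => 1) (hw.mono fun w hw => by simp [hw.1]), wder_eq_dW, dW_const]
        have g2 : wder n j (fun v => (E v : ℂ)) z = - wder n j (fun v => (Φ v : ℂ)) z := by
          rw [wder_congr (v := fun w => 0 - (Φ w : ℂ)) (hw.mono fun w hw => by simp [hw.2]),
            wder_eq_dW, dW_sub _ _ (differentiableAt_const _)
            ((contDiff_ofReal_comp hΦ1).differentiable (by norm_num) z), dW_const, zero_sub, ← wder_eq_dW]
        simp only [Q, g1, g2, hw.self_of_nhds.1]
        push_cast; ring
      · simp [image_eq_zero_of_notMem_tsupport hz]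
    rw [← e1, ← integral_sub (hA1 j) (hB1 j)]
    refine integral_congr_ae (ae_of_all _ fun z => ?_)
    simp only [hdv, map_mul, Complex.conj_conj, hcj, ← hexp2]
    linear_combination (α j z * Q j z) * hexp z
  simp only [hterm, Finset.sum_sub_distrib, Finset.sum_neg_distrib] at h
  have hT1 : ∀ j, Integrable fun z => twDer n Φ j (α j) z * ψ z := fun j => by
    have c1 : Continuous (twDer n Φ j (α j)) := (wder_continuous j (hα1 j)).sub
      ((wder_continuous j (contDiff_ofReal_comp hΦ1)).mul (hα1 j).continuous)
    exact (c1.mul hψ1.continuous).integrable_of_hasCompactSupport hψc.mul_left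
  have hL : ∀ (c : Fin n → (Fin n → ℂ) → ℂ), (∀ j, Continuous (c j)) →
      (∀ j, HasCompactSupport (c j)) → ∀ j, Integrable fun z => B j z * c j z :=
    fun c hc hcs j => LocallyIntegrable.integrable_mul_of_hasCompactSupport
      ((hB j).locallyIntegrable (by norm_num)) (hc j) (hcs j)
  rw [← integral_finsetSum _ fun j _ => hT1 j, ← integral_finsetSum _ fun j _ => hB1 j] at h
  have j1 : Integrable fun z => ∑ j, (η z : ℂ) * (cexp (-1 * (E z : ℂ) / 2) * B j z) * wder n j ψ z := by
    refine integrable_finsetSum _ fun j _ => ?_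
    refine (hL (fun j z => η z * cexp (-1 * (E z : ℂ) / 2) * wder n j ψ z) (fun j => ?_)
      (fun j => ?_) j).congr (ae_of_all _ fun z => ?_)
    · exact (hη1.continuous.mul (continuous_halfWeight hE.continuous _)).mul (wder_continuous j hψ1)
    · exact hηcc.mul_right.mul_right
    · ring
  have j2 := integrable_finsetSum Finset.univ fun j _ => hT1 j
  have j3 := integrable_finsetSum Finset.univ fun j _ => hB1 j
  have e3 : (∫ z, (∑ j, twDer n Φ j (α j) z + ∑ j, (wder n j (fun v => (η v : ℂ)) z
        - wder n j (fun v => (E v : ℂ)) z * η z) * (cexp (-1 * (E z : ℂ) / 2) * B j z)) * ψ z)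
      = ∫ z, ((∑ j, twDer n Φ j (α j) z * ψ z + ∑ j, B j z * (cexp (-1 * (E z : ℂ) / 2) * Q j z))
        - ∑ j, (η z : ℂ) * (cexp (-1 * (E z : ℂ) / 2) * B j z) * wder n j ψ z) := by
    refine integral_congr_ae (ae_of_all _ fun z => ?_)
    simp only [add_mul, Finset.sum_mul, add_sub_assoc, ← Finset.sum_sub_distrib]
    congr 1
    refine Finset.sum_congr rfl fun j _ => ?_
    simp only [Q]
    ring
  have j4 := j2.add j3
  simp only [Pi.add_def] at j4
  rw [e3, integral_sub j4 j1, integral_add j2 j3]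
  linear_combination -h

theorem hasWeakCurl_cutoff (hE : ContDiff ℝ 2 E) (hη : ContDiff ℝ 2 η)
    (hηc : HasCompactSupport η) (hB : ∀ j, MemLp (B j) 2)
    (h2 : ∀ v : (Fin n → ℂ) → ℂ, ContDiff ℝ 1 v → tsupport v ⊆ tsupport η → ∀ j k,
      ∫ z, cexp (-1 * (E z : ℂ) / 2) * (B k z * wderBar n j v z - B j z * wderBar n k v z) = 0) :
    HasWeakCurl n (fun j z => (η z : ℂ) * (cexp (-1 * (E z : ℂ) / 2) * B j z))
      (fun j k z => wderBar n j (fun v => (η v : ℂ)) z * (cexp (-1 * (E z : ℂ) / 2) * B k z)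
        - wderBar n k (fun v => (η v : ℂ)) z * (cexp (-1 * (E z : ℂ) / 2) * B j z)) := by
  intro j k ψ hψ hψc
  have hψ1 : ContDiff ℝ 1 ψ := hψ.of_le (by norm_cast)
  have hη1 : ContDiff ℝ 1 (fun v => (η v : ℂ)) := (contDiff_ofReal_comp hη).of_le (by norm_num)
  have hηcc : HasCompactSupport (fun v => (η v : ℂ)) :=
    hηc.comp_left (g := ((↑) : ℝ → ℂ)) (by simp)
  have hvs : tsupport (fun z => (η z : ℂ) * ψ z) ⊆ tsupport η := by
    refine closure_mono fun z hz => ?_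
    contrapose! hz
    rw [Function.notMem_support] at hz ⊢
    simp [hz]
  have h := h2 _ (hη1.mul hψ1) hvs j k
  have hd : ∀ j z, wderBar n j (fun z => (η z : ℂ) * ψ z) z
      = wderBar n j (fun v => (η v : ℂ)) z * ψ z + η z * wderBar n j ψ z := fun j z => by
    simp only [wderBar_eq_dW]
    exact dW_mul _ _ (hη1.differentiable (by norm_num) z) (hψ1.differentiable (by norm_num) z)
  have hW := continuous_halfWeight hE.continuous (-1)
  have hdc : ∀ j, HasCompactSupport (wderBar n j (fun v => (η v : ℂ))) := fun j => by
    rw [wderBar_eq_dW]; exact dW_hasCompactSupport _ _ hηcc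
  have hI : ∀ j k, Integrable fun z => (η z : ℂ) * (cexp (-1 * (E z : ℂ) / 2) * B k z)
      * wderBar n j ψ z := fun j k => by
    refine (LocallyIntegrable.integrable_mul_of_hasCompactSupport
      ((hB k).locallyIntegrable (by norm_num)) (g := fun z => η z * cexp (-1 * (E z : ℂ) / 2)
        * wderBar n j ψ z) ?_ ?_).congr (ae_of_all _ fun z => ?_)
    · exact (hη1.continuous.mul hW).mul (wderBar_continuous j hψ1)
    · exact hηcc.mul_right.mul_right
    · ring
  have hJ : ∀ j k, Integrable fun z => wderBar n j (fun v => (η v : ℂ)) z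
      * (cexp (-1 * (E z : ℂ) / 2) * B k z) * ψ z := fun j k => by
    refine (LocallyIntegrable.integrable_mul_of_hasCompactSupport
      ((hB k).locallyIntegrable (by norm_num)) (g := fun z => wderBar n j (fun v => (η v : ℂ)) z
        * cexp (-1 * (E z : ℂ) / 2) * ψ z) ?_ ?_).congr (ae_of_all _ fun z => ?_)
    · exact ((wderBar_continuous j hη1).mul hW).mul hψ1.continuous
    · exact (hdc j).mul_right.mul_right
    · ring
  have i1 := (hI j k).sub (hI k j)
  have i2 := (hJ j k).sub (hJ k j)
  simp only [Pi.sub_def, ← sub_mul] at i1 i2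
  beta_reduce
  rw [← sub_eq_zero, sub_neg_eq_add, ← integral_add i1 i2, ← h]
  refine integral_congr_ae (ae_of_all _ fun z => ?_)
  simp only [hd]
  ring

end Cutoff

section CutoffEstimate

open scoped ENNReal

variable {n : ℕ} {Φ k T η ζ : (Fin n → ℂ) → ℝ} {α B : Fin n → (Fin n → ℂ) → ℂ} {ε : ℝ}

theorem wder_contDiff {φ : (Fin n → ℂ) → ℝ} (hφ : ContDiff ℝ 2 φ) (j : Fin n) :
    ContDiff ℝ 1 (wder n j (fun v => (φ v : ℂ))) := by
  rw [wder_eq_dW]; exact dW_contDiff _ _ (contDiff_ofReal_comp hφ) (by norm_num)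

theorem wder_add_ofReal {φ ψ : (Fin n → ℂ) → ℝ} {z : Fin n → ℂ} (hφ : ContDiffAt ℝ 1 φ z)
    (hψ : ContDiffAt ℝ 1 ψ z) (j : Fin n) :
    wder n j (fun v => ((φ v + ψ v : ℝ) : ℂ)) z
      = wder n j (fun v => (φ v : ℂ)) z + wder n j (fun v => (ψ v : ℂ)) z := by
  have h := @dW_add n (-I) j (fun v => (φ v : ℂ)) (fun v => (ψ v : ℂ)) z
    ((Complex.ofRealCLM.contDiff.contDiffAt.comp z hφ).differentiableAt (by norm_num))
    ((Complex.ofRealCLM.contDiff.contDiffAt.comp z hψ).differentiableAt (by norm_num))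
  simpa only [wder_eq_dW, Complex.ofReal_add] using h

theorem wder_neg_ofReal {φ : (Fin n → ℂ) → ℝ} {z : Fin n → ℂ} (j : Fin n) :
    wder n j (fun v => ((-φ v : ℝ) : ℂ)) z = -wder n j (fun v => (φ v : ℂ)) z := by
  simp only [wder, Complex.ofReal_neg, fderiv_fun_neg, neg_apply]
  ring

theorem cHess_add {φ ψ : (Fin n → ℂ) → ℝ} {z : Fin n → ℂ} (hφ : ContDiffAt ℝ 2 φ z)
    (hψ : ContDiffAt ℝ 2 ψ z) (j l : Fin n) :
    cHess n (fun v => φ v + ψ v) z j l = cHess n φ z j l + cHess n ψ z j l := by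
  have e : wder n j (fun v => ((φ v + ψ v : ℝ) : ℂ)) =ᶠ[𝓝 z]
      fun w => wder n j (fun v => (φ v : ℂ)) w + wder n j (fun v => (ψ v : ℂ)) w := by
    filter_upwards [hφ.eventually (by norm_num), hψ.eventually (by norm_num)] with w h1 h2
    exact wder_add_ofReal (h1.of_le (by norm_num)) (h2.of_le (by norm_num)) j
  have hd : ∀ {χ : (Fin n → ℂ) → ℝ}, ContDiffAt ℝ 2 χ z →
      DifferentiableAt ℝ (wder n j (fun v => (χ v : ℂ))) z := fun h => by
    rw [wder_eq_dW]
    exact (dW_contDiffAt (m' := 1) _ _ (Complex.ofRealCLM.contDiff.contDiffAt.comp z h)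
      (by norm_num)).differentiableAt (by norm_num)
  simp only [cHess, wderBar_eq_dW]
  rw [dW_congr _ _ e, dW_add _ _ (hd hφ) (hd hψ)]

theorem hermForm_add (H H' : Fin n → Fin n → ℂ) (X Y : Fin n → ℂ) :
    hermForm n (fun j l => H j l + H' j l) X Y = hermForm n H X Y + hermForm n H' X Y := by
  simp only [hermForm, add_mul, Finset.sum_add_distrib, Complex.add_re]

theorem hermForm_smul (H : Fin n → Fin n → ℂ) (c : ℂ) (X : Fin n → ℂ) :
    hermForm n H (fun j => c * X j) (fun j => c * X j) = ‖c‖ ^ 2 * hermForm n H X X := by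
  have e : ∀ j l, H j l * (c * X j) * (starRingEnd ℂ) (c * X l)
      = ((‖c‖ ^ 2 : ℝ) : ℂ) * (H j l * X j * (starRingEnd ℂ) (X l)) := fun j l => by
    rw [map_mul, ← Complex.normSq_eq_norm_sq, ← Complex.mul_conj]; ring
  simp only [hermForm, e, ← Finset.mul_sum, Complex.re_ofReal_mul]

theorem norm_sum_mul_sq_le (a b : Fin n → ℂ) :
    ‖∑ j, a j * b j‖ ^ 2 ≤ (∑ j, ‖a j‖ ^ 2) * ∑ j, ‖b j‖ ^ 2 := by
  have h1 : ‖∑ j, a j * b j‖ ≤ ∑ j, ‖a j‖ * ‖b j‖ :=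
    (norm_sum_le _ _).trans (le_of_eq (Finset.sum_congr rfl fun j _ => norm_mul _ _))
  exact (pow_le_pow_left₀ (norm_nonneg _) h1 2).trans (Finset.sum_mul_sq_le_sq_mul_sq _ _ _)

theorem norm_add_sq_le_two_mul (x y : ℂ) : ‖x + y‖ ^ 2 ≤ 2 * ‖x‖ ^ 2 + 2 * ‖y‖ ^ 2 := by
  have h := pow_le_pow_left₀ (norm_nonneg _) (norm_add_le x y) 2
  nlinarith [sq_nonneg (‖x‖ - ‖y‖)]

theorem half_sum_curl_le (a b : Fin n → ℂ) :
    (1 / 2 : ℝ) * ∑ j, ∑ l, ‖a j * b l - a l * b j‖ ^ 2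
      ≤ 2 * ((∑ j, ‖a j‖ ^ 2) * ∑ j, ‖b j‖ ^ 2) := by
  have h : ∀ j l, ‖a j * b l - a l * b j‖ ^ 2
      ≤ 2 * (‖a j‖ ^ 2 * ‖b l‖ ^ 2) + 2 * (‖a l‖ ^ 2 * ‖b j‖ ^ 2) := fun j l => by
    have := norm_add_sq_le_two_mul (a j * b l) (-(a l * b j))
    rw [← sub_eq_add_neg, norm_neg, norm_mul, norm_mul, mul_pow, mul_pow] at this
    exact this
  have h2 := Finset.sum_le_sum fun j (_ : j ∈ Finset.univ) =>
    Finset.sum_le_sum fun l (_ : l ∈ Finset.univ) => h j l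
  have e1 : ∑ j, ∑ l, ‖a j‖ ^ 2 * ‖b l‖ ^ 2 = (∑ j, ‖a j‖ ^ 2) * ∑ j, ‖b j‖ ^ 2 := by
    rw [Finset.sum_mul_sum]
  have e2 : ∑ j, ∑ l, ‖a l‖ ^ 2 * ‖b j‖ ^ 2 = (∑ j, ‖a j‖ ^ 2) * ∑ j, ‖b j‖ ^ 2 := by
    rw [Finset.sum_comm, e1]
  simp only [Finset.sum_add_distrib, ← Finset.mul_sum] at h2
  simp only [Finset.mul_sum] at e1 e2 h2 ⊢
  simp only [← Finset.mul_sum] at e1 e2 h2 ⊢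
  rw [e1] at h2
  have e3 : ∑ j, ∑ l, ‖a l‖ ^ 2 * ‖b j‖ ^ 2 = ∑ j, (∑ l, ‖a l‖ ^ 2) * ‖b j‖ ^ 2 := by
    simp only [Finset.sum_mul]
  linarith

theorem cutoff_pointwise {h c : ℂ} {e e' k b B : Fin n → ℂ} {P Q : Fin n → Fin n → ℂ}
    {η ζ w w' wk ε : ℝ} (hY : h = 0 ∨ w' = w ∧ ∑ j, (e j - k j * η) * b j = 0)
    (hw : 0 ≤ w') (hwk : 0 ≤ wk) (hb : ∀ j, b j = c * B j) (hc : ‖c‖ ^ 2 * w' = wk)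
    (he : ∀ j, ‖e' j‖ = ‖e j‖) (hε : (∑ j, ‖e j‖ ^ 2) * wk ≤ ε)
    (hQ : η ≠ 0 → ∀ X : Fin n → ℂ, 2 * ‖∑ j, k j * X j‖ ^ 2 ≤ hermForm n Q X X)
    (hP : η ≠ 0 → ∀ X, 0 ≤ hermForm n P X X) (hζ1 : ζ ≤ 1)
    (hζ : ζ ≠ 0 → η = 1 ∧ wk = 1) :
    (‖h + ∑ j, (e j - k j * η) * b j‖ ^ 2
        + (1 / 2 : ℝ) * ∑ j, ∑ l, ‖e' j * b l - e' l * b j‖ ^ 2) * w'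
      - hermForm n (fun j l => P j l + Q j l) (fun j => η * b j) (fun j => η * b j) * w'
      ≤ ‖h‖ ^ 2 * w + ε * 4 * ∑ j, ‖B j‖ ^ 2 - hermForm n P B B * ζ := by
  set Y := ∑ j, (e j - k j * η) * b j with hYd
  have a1 : ‖h + Y‖ ^ 2 * w' ≤ ‖h‖ ^ 2 * w + ‖Y‖ ^ 2 * w' := by
    rcases hY with h0 | ⟨h0, h1⟩
    · simp [h0]
    · simp [h0, h1]
  have a2 : ‖Y‖ ^ 2 ≤ 2 * ((∑ j, ‖e j‖ ^ 2) * ∑ j, ‖b j‖ ^ 2)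
      + 2 * (η ^ 2 * ‖∑ j, k j * b j‖ ^ 2) := by
    have : Y = ∑ j, e j * b j + -(η * ∑ j, k j * b j) := by
      rw [hYd, Finset.mul_sum, ← sub_eq_add_neg, ← Finset.sum_sub_distrib]
      exact Finset.sum_congr rfl fun j _ => by ring
    rw [this]
    refine (norm_add_sq_le_two_mul _ _).trans (add_le_add ?_ (le_of_eq ?_))
    · exact mul_le_mul_of_nonneg_left (norm_sum_mul_sq_le e b) (by norm_num)
    · rw [norm_neg, norm_mul, mul_pow, Complex.norm_real, Real.norm_eq_abs, sq_abs]
  have a3 := half_sum_curl_le e' b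
  simp only [he] at a3
  have a4 : (∑ j, ‖b j‖ ^ 2) * w' = wk * ∑ j, ‖B j‖ ^ 2 := by
    simp only [hb, norm_mul, mul_pow, ← Finset.mul_sum]
    rw [← hc]; ring
  have a5 : (∑ j, ‖e j‖ ^ 2) * (∑ j, ‖b j‖ ^ 2) * w' ≤ ε * ∑ j, ‖B j‖ ^ 2 := by
    rw [mul_assoc, a4, ← mul_assoc]
    exact mul_le_mul_of_nonneg_right hε (Finset.sum_nonneg fun _ _ => by positivity)
  have a6 : 2 * (η ^ 2 * ‖∑ j, k j * b j‖ ^ 2) ≤ η ^ 2 * hermForm n Q b b := by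
    by_cases h0 : η = 0
    · simp [h0]
    · nlinarith [hQ h0 b, sq_nonneg η]
  have a7 : hermForm n P b b * w' = wk * hermForm n P B B := by
    have : b = fun j => c * B j := funext hb
    rw [this, hermForm_smul, ← hc]; ring
  have a8 : hermForm n P B B * ζ ≤ η ^ 2 * (wk * hermForm n P B B) := by
    by_cases h0 : ζ = 0
    · by_cases h1 : η = 0
      · simp [h0, h1]
      · rw [h0, mul_zero]
        have := hP h1 B
        positivity
    · obtain ⟨h1, h2⟩ := hζ h0
      rw [h1, h2]
      nlinarith [hP (by rw [h1]; norm_num) B]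
  rw [hermForm_smul, hermForm_add, Complex.norm_real, Real.norm_eq_abs, sq_abs]
  have a9 := mul_le_mul_of_nonneg_right a2 hw
  have a10 := mul_le_mul_of_nonneg_right a3 hw
  have a11 := mul_le_mul_of_nonneg_right a6 hw
  rw [← a7] at a8
  linarith

theorem memLp_mul_of_hasCompactSupport {f u : (Fin n → ℂ) → ℂ} (hf : MemLp f 2)
    (hu : Continuous u) (hc : HasCompactSupport u) : MemLp (fun z => u z * f z) 2 := by
  obtain ⟨C, hC⟩ := exists_bound_of_hasCompactSupport hu hc
  exact memLp_two_bdd_mul hf hu hC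

/-- The three-weight estimate for a cut-off form. -/
theorem cutoff_estimate (hΦ : ContDiff ℝ 2 Φ) (hk : ContDiff ℝ 2 k) (hT : ContDiff ℝ 2 T)
    (hΦc : HasCompactSupport Φ) (hTc : HasCompactSupport T)
    (hη : ContDiff ℝ 2 η) (hηc : HasCompactSupport η) (hζ : Continuous ζ)
    (hζc : HasCompactSupport ζ) (hζ1 : ∀ z, ζ z ≤ 1)
    (hζη : ∀ z, ζ z ≠ 0 → η z = 1 ∧ k z = 0)
    (hα : ∀ j, ContDiff ℝ 2 (α j)) (hαc : ∀ j, HasCompactSupport (α j))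
    (hB : ∀ j, MemLp (B j) 2)
    (h1 : ∀ v : (Fin n → ℂ) → ℂ, ContDiff ℝ 2 v → tsupport v ⊆ tsupport η →
      ∑ j, ∫ z, (cexp (1 * ((k z - Φ z - T z : ℝ) : ℂ) / 2) * α j z - B j z)
        * (starRingEnd ℂ) (cexp (1 * ((k z - Φ z - T z : ℝ) : ℂ) / 2) * wderBar n j v z) = 0)
    (h2 : ∀ v : (Fin n → ℂ) → ℂ, ContDiff ℝ 1 v → tsupport v ⊆ tsupport η → ∀ j l,
      ∫ z, cexp (-1 * ((k z - Φ z - T z : ℝ) : ℂ) / 2)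
        * (B l z * wderBar n j v z - B j z * wderBar n l v z) = 0)
    (hKα : ∀ j, ∀ z ∈ tsupport (α j), ∀ᶠ w in 𝓝 z, η w = 1 ∧ k w = 0 ∧ T w = 0)
    (hΦp : ∀ z ∈ tsupport η, ∀ X, 0 ≤ hermForm n (cHess n Φ z) X X)
    (hTk : ∀ z ∈ tsupport η, ∀ X : Fin n → ℂ,
      2 * ‖∑ j, wder n j (fun v => (k v : ℂ)) z * X j‖ ^ 2 ≤ hermForm n (cHess n T z) X X)
    (hε : ∀ z, ∑ j, ‖wder n j (fun v => (η v : ℂ)) z‖ ^ 2 ≤ ε * Real.exp (k z)) :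
    ∫ z, hermForm n (cHess n Φ z) (fun j => B j z) (fun j => B j z) * ζ z
      ≤ (∫ z, ‖∑ j, twDer n Φ j (α j) z‖ ^ 2 * Real.exp (-Φ z))
        + 4 * ε * ∫ z, ∑ j, ‖B j z‖ ^ 2 := by
  have hE : ContDiff ℝ 2 (fun z => k z - Φ z - T z) := (hk.sub hΦ).sub hT
  have hφ : ContDiff ℝ 2 (fun z => Φ z + T z) := hΦ.add hT
  have hφc : HasCompactSupport (fun z => Φ z + T z) := hΦc.add hTc
  have hΦ1 : ContDiff ℝ 1 Φ := hΦ.of_le (by norm_num)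
  have hk1 : ContDiff ℝ 1 k := hk.of_le (by norm_num)
  have hT1 : ContDiff ℝ 1 T := hT.of_le (by norm_num)
  have hη1 : ContDiff ℝ 1 (fun v => (η v : ℂ)) := (contDiff_ofReal_comp hη).of_le (by norm_num)
  have hηcc : HasCompactSupport (fun v => (η v : ℂ)) :=
    hηc.comp_left (g := ((↑) : ℝ → ℂ)) (by simp)
  have hα1 : ∀ j, ContDiff ℝ 1 (α j) := fun j => (hα j).of_le (by norm_num)
  have hwD := hasWeakDiv_cutoff hE hΦ hη hηc hα hαc hB h1 fun j z hz =>
    (hKα j z hz).mono fun w hw => ⟨hw.1, by rw [hw.2.1, hw.2.2]; ring⟩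
  have hwR := hasWeakCurl_cutoff hE hη hηc hB h2
  have hW := continuous_halfWeight hE.continuous (-1)
  let b : Fin n → (Fin n → ℂ) → ℂ := fun j z =>
    cexp (-1 * ((k z - Φ z - T z : ℝ) : ℂ) / 2) * B j z
  have hub : ∀ (u : (Fin n → ℂ) → ℂ), Continuous u → HasCompactSupport u → ∀ j,
      MemLp (fun z => u z * b j z) 2 := fun u hu huc j => by
    have := memLp_mul_of_hasCompactSupport
      (u := fun z => u z * cexp (-1 * ((k z - Φ z - T z : ℝ) : ℂ) / 2)) (hB j) (hu.mul hW)
      huc.mul_right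
    simpa only [b, mul_assoc] using this
  have hγ : ∀ j, MemLp (fun z => (η z : ℂ) * b j z) 2 := hub _ hη1.continuous hηcc
  have hdη : ∀ j, Continuous (wder n j (fun v => (η v : ℂ))) := fun j => wder_continuous j hη1
  have hdηc : ∀ j, HasCompactSupport (wder n j (fun v => (η v : ℂ))) := fun j => by
    rw [wder_eq_dW]; exact dW_hasCompactSupport _ _ hηcc
  have hdη' : ∀ j, Continuous (wderBar n j (fun v => (η v : ℂ))) := fun j => wderBar_continuous j hη1
  have hdηc' : ∀ j, HasCompactSupport (wderBar n j (fun v => (η v : ℂ))) := fun j => by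
    rw [wderBar_eq_dW]; exact dW_hasCompactSupport _ _ hηcc
  have hh : MemLp (fun z => ∑ j, twDer n Φ j (α j) z) 2 := by
    refine memLp_finsetSum _ fun j _ => ?_
    have c1 : Continuous (twDer n Φ j (α j)) := (wder_continuous j (hα1 j)).sub
      ((wder_continuous j (contDiff_ofReal_comp hΦ1)).mul (hα1 j).continuous)
    have c2 : HasCompactSupport (twDer n Φ j (α j)) := by
      have : HasCompactSupport (wder n j (α j)) := by
        rw [wder_eq_dW]; exact dW_hasCompactSupport _ _ (hαc j)
      exact this.sub (hαc j).mul_left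
    exact c1.memLp_of_hasCompactSupport c2
  have hD : MemLp (fun z => ∑ j, twDer n Φ j (α j) z + ∑ j, (wder n j (fun v => (η v : ℂ)) z
        - wder n j (fun v => ((k v - Φ v - T v : ℝ) : ℂ)) z * η z) * b j z) 2 := by
    refine hh.add (memLp_finsetSum _ fun j _ => hub (fun z => wder n j (fun v => (η v : ℂ)) z
        - wder n j (fun v => ((k v - Φ v - T v : ℝ) : ℂ)) z * η z) ?_ ?_ j)
    · exact (hdη j).sub ((wder_contDiff hE j).continuous.mul hη1.continuous)
    · exact (hdηc j).sub hηcc.mul_left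
  have hR : ∀ j l, MemLp (fun z => wderBar n j (fun v => (η v : ℂ)) z * b l z
      - wderBar n l (fun v => (η v : ℂ)) z * b j z) 2 := fun j l =>
    (hub _ (hdη' j) (hdηc' j) l).sub (hub _ (hdη' l) (hdηc' l) j)
  have hmain := basic_estimate_of_hasCompactSupport hφ hφc hγ hηc.isCompact
    (fun j z hz => by simp [image_eq_zero_of_notMem_tsupport hz]) hD hR hwD hwR
  set D : (Fin n → ℂ) → ℂ := fun z => ∑ j, twDer n Φ j (α j) z
    + ∑ j, (wder n j (fun v => (η v : ℂ)) z
        - wder n j (fun v => ((k v - Φ v - T v : ℝ) : ℂ)) z * η z) * b j z with hDdef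
  have hP : ∀ j, Continuous (wder n j (fun v => ((Φ v + T v : ℝ) : ℂ))) := fun j =>
    (wder_contDiff hφ j).continuous
  have hDP : MemLp (fun z => D z - ∑ j, wder n j (fun v => ((Φ v + T v : ℝ) : ℂ)) z
      * ((η z : ℂ) * b j z)) 2 := by
    refine hD.sub (memLp_finsetSum _ fun j _ => ?_)
    simpa only [mul_assoc] using hub (fun z => wder n j (fun v => ((Φ v + T v : ℝ) : ℂ)) z * (η z : ℂ))
      ((hP j).mul hη1.continuous) hηcc.mul_left j
  obtain ⟨Cφ, hCφ⟩ := hφc.exists_bound_of_continuous hφ.continuous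
  have hw : Continuous fun z => Real.exp (-(Φ z + T z)) := by
    have := hφ.continuous
    fun_prop
  have hwb : ∀ z, |Real.exp (-(Φ z + T z))| ≤ Real.exp Cφ := fun z => by
    rw [abs_of_pos (Real.exp_pos _)]
    exact Real.exp_le_exp.2 ((neg_le_abs _).trans (hCφ z))
  have hiR : Integrable fun z => (‖D z - ∑ j, wder n j (fun v => ((Φ v + T v : ℝ) : ℂ)) z
      * ((η z : ℂ) * b j z)‖ ^ 2 + (1 / 2 : ℝ) * ∑ j, ∑ l,
        ‖wderBar n j (fun v => (η v : ℂ)) z * b l z - wderBar n l (fun v => (η v : ℂ)) z * b j z‖ ^ 2)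
      * Real.exp (-(Φ z + T z)) := by
    refine Integrable.mul_bdd (c := Real.exp Cφ) ?_ hw.aestronglyMeasurable
      (ae_of_all _ hwb)
    exact hDP.norm.integrable_sq.add ((integrable_finsetSum _ fun j _ =>
      integrable_finsetSum _ fun l _ => (hR j l).norm.integrable_sq).const_mul _)
  have hHc : ∀ j l, Continuous fun z => cHess n (fun v => Φ v + T v) z j l := fun j l =>
    wderBar_continuous l (wder_contDiff hφ j)
  have hHs : ∀ j l, HasCompactSupport fun z => cHess n (fun v => Φ v + T v) z j l := fun j l => by
    have : HasCompactSupport (fun v => ((Φ v + T v : ℝ) : ℂ)) :=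
      hφc.comp_left (g := ((↑) : ℝ → ℂ)) (by simp)
    have h3 := dW_hasCompactSupport I l (dW_hasCompactSupport (-I) j this)
    simpa only [cHess, wder_eq_dW, wderBar_eq_dW] using h3
  choose C1 hC1 using fun j l => exists_bound_of_hasCompactSupport
    ((hHc j l).mul (Complex.continuous_ofReal.comp hw)) (hHs j l).mul_right
  have hiL : Integrable fun z => hermForm n (cHess n (fun v => Φ v + T v) z)
      (fun j => (η z : ℂ) * b j z) (fun j => (η z : ℂ) * b j z) * Real.exp (-(Φ z + T z)) := by
    have := (integrable_hermForm_mul (fun j l => (hHc j l).mul (Complex.continuous_ofReal.comp hw))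
    (C := ∑ j, ∑ l, |C1 j l|) (fun j l z => ((hC1 j l z).trans (le_abs_self _)).trans
      ((Finset.single_le_sum (f := fun l => |C1 j l|) (fun _ _ => abs_nonneg _)
        (Finset.mem_univ l)).trans (Finset.single_le_sum (f := fun j => ∑ l, |C1 j l|)
          (fun _ _ => Finset.sum_nonneg fun _ _ => abs_nonneg _) (Finset.mem_univ j)))) hγ).1
    exact this
  have hΦc1 : ∀ j l, Continuous fun z => cHess n Φ z j l := fun j l =>
    wderBar_continuous l (wder_contDiff hΦ j)
  have hζcc : HasCompactSupport (fun v => (ζ v : ℂ)) :=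
    hζc.comp_left (g := ((↑) : ℝ → ℂ)) (by simp)
  choose C2 hC2 using fun j l => exists_bound_of_hasCompactSupport
    ((hΦc1 j l).mul (Complex.continuous_ofReal.comp hζ)) hζcc.mul_left
  have hiζ : Integrable fun z => hermForm n (cHess n Φ z) (fun j => B j z) (fun j => B j z) * ζ z := by
    have := (integrable_hermForm_mul (fun j l => (hΦc1 j l).mul (Complex.continuous_ofReal.comp hζ))
    (C := ∑ j, ∑ l, |C2 j l|) (fun j l z => ((hC2 j l z).trans (le_abs_self _)).trans
      ((Finset.single_le_sum (f := fun l => |C2 j l|) (fun _ _ => abs_nonneg _)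
        (Finset.mem_univ l)).trans (Finset.single_le_sum (f := fun j => ∑ l, |C2 j l|)
          (fun _ _ => Finset.sum_nonneg fun _ _ => abs_nonneg _) (Finset.mem_univ j)))) hB).1
    exact this
  have hih : Integrable fun z => ‖∑ j, twDer n Φ j (α j) z‖ ^ 2 * Real.exp (-Φ z) := by
    obtain ⟨CΦ, hCΦ⟩ := hΦc.exists_bound_of_continuous hΦ.continuous
    refine integrable_norm_sq_mul hh (C := Real.exp CΦ) ?_ fun z => ?_
    · have := hΦ.continuous
      fun_prop
    · rw [abs_of_pos (Real.exp_pos _)]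
      exact Real.exp_le_exp.2 ((neg_le_abs _).trans (hCΦ z))
  have hiB : Integrable fun z => ∑ j, ‖B j z‖ ^ 2 :=
    integrable_finsetSum _ fun j _ => (hB j).norm.integrable_sq
  have hsum : Integrable fun z => ‖∑ j, twDer n Φ j (α j) z‖ ^ 2 * Real.exp (-Φ z)
      + 4 * ε * ∑ j, ‖B j z‖ ^ 2 := hih.add (hiB.const_mul _)
  rw [← integral_const_mul, ← integral_add hih (hiB.const_mul _), ← sub_nonneg,
    ← integral_sub hsum hiζ]
  rw [← sub_nonneg, ← integral_sub hiR hiL] at hmain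
  refine hmain.trans (integral_mono (hiR.sub hiL) (hsum.sub hiζ) fun z => ?_)
  have hzη : η z ≠ 0 → z ∈ tsupport η := fun h => subset_tsupport _ h
  have eE : ∀ j, wder n j (fun v => ((k v - Φ v - T v : ℝ) : ℂ)) z
      + wder n j (fun v => ((Φ v + T v : ℝ) : ℂ)) z = wder n j (fun v => (k v : ℂ)) z := fun j => by
    rw [← wder_add_ofReal (hE.of_le (by norm_num)).contDiffAt (hφ.of_le (by norm_num)).contDiffAt]
    congr 2
    funext v
    norm_num
  have eD : D z - ∑ j, wder n j (fun v => ((Φ v + T v : ℝ) : ℂ)) z * ((η z : ℂ) * b j z)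
      = ∑ j, twDer n Φ j (α j) z + ∑ j, (wder n j (fun v => (η v : ℂ)) z
        - wder n j (fun v => (k v : ℂ)) z * η z) * b j z := by
    rw [hDdef, add_sub_assoc, ← Finset.sum_sub_distrib]
    congr 1
    exact Finset.sum_congr rfl fun j _ => by rw [← eE j]; ring
  have eH : cHess n (fun v => Φ v + T v) z = fun j l => cHess n Φ z j l + cHess n T z j l := by
    funext j l
    exact cHess_add hΦ.contDiffAt hT.contDiffAt j l
  have hY : ∑ j, twDer n Φ j (α j) z = 0 ∨ Real.exp (-(Φ z + T z)) = Real.exp (-Φ z) ∧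
      ∑ j, (wder n j (fun v => (η v : ℂ)) z - wder n j (fun v => (k v : ℂ)) z * η z) * b j z
        = 0 := by
    by_cases hz : ∃ j, z ∈ tsupport (α j)
    · obtain ⟨j, hj⟩ := hz
      have ev := hKα j z hj
      refine Or.inr ⟨by rw [ev.self_of_nhds.2.2, add_zero], Finset.sum_eq_zero fun l _ => ?_⟩
      have d1 : wder n l (fun v => (η v : ℂ)) z = 0 := by
        rw [wder_eq_dW, dW_congr (-I) l (v := fun _ => 1) (ev.mono fun w hw => by simp [hw.1]),
          dW_const]
      have d2 : wder n l (fun v => (k v : ℂ)) z = 0 := by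
        rw [wder_eq_dW, dW_congr (-I) l (v := fun _ => 0) (ev.mono fun w hw => by simp [hw.2.1]),
          dW_const]
      simp [d1, d2]
    · push Not at hz
      refine Or.inl (Finset.sum_eq_zero fun j _ => ?_)
      rw [twDer, wder_eq_dW, dW_eq_zero_of_notMem _ _ (hz j),
        image_eq_zero_of_notMem_tsupport (hz j)]
      simp
  have key := cutoff_pointwise (h := ∑ j, twDer n Φ j (α j) z)
    (e := fun j => wder n j (fun v => (η v : ℂ)) z)
    (e' := fun j => wderBar n j (fun v => (η v : ℂ)) z)
    (k := fun j => wder n j (fun v => (k v : ℂ)) z) (b := fun j => b j z) (B := fun j => B j z)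
    (P := cHess n Φ z) (Q := cHess n T z) (η := η z) (ζ := ζ z) (w := Real.exp (-Φ z))
    (wk := Real.exp (-k z)) (ε := ε) (c := cexp (-1 * ((k z - Φ z - T z : ℝ) : ℂ) / 2)) hY
    (Real.exp_pos (-(Φ z + T z))).le (Real.exp_pos _).le (fun j => rfl) ?_ (fun j => ?_) ?_
    (fun h => hTk z (hzη h)) (fun h => hΦp z (hzη h)) (hζ1 z)
    (fun h => ⟨(hζη z h).1, by simp [(hζη z h).2]⟩)
  · simp only
    rw [eD, eH]
    refine key.trans (le_of_eq ?_)
    ring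
  · have : ‖cexp (-1 * ((k z - Φ z - T z : ℝ) : ℂ) / 2)‖ = Real.exp (-(k z - Φ z - T z) / 2) := by
      rw [Complex.norm_exp]
      congr 1
      norm_cast
      simp
    rw [this, ← Real.exp_nat_mul, ← Real.exp_add]
    congr 1
    push_cast
    ring
  · rw [wderBar_ofReal, RCLike.norm_conj]
  · have := mul_le_mul_of_nonneg_right (hε z) (Real.exp_pos (-k z)).le
    rwa [mul_assoc, ← Real.exp_add, add_neg_cancel, Real.exp_zero, mul_one] at this

end CutoffEstimate

section WeightedEstimate

variable {n : ℕ} {Ω K : Set (Fin n → ℂ)} {Φ k T ζ : (Fin n → ℂ) → ℝ}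
  {α : Fin n → (Fin n → ℂ) → ℂ}

theorem exists_contDiff_eventuallyEq {L : Set (Fin n → ℂ)} (hΩ : IsOpen Ω) (hL : IsCompact L)
    (hLΩ : L ⊆ Ω) {f : (Fin n → ℂ) → ℝ} (hf : ContDiffOn ℝ 2 f Ω) :
    ∃ g : (Fin n → ℂ) → ℝ, ContDiff ℝ 2 g ∧ HasCompactSupport g ∧ ∀ z ∈ L, g =ᶠ[𝓝 z] f := by
  obtain ⟨χ, hχ, hχc, hχs, hχ1, -⟩ := exists_smooth_cutoff hΩ hL hLΩ
  refine ⟨fun z => χ z * f z, ?_, hχc.mul_right, fun z hz => ?_⟩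
  · rw [contDiff_iff_contDiffAt]
    intro z
    by_cases hz : z ∈ tsupport χ
    · exact (hχ.of_le (by norm_cast)).contDiffAt.mul (hf.contDiffAt (hΩ.mem_nhds (hχs hz)))
    · refine contDiffAt_const (c := 0) |>.congr_of_eventuallyEq ?_
      filter_upwards [notMem_tsupport_iff_eventuallyEq.1 hz] with w hw
      simp [hw]
  · filter_upwards [eventually_nhdsSet_iff_forall.1 hχ1 z hz] with w hw
    simp [hw]

theorem L2Tendsto.const {f : (Fin n → ℂ) → ℂ} (hf : MemLp f 2) : L2Tendsto n (fun _ => f) f where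
  memLp _ := hf
  memLp_lim := hf
  tendsto := by simp

theorem memLp_halfWeight_mul {E : (Fin n → ℂ) → ℝ} (hΩ : IsOpen Ω) (hE : ContinuousOn E Ω)
    {u : (Fin n → ℂ) → ℂ} (hu : Continuous u) (hc : HasCompactSupport u) (hs : tsupport u ⊆ Ω) :
    MemLp (fun z => cexp (1 * (E z : ℂ) / 2) * u z) 2 := by
  refine Continuous.memLp_of_hasCompactSupport ?_ hc.mul_left
  refine ContinuousOn.continuous_of_tsupport_subset (s := Ω) ?_ hΩ
    ((tsupport_mul_subset_right).trans hs)
  refine ContinuousOn.mul ?_ hu.continuousOn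
  have : ContinuousOn (fun z => (E z : ℂ)) Ω := Complex.continuous_ofReal.comp_continuousOn hE
  fun_prop

theorem integral_wderBar_mul_wderBar {u v : (Fin n → ℂ) → ℂ} (hu : ContDiff ℝ 2 u)
    (hv : ContDiff ℝ 1 v) (hc : HasCompactSupport v) (j l : Fin n) :
    ∫ z, wderBar n l u z * wderBar n j v z = ∫ z, wderBar n j u z * wderBar n l v z := by
  have e : ∀ a b : Fin n, ∫ z, wderBar n a u z * wderBar n b v z
      = -∫ z, wderBar n b (wderBar n a u) z * v z := fun a b => by
    simp only [wderBar_eq_dW]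
    rw [integral_dW_mul I b (dW_contDiff I a hu (by norm_num)) hv hc, neg_neg]
  rw [e, e]
  congr 2
  funext z
  simp only [wderBar_eq_dW]
  rw [dW_comm _ _ _ _ hu.contDiffAt]

/-- Weights `k`, `T` and cut-off functions that allow one to localize the basic estimate. -/
structure CutoffWeights (n : ℕ) (Ω K : Set (Fin n → ℂ)) (k T : (Fin n → ℂ) → ℝ) : Prop where
  contDiffOn_left : ContDiffOn ℝ 2 k Ω
  contDiffOn_right : ContDiffOn ℝ 2 T Ω
  eq_zero : ∀ᶠ z in 𝓝ˢ K, k z = 0 ∧ T z = 0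
  sq_le : ∀ z ∈ Ω, ∀ X : Fin n → ℂ,
    2 * ‖∑ j, wder n j (fun v => (k v : ℂ)) z * X j‖ ^ 2 ≤ hermForm n (cHess n T z) X X
  cutoff : ∀ ε > 0, ∃ η : (Fin n → ℂ) → ℝ, ContDiff ℝ 2 η ∧ HasCompactSupport η ∧
    tsupport η ⊆ Ω ∧ (∀ᶠ z in 𝓝ˢ K, η z = 1) ∧
    ∀ z, ∑ j, ‖wder n j (fun v => (η v : ℂ)) z‖ ^ 2 ≤ ε * Real.exp (k z)

theorem integrable_hermForm_cutoff {B : Fin n → (Fin n → ℂ) → ℂ} (hΦ : ContDiff ℝ 2 Φ)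
    (hζ : Continuous ζ) (hζc : HasCompactSupport ζ) (hB : ∀ j, MemLp (B j) 2) :
    Integrable fun z => hermForm n (cHess n Φ z) (fun j => B j z) (fun j => B j z) * ζ z := by
  have hΦc1 : ∀ j l, Continuous fun z => cHess n Φ z j l := fun j l =>
    wderBar_continuous l (wder_contDiff hΦ j)
  have hζcc : HasCompactSupport (fun v => (ζ v : ℂ)) :=
    hζc.comp_left (g := ((↑) : ℝ → ℂ)) (by simp)
  choose C2 hC2 using fun j l => exists_bound_of_hasCompactSupport
    ((hΦc1 j l).mul (Complex.continuous_ofReal.comp hζ)) hζcc.mul_left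
  exact (integrable_hermForm_mul (fun j l => (hΦc1 j l).mul (Complex.continuous_ofReal.comp hζ))
    (C := ∑ j, ∑ l, |C2 j l|) (fun j l z => ((hC2 j l z).trans (le_abs_self _)).trans
      ((Finset.single_le_sum (f := fun l => |C2 j l|) (fun _ _ => abs_nonneg _)
        (Finset.mem_univ l)).trans (Finset.single_le_sum (f := fun j => ∑ l, |C2 j l|)
          (fun _ _ => Finset.sum_nonneg fun _ _ => abs_nonneg _) (Finset.mem_univ j)))) hB).1

theorem exists_weighted_estimate (hΩ : IsOpen Ω) (hΦ : ContDiffOn ℝ 2 Φ Ω)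
    (hΦp : PSHOnC2 n Φ Ω) (hKΩ : K ⊆ Ω) (hkT : CutoffWeights n Ω K k T)
    (hα : ∀ j, ContDiff ℝ 2 (α j)) (hαc : ∀ j, HasCompactSupport (α j))
    (hαK : ∀ j, tsupport (α j) ⊆ K) (hζ : Continuous ζ)
    (hζc : HasCompactSupport ζ) (hζK : tsupport ζ ⊆ K) (hζ1 : ∀ z, ζ z ≤ 1) :
    ∃ B : Fin n → (Fin n → ℂ) → ℂ, (∀ j, MemLp (B j) 2) ∧
      (∀ v : (Fin n → ℂ) → ℂ, ContDiff ℝ 2 v → HasCompactSupport v → tsupport v ⊆ Ω →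
        ∑ j, ∫ z, (cexp (1 * ((k z - Φ z - T z : ℝ) : ℂ) / 2) * α j z - B j z)
        * (starRingEnd ℂ) (cexp (1 * ((k z - Φ z - T z : ℝ) : ℂ) / 2) * wderBar n j v z) = 0) ∧
      ∫ z, hermForm n (cHess n Φ z) (fun j => B j z) (fun j => B j z) * ζ z
        ≤ ∫ z, ‖∑ j, twDer n Φ j (α j) z‖ ^ 2 * Real.exp (-Φ z) := by
  have hE : ContinuousOn (fun z => k z - Φ z - T z) Ω :=
    ((hkT.contDiffOn_left.sub hΦ).sub hkT.contDiffOn_right).continuousOn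
  let S : Set (Fin n → (Fin n → ℂ) → ℂ) := {s | ∃ v : (Fin n → ℂ) → ℂ, ContDiff ℝ 2 v ∧
    HasCompactSupport v ∧ tsupport v ⊆ Ω ∧
    s = fun j z => cexp (1 * ((k z - Φ z - T z : ℝ) : ℂ) / 2) * wderBar n j v z}
  have hb1 : ∀ {v : (Fin n → ℂ) → ℂ}, ContDiff ℝ 2 v → ∀ j, ContDiff ℝ 1 (wderBar n j v) :=
    fun h j => by rw [wderBar_eq_dW]; exact dW_contDiff _ _ h (by norm_num)
  have hb2 : ∀ {v : (Fin n → ℂ) → ℂ}, HasCompactSupport v → ∀ j,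
      HasCompactSupport (wderBar n j v) :=
    fun h j => by rw [wderBar_eq_dW]; exact dW_hasCompactSupport _ _ h
  have hb3 : ∀ (v : (Fin n → ℂ) → ℂ) (j : Fin n), tsupport (wderBar n j v) ⊆ tsupport v :=
    fun v j => by rw [wderBar_eq_dW]; exact tsupport_dW_subset _ _
  have hd : ∀ {v : (Fin n → ℂ) → ℂ}, ContDiff ℝ 2 v → ∀ z, DifferentiableAt ℝ v z :=
    fun h z => h.differentiable (by norm_num) z
  have hS0 : (fun _ _ => 0) ∈ S := by
    refine ⟨fun _ => 0, contDiff_const, HasCompactSupport.zero, by simp [tsupport], ?_⟩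
    funext j z
    simp [wderBar_eq_dW, dW_const]
  have hSadd : ∀ s ∈ S, ∀ t ∈ S, (fun j z => s j z + t j z) ∈ S := by
    rintro _ ⟨v, h1, h2, h3, rfl⟩ _ ⟨w, h4, h5, h6, rfl⟩
    refine ⟨fun z => v z + w z, h1.add h4, h2.add h5,
      (tsupport_add v w).trans (union_subset h3 h6), ?_⟩
    funext j z
    simp only [wderBar_eq_dW]
    rw [dW_add _ _ (hd h1 z) (hd h4 z)]
    ring
  have hSmul : ∀ (c : ℂ), ∀ s ∈ S, (fun j z => c * s j z) ∈ S := by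
    rintro c _ ⟨v, h1, h2, h3, rfl⟩
    refine ⟨fun z => c * v z, contDiff_const.mul h1, h2.mul_left,
      (tsupport_mul_subset_right).trans h3, ?_⟩
    funext j z
    simp only [wderBar_eq_dW]
    rw [dW_mul _ _ (differentiableAt_const c) (hd h1 z), dW_const]
    ring
  have hSL : ∀ s ∈ S, ∀ j, MemLp (s j) 2 := by
    rintro _ ⟨v, h1, h2, h3, rfl⟩ j
    exact memLp_halfWeight_mul hΩ hE (hb1 h1 j).continuous (hb2 h2 j) ((hb3 v j).trans h3)
  obtain ⟨B, s, hsS, hsB, hBo⟩ := exists_l2_projection S hS0 hSadd hSmul hSL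
    (fun j z => cexp (1 * ((k z - Φ z - T z : ℝ) : ℂ) / 2) * α j z)
    (fun j => memLp_halfWeight_mul hΩ hE (hα j).continuous (hαc j) ((hαK j).trans hKΩ))
  have hBm : ∀ j, MemLp (B j) 2 := fun j => (hsB j).memLp_lim
  have ho : ∀ v : (Fin n → ℂ) → ℂ, ContDiff ℝ 2 v → HasCompactSupport v → tsupport v ⊆ Ω →
        ∑ j, ∫ z, (cexp (1 * ((k z - Φ z - T z : ℝ) : ℂ) / 2) * α j z - B j z)
        * (starRingEnd ℂ) (cexp (1 * ((k z - Φ z - T z : ℝ) : ℂ) / 2) * wderBar n j v z) = 0 :=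
    fun v h1 h2 h3 => hBo _ ⟨v, h1, h2, h3, rfl⟩
  have hcurl : ∀ v : (Fin n → ℂ) → ℂ, ContDiff ℝ 1 v → HasCompactSupport v → tsupport v ⊆ Ω →
      ∀ j l, ∫ z, cexp (-1 * ((k z - Φ z - T z : ℝ) : ℂ) / 2)
        * (B l z * wderBar n j v z - B j z * wderBar n l v z) = 0 := by
    intro v hv hvc hvΩ j l
    have hm : ∀ j, MemLp (fun z => cexp (1 * ((-(k z - Φ z - T z) : ℝ) : ℂ) / 2)
        * wderBar n j v z) 2 := fun j =>
      memLp_halfWeight_mul hΩ hE.neg (wderBar_continuous j hv) (hb2 hvc j) ((hb3 v j).trans hvΩ)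
    have hm' : ∀ j, MemLp (fun z => (starRingEnd ℂ) (cexp (1 * ((-(k z - Φ z - T z) : ℝ) : ℂ) / 2)
        * wderBar n j v z)) 2 := fun j => (hm j).star
    have hl : ∀ j l, Tendsto (fun i => ∫ z, s i l z
        * (cexp (1 * ((-(k z - Φ z - T z) : ℝ) : ℂ) / 2) * wderBar n j v z)) atTop
        (𝓝 (∫ z, B l z * (cexp (1 * ((-(k z - Φ z - T z) : ℝ) : ℂ) / 2) * wderBar n j v z))) :=
      fun j l => by simpa using (hsB l).integral_mul_conj (L2Tendsto.const (hm' j))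
    have hii : ∀ j l, Integrable fun z => B l z * (cexp (1 * ((-(k z - Φ z - T z) : ℝ) : ℂ) / 2)
        * wderBar n j v z) := fun j l => by simpa using integrable_mul_conj (hBm l) (hm' j)
    have heq : ∀ i, ∫ z, s i l z
        * (cexp (1 * ((-(k z - Φ z - T z) : ℝ) : ℂ) / 2) * wderBar n j v z)
        = ∫ z, s i j z * (cexp (1 * ((-(k z - Φ z - T z) : ℝ) : ℂ) / 2) * wderBar n l v z) := by
      intro i
      obtain ⟨u, h1, h2, h3, h4⟩ := hsS i
      have h5 : ∀ a b z, s i a z * (cexp (1 * ((-(k z - Φ z - T z) : ℝ) : ℂ) / 2)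
          * wderBar n b v z) = wderBar n a u z * wderBar n b v z := fun a b z => by
        have h6 : cexp (1 * ((k z - Φ z - T z : ℝ) : ℂ) / 2)
            * cexp (1 * ((-(k z - Φ z - T z) : ℝ) : ℂ) / 2) = 1 := by
          rw [← Complex.exp_add, ← Complex.exp_zero]
          congr 1
          push_cast
          ring
        rw [h4]
        linear_combination (wderBar n a u z * wderBar n b v z) * h6
      simp only [h5]
      exact integral_wderBar_mul_wderBar h1 hv hvc j l
    have h := tendsto_nhds_unique (hl j l) ((hl l j).congr fun i => (heq i).symm)
    rw [← sub_eq_zero, ← integral_sub (hii j l) (hii l j)] at h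
    rw [← h]
    refine integral_congr_ae (ae_of_all _ fun z => ?_)
    have : (-1 : ℂ) * ((k z - Φ z - T z : ℝ) : ℂ) / 2 = 1 * ((-(k z - Φ z - T z) : ℝ) : ℂ) / 2 := by
      push_cast
      ring
    simp only [this]
    ring
  refine ⟨B, hBm, ho, ?_⟩
  have key : ∀ ε > 0, ∫ z, hermForm n (cHess n Φ z) (fun j => B j z) (fun j => B j z) * ζ z
      ≤ (∫ z, ‖∑ j, twDer n Φ j (α j) z‖ ^ 2 * Real.exp (-Φ z))
        + 4 * ε * ∫ z, ∑ j, ‖B j z‖ ^ 2 := by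
    intro ε hε
    obtain ⟨η, hη, hηc, hηΩ, hη1, hηε⟩ := hkT.cutoff ε hε
    have hLc : IsCompact (tsupport η) := hηc
    have hKη : K ⊆ tsupport η := fun z hz => subset_tsupport _ (by
      rw [Function.mem_support, hη1.self_of_nhdsSet z hz]; norm_num)
    obtain ⟨Φ', hΦ', hΦ'c, eΦ⟩ := exists_contDiff_eventuallyEq hΩ hLc hηΩ hΦ
    obtain ⟨k', hk', -, ek⟩ := exists_contDiff_eventuallyEq hΩ hLc hηΩ hkT.contDiffOn_left
    obtain ⟨T', hT', hT'c, eT⟩ := exists_contDiff_eventuallyEq hΩ hLc hηΩ hkT.contDiffOn_right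
    have eW : ∀ z ∈ tsupport η, k' z - Φ' z - T' z = k z - Φ z - T z := fun z hz => by
      rw [(eΦ z hz).self_of_nhds, (ek z hz).self_of_nhds, (eT z hz).self_of_nhds]
    have eK : ∀ z ∈ K, ∀ᶠ w in 𝓝 z, η w = 1 ∧ k' w = 0 ∧ T' w = 0 := fun z hz => by
      filter_upwards [eventually_nhdsSet_iff_forall.1 hη1 z hz, ek z (hKη hz), eT z (hKη hz),
        eventually_nhdsSet_iff_forall.1 hkT.eq_zero z hz] with w h1 h2 h3 h4
      exact ⟨h1, h2.trans h4.1, h3.trans h4.2⟩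
    have h := cutoff_estimate (ε := ε) hΦ' hk' hT' hΦ'c hT'c hη hηc hζ hζc hζ1 ?_ hα hαc hBm
      ?_ ?_ (fun j z hz => eK z (hαK j hz)) ?_ ?_ ?_
    · refine (le_of_eq ?_).trans (h.trans (le_of_eq ?_))
      · refine integral_congr_ae (ae_of_all _ fun z => ?_)
        by_cases hz : ζ z = 0
        · simp [hz]
        · have hzη := hKη (hζK (subset_tsupport _ hz))
          simp only
          rw [show cHess n Φ z = cHess n Φ' z from
            funext fun j => funext fun l => (cHess_congr (eΦ z hzη) j l).symm]
      · congr 1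
        refine integral_congr_ae (ae_of_all _ fun z => ?_)
        simp only
        by_cases hz : ∃ j, z ∈ tsupport (α j)
        · obtain ⟨j, hj⟩ := hz
          have e := eΦ z (hKη (hαK j hj))
          have e2 : (fun v => (Φ' v : ℂ)) =ᶠ[𝓝 z] fun v => (Φ v : ℂ) := e.mono fun v hv =>
            congrArg _ hv
          simp only [twDer, wder_congr e2, e.self_of_nhds]
        · push Not at hz
          have : ∀ (F : (Fin n → ℂ) → ℝ) j, twDer n F j (α j) z = 0 := fun F j => by
            rw [twDer, wder_eq_dW, dW_eq_zero_of_notMem _ _ (hz j),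
              image_eq_zero_of_notMem_tsupport (hz j)]
            simp
          simp [this]
    · intro z hz
      have := (eK z (hζK (subset_tsupport _ hz))).self_of_nhds
      exact ⟨this.1, this.2.1⟩
    · intro v hv hvη
      rw [← ho v hv (hηc.of_isClosed_subset (isClosed_tsupport _) hvη) (hvη.trans hηΩ)]
      refine Finset.sum_congr rfl fun j _ => integral_congr_ae (ae_of_all _ fun z => ?_)
      by_cases hz : z ∈ tsupport η
      · simp only [eW z hz]
      · have : wderBar n j v z = 0 := by
          rw [wderBar_eq_dW, dW_eq_zero_of_notMem _ _ fun h => hz (hvη h)]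
        simp [this]
    · intro v hv hvη j l
      rw [← hcurl v hv (hηc.of_isClosed_subset (isClosed_tsupport _) hvη) (hvη.trans hηΩ) j l]
      refine integral_congr_ae (ae_of_all _ fun z => ?_)
      by_cases hz : z ∈ tsupport η
      · simp only [eW z hz]
      · have : ∀ j, wderBar n j v z = 0 := fun j => by
          rw [wderBar_eq_dW, dW_eq_zero_of_notMem _ _ fun h => hz (hvη h)]
        simp [this]
    · intro z hz X
      rw [show cHess n Φ' z = cHess n Φ z from
        funext fun j => funext fun l => cHess_congr (eΦ z hz) j l]
      exact hΦp z (hηΩ hz) X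
    · intro z hz X
      have e2 : (fun v => (k' v : ℂ)) =ᶠ[𝓝 z] fun v => (k v : ℂ) := (ek z hz).mono fun v hv =>
            congrArg _ hv
      rw [show cHess n T' z = cHess n T z from
        funext fun j => funext fun l => cHess_congr (eT z hz) j l]
      simp only [wder_congr e2]
      exact hkT.sq_le z (hηΩ hz) X
    · intro z
      by_cases hz : z ∈ tsupport η
      · rw [(ek z hz).self_of_nhds]
        exact hηε z
      · have hz' : z ∉ tsupport (fun v => (η v : ℂ)) := fun h =>
          hz (closure_mono (fun w hw => by simpa using hw) h)
        have : ∀ j, wder n j (fun v => (η v : ℂ)) z = 0 := fun j => by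
          rw [wder_eq_dW, dW_eq_zero_of_notMem _ _ hz']
        simp only [this]
        simp only [norm_zero, ne_eq, OfNat.ofNat_ne_zero, not_false_eq_true, zero_pow,
          Finset.sum_const_zero]
        positivity
  have hN : 0 ≤ ∫ z, ∑ j, ‖B j z‖ ^ 2 :=
    integral_nonneg fun z => Finset.sum_nonneg fun _ _ => by positivity
  set N := ∫ z, ∑ j, ‖B j z‖ ^ 2
  refine le_of_forall_pos_le_add fun δ hδ => ?_
  refine (key (δ / (4 * (N + 1))) (by positivity)).trans ?_
  gcongr
  rw [show 4 * (δ / (4 * (N + 1))) * N = δ * (N / (N + 1)) by field_simp]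
  exact mul_le_of_le_one_right hδ.le ((div_le_one (by positivity)).2 (by linarith))

end WeightedEstimate

section WeightedSolution

variable {n : ℕ} {Ω : Set (Fin n → ℂ)} {Φ G : (Fin n → ℂ) → ℝ}
  {α : Fin n → (Fin n → ℂ) → ℂ} {χ : (Fin n → ℂ) → ℂ} {A : ℝ}

theorem pairing_estimate (hΩ : IsOpen Ω) (hΦ : ContDiffOn ℝ 2 Φ Ω) (hΦp : PSHOnC2 n Φ Ω)
    (hcw : ∀ K : Set (Fin n → ℂ), IsCompact K → K ⊆ Ω → ∃ k T, CutoffWeights n Ω K k T)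
    (hα : ∀ j, ContDiff ℝ 2 (α j)) (hαc : ∀ j, HasCompactSupport (α j))
    (hαΩ : ∀ j, tsupport (α j) ⊆ Ω) (hχ : ContDiff ℝ 2 χ) (hχc : HasCompactSupport χ)
    (hχΩ : tsupport χ ⊆ Ω) (hG0 : ∀ z, 0 ≤ G z)
    (hG : ∀ z ∈ Ω, ∀ X : Fin n → ℂ, ‖∑ j, X j * (starRingEnd ℂ) (wderBar n j χ z)‖ ^ 2
      ≤ G z * hermForm n (cHess n Φ z) X X)
    (hGi : Integrable fun z => G z * Real.exp (-Φ z))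
    (hGA : ∫ z, G z * Real.exp (-Φ z) ≤ A) :
    ‖∑ j, ∫ z, α j z * (starRingEnd ℂ) (wderBar n j χ z) * Real.exp (-Φ z)‖
      ≤ (1 / 2) * (A + ∫ z, ‖∑ j, twDer n Φ j (α j) z‖ ^ 2 * Real.exp (-Φ z)) := by
  obtain ⟨ζ, hζ, hζc, hζΩ, hζ1, hζI⟩ := exists_smooth_cutoff hΩ hχc hχΩ
  let K := tsupport ζ ∪ ⋃ j, tsupport (α j)
  have hK : IsCompact K := IsCompact.union hζc (isCompact_iUnion fun j => hαc j)
  have hKΩ : K ⊆ Ω := union_subset hζΩ (iUnion_subset hαΩ)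
  have hχK : tsupport χ ⊆ K := fun z hz => Or.inl (subset_tsupport _ (by
    rw [Function.mem_support, hζ1.self_of_nhdsSet z hz]; norm_num))
  obtain ⟨k, T, hkT⟩ := hcw K hK hKΩ
  obtain ⟨B, hB, ho, hest⟩ := exists_weighted_estimate hΩ hΦ hΦp hKΩ hkT hα hαc
    (fun j => (subset_iUnion (fun j => tsupport (α j)) j).trans subset_union_right) hζ.continuous
    hζc subset_union_left fun z => (hζI z).2
  have hE : ContinuousOn (fun z => k z - Φ z - T z) Ω :=
    ((hkT.contDiffOn_left.sub hΦ).sub hkT.contDiffOn_right).continuousOn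
  have hχ1 : ContDiff ℝ 1 χ := hχ.of_le (by norm_num)
  have hb0 : ∀ z ∉ tsupport χ, ∀ j, wderBar n j χ z = 0 := fun z hz j => by
    rw [wderBar_eq_dW, dW_eq_zero_of_notMem _ _ hz]
  have hqα : ∀ j, MemLp (fun z => cexp (1 * ((k z - Φ z - T z : ℝ) : ℂ) / 2) * α j z) 2 := fun j =>
    memLp_halfWeight_mul hΩ hE (hα j).continuous (hαc j) (hαΩ j)
  have hqχ : ∀ j, MemLp (fun z => cexp (1 * ((k z - Φ z - T z : ℝ) : ℂ) / 2)
      * wderBar n j χ z) 2 := fun j =>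
    memLp_halfWeight_mul hΩ hE (wderBar_continuous j hχ1)
      (by rw [wderBar_eq_dW]; exact dW_hasCompactSupport _ _ hχc)
      ((by rw [wderBar_eq_dW]; exact tsupport_dW_subset _ _ : _ ⊆ tsupport χ).trans hχΩ)
  have hq : ∀ z ∈ K, k z - Φ z - T z = -Φ z := fun z hz => by
    obtain ⟨h1, h2⟩ := hkT.eq_zero.self_of_nhdsSet z hz
    rw [h1, h2]; ring
  have h0 := ho χ hχ hχc hχΩ
  have e1 : ∀ j, ∫ z, (cexp (1 * ((k z - Φ z - T z : ℝ) : ℂ) / 2) * α j z - B j z)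
        * (starRingEnd ℂ) (cexp (1 * ((k z - Φ z - T z : ℝ) : ℂ) / 2) * wderBar n j χ z)
      = (∫ z, α j z * (starRingEnd ℂ) (wderBar n j χ z) * Real.exp (-Φ z))
        - ∫ z, B j z * (starRingEnd ℂ) (cexp (1 * ((k z - Φ z - T z : ℝ) : ℂ) / 2)
          * wderBar n j χ z) := fun j => by
    have e2 : ∫ z, α j z * (starRingEnd ℂ) (wderBar n j χ z) * Real.exp (-Φ z)
        = ∫ z, cexp (1 * ((k z - Φ z - T z : ℝ) : ℂ) / 2) * α j z
          * (starRingEnd ℂ) (cexp (1 * ((k z - Φ z - T z : ℝ) : ℂ) / 2) * wderBar n j χ z) := by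
      refine integral_congr_ae (ae_of_all _ fun z => ?_)
      by_cases hz : z ∈ tsupport χ
      · have h3 : ((Real.exp (-Φ z) : ℝ) : ℂ) = cexp (1 * ((-Φ z : ℝ) : ℂ) / 2)
            * cexp (1 * ((-Φ z : ℝ) : ℂ) / 2) := by
          rw [Complex.ofReal_exp, ← Complex.exp_add]
          congr 1
          ring
        have h4 : (starRingEnd ℂ) (cexp (1 * ((-Φ z : ℝ) : ℂ) / 2))
            = cexp (1 * ((-Φ z : ℝ) : ℂ) / 2) := by
          rw [← Complex.exp_conj]
          congr 1
          simp [Complex.conj_ofNat]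
        simp only [hq z (hχK hz), h3, map_mul, h4]
        ring
      · simp [hb0 z hz]
    rw [e2, ← integral_sub (integrable_mul_conj (hqα j) (hqχ j))
      (integrable_mul_conj (hB j) (hqχ j))]
    simp only [sub_mul]
  simp only [e1, Finset.sum_sub_distrib] at h0
  rw [sub_eq_zero.1 h0, ← integral_finsetSum _ fun j _ => integrable_mul_conj (hB j) (hqχ j)]
  obtain ⟨Φ', hΦ', -, eΦ⟩ := exists_contDiff_eventuallyEq hΩ hζc hζΩ hΦ
  have hiH : Integrable fun z => hermForm n (cHess n Φ z) (fun j => B j z) (fun j => B j z)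
      * ζ z := by
    refine (integrable_hermForm_cutoff hΦ' hζ.continuous hζc hB).congr (ae_of_all _ fun z => ?_)
    by_cases hz : ζ z = 0
    · simp [hz]
    · simp only
      rw [show cHess n Φ z = cHess n Φ' z from funext fun j => funext fun l =>
        (cHess_congr (eΦ z (subset_tsupport _ hz)) j l).symm]
  refine (norm_integral_le_integral_norm _).trans ?_
  have hpt : ∀ z, ‖∑ j, B j z * (starRingEnd ℂ) (cexp (1 * ((k z - Φ z - T z : ℝ) : ℂ) / 2)
      * wderBar n j χ z)‖ ≤ (1 / 2) * (G z * Real.exp (-Φ z)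
        + hermForm n (cHess n Φ z) (fun j => B j z) (fun j => B j z) * ζ z) := by
    intro z
    by_cases hz : z ∈ tsupport χ
    · have h1 : ‖∑ j, B j z * (starRingEnd ℂ) (cexp (1 * ((k z - Φ z - T z : ℝ) : ℂ) / 2)
          * wderBar n j χ z)‖ ^ 2 = Real.exp (-Φ z)
            * ‖∑ j, B j z * (starRingEnd ℂ) (wderBar n j χ z)‖ ^ 2 := by
        rw [hq z (hχK hz)]
        have : ∀ j, B j z * (starRingEnd ℂ) (cexp (1 * ((-Φ z : ℝ) : ℂ) / 2) * wderBar n j χ z)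
            = (starRingEnd ℂ) (cexp (1 * ((-Φ z : ℝ) : ℂ) / 2))
              * (B j z * (starRingEnd ℂ) (wderBar n j χ z)) := fun j => by rw [map_mul]; ring
        simp only [this, ← Finset.mul_sum]
        rw [norm_mul, mul_pow, RCLike.norm_conj, Complex.norm_exp, ← Real.exp_nat_mul]
        congr 2
        norm_cast
        simp
        ring
      have h2 := hG z (hχΩ hz) fun j => B j z
      have h3 := hΦp z (hχΩ hz) fun j => B j z
      rw [hζ1.self_of_nhdsSet z hz, mul_one]
      set H := hermForm n (cHess n Φ z) (fun j => B j z) (fun j => B j z)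
      set x := ‖∑ j, B j z * (starRingEnd ℂ) (cexp (1 * ((k z - Φ z - T z : ℝ) : ℂ) / 2)
          * wderBar n j χ z)‖
      have h4 : x ^ 2 ≤ (G z * Real.exp (-Φ z)) * H := by
        rw [h1]
        nlinarith [Real.exp_pos (-Φ z)]
      have h5 : 0 ≤ G z * Real.exp (-Φ z) := mul_nonneg (hG0 z) (Real.exp_pos _).le
      refine abs_le_of_sq_le_sq' ?_ (by positivity) |>.2
      nlinarith [sq_nonneg (G z * Real.exp (-Φ z) - H)]
    · simp only [hb0 z hz]
      have h5 : 0 ≤ G z * Real.exp (-Φ z) := mul_nonneg (hG0 z) (Real.exp_pos _).le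
      have h6 : 0 ≤ hermForm n (cHess n Φ z) (fun j => B j z) (fun j => B j z) * ζ z := by
        by_cases hz : ζ z = 0
        · simp [hz]
        · exact mul_nonneg (hΦp z (hζΩ (subset_tsupport _ hz)) _) (hζI z).1
      simp only [mul_zero, map_zero, Finset.sum_const_zero, norm_zero]
      positivity
  refine (integral_mono (integrable_finsetSum _ fun j _ =>
    integrable_mul_conj (hB j) (hqχ j)).norm ((hGi.add hiH).const_mul _) hpt).trans ?_
  rw [integral_const_mul]
  have e3 : ∫ z, (G z * Real.exp (-Φ z)
      + hermForm n (cHess n Φ z) (fun j => B j z) (fun j => B j z) * ζ z)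
      = (∫ z, G z * Real.exp (-Φ z))
        + ∫ z, hermForm n (cHess n Φ z) (fun j => B j z) (fun j => B j z) * ζ z :=
    integral_add hGi hiH
  simp only [Pi.add_apply]
  rw [e3]
  gcongr

theorem memLp_of_continuousOn {F : (Fin n → ℂ) → ℂ} {L : Set (Fin n → ℂ)} (hΩ : IsOpen Ω)
    (hF : ContinuousOn F Ω) (hL : IsCompact L) (hLΩ : L ⊆ Ω) (h0 : ∀ z ∉ L, F z = 0) :
    MemLp F 2 := by
  have hs : tsupport F ⊆ L := closure_minimal (fun z hz => by
    by_contra h; exact hz (h0 z h)) hL.isClosed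
  exact (hF.continuous_of_tsupport_subset hΩ (hs.trans hLΩ)).memLp_of_hasCompactSupport
    (hL.of_isClosed_subset (isClosed_tsupport _) hs)

theorem twDer_add {u v : (Fin n → ℂ) → ℂ} {z : Fin n → ℂ} (j : Fin n)
    (hu : DifferentiableAt ℝ u z) (hv : DifferentiableAt ℝ v z) :
    twDer n Φ j (fun w => u w + v w) z = twDer n Φ j u z + twDer n Φ j v z := by
  simp only [twDer, wder_eq_dW]
  rw [dW_add _ _ hu hv]
  ring

theorem twDer_const_mul {u : (Fin n → ℂ) → ℂ} {z : Fin n → ℂ} (j : Fin n) (c : ℂ)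
    (hu : DifferentiableAt ℝ u z) :
    twDer n Φ j (fun w => c * u w) z = c * twDer n Φ j u z := by
  simp only [twDer, wder_eq_dW]
  rw [dW_mul _ _ (differentiableAt_const c) hu, dW_const]
  ring

theorem twDer_eq_zero_of_notMem {u : (Fin n → ℂ) → ℂ} {z : Fin n → ℂ} (j : Fin n)
    (hz : z ∉ tsupport u) : twDer n Φ j u z = 0 := by
  rw [twDer, wder_eq_dW, dW_eq_zero_of_notMem _ _ hz, image_eq_zero_of_notMem_tsupport hz]
  simp

theorem twDer_weight_congr {Ψ : (Fin n → ℂ) → ℝ} {z : Fin n → ℂ} (h : Φ =ᶠ[𝓝 z] Ψ) (j : Fin n)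
    (u : (Fin n → ℂ) → ℂ) : twDer n Φ j u z = twDer n Ψ j u z := by
  have e2 : (fun v => (Φ v : ℂ)) =ᶠ[𝓝 z] fun v => (Ψ v : ℂ) := h.mono fun v hv => congrArg _ hv
  simp only [twDer, wder_congr e2]

theorem twDer_mul_exp {v : (Fin n → ℂ) → ℂ} (hΦ : ContDiff ℝ 1 Φ) (hv : ContDiff ℝ 1 v)
    (j : Fin n) (z : Fin n → ℂ) :
    twDer n Φ j (fun w => v w * cexp (Φ w : ℂ)) z = wder n j v z * cexp (Φ z : ℂ) := by
  have h := dW_weight_mul (-I) j hΦ.neg hv z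
  have h2 := wder_neg_ofReal (φ := Φ) (z := z) j
  simp only [Complex.ofReal_neg, neg_neg] at h h2
  simp only [twDer]
  simp only [wder_eq_dW] at h2 ⊢
  rw [h, h2]
  ring

theorem exists_l2_solution (hΩ : IsOpen Ω) (hΦ : ContDiffOn ℝ 2 Φ Ω) (hΦp : PSHOnC2 n Φ Ω)
    (hcw : ∀ K : Set (Fin n → ℂ), IsCompact K → K ⊆ Ω → ∃ k T, CutoffWeights n Ω K k T)
    (hχ : ContDiff ℝ 2 χ) (hχc : HasCompactSupport χ) (hχΩ : tsupport χ ⊆ Ω) (hG0 : ∀ z, 0 ≤ G z)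
    (hG : ∀ z ∈ Ω, ∀ X : Fin n → ℂ, ‖∑ j, X j * (starRingEnd ℂ) (wderBar n j χ z)‖ ^ 2
      ≤ G z * hermForm n (cHess n Φ z) X X)
    (hGi : Integrable fun z => G z * Real.exp (-Φ z))
    (hGA : ∫ z, G z * Real.exp (-Φ z) ≤ A) :
    ∃ u : (Fin n → ℂ) → ℂ, MemLp u 2 ∧ ∫ z, ‖u z‖ ^ 2 ≤ A ∧
      ∀ ψ : (Fin n → ℂ) → ℂ, ContDiff ℝ 2 ψ → HasCompactSupport ψ → tsupport ψ ⊆ Ω → ∀ j,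
        ∫ z, (χ z - cexp ((Φ z : ℂ) / 2) * u z) * wderBar n j ψ z = 0 := by
  let q : (Fin n → ℂ) → ℂ := fun z => cexp (1 * ((-Φ z : ℝ) : ℂ) / 2)
  have hqd : ∀ z, q z = cexp (1 * ((-Φ z : ℝ) : ℂ) / 2) := fun z => rfl
  have hqc : ContinuousOn q Ω := by
    have : ContinuousOn (fun z => ((-Φ z : ℝ) : ℂ)) Ω :=
      Complex.continuous_ofReal.comp_continuousOn hΦ.neg.continuousOn
    fun_prop
  have hq1 : ∀ z, (starRingEnd ℂ) (q z) = q z := fun z => by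
    rw [hqd, ← Complex.exp_conj]
    congr 1
    simp [Complex.conj_ofNat]
  have hq2 : ∀ z, q z * q z = cexp (-(Φ z : ℂ)) := fun z => by
    rw [hqd, ← Complex.exp_add]
    congr 1
    push_cast
    ring
  have hq3 : ∀ z, ‖q z‖ ^ 2 = Real.exp (-Φ z) := fun z => by
    rw [hqd, Complex.norm_exp, ← Real.exp_nat_mul]
    congr 1
    norm_cast
    simp
    ring
  have hq4 : ∀ z, q z * cexp ((Φ z : ℂ) / 2) = 1 := fun z => by
    have h0 : 1 * ((-Φ z : ℝ) : ℂ) / 2 + (Φ z : ℂ) / 2 = 0 := by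
      push_cast
      ring
    rw [hqd, ← Complex.exp_add, h0, Complex.exp_zero]
  let S : Set (Unit → (Fin n → ℂ) → ℂ) := {s | ∃ α : Fin n → (Fin n → ℂ) → ℂ,
    (∀ j, ContDiff ℝ 2 (α j)) ∧ (∀ j, HasCompactSupport (α j)) ∧ (∀ j, tsupport (α j) ⊆ Ω) ∧
    s = fun _ z => q z * ∑ j, twDer n Φ j (α j) z}
  have hd : ∀ {v : (Fin n → ℂ) → ℂ}, ContDiff ℝ 2 v → ∀ z, DifferentiableAt ℝ v z :=
    fun h z => h.differentiable (by norm_num) z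
  have hS0 : (fun _ _ => 0) ∈ S := by
    refine ⟨fun _ _ => 0, fun _ => contDiff_const, fun _ => HasCompactSupport.zero,
      fun _ => by simp [tsupport], ?_⟩
    funext _ z
    simp [twDer, wder_eq_dW, dW_const]
  have hSadd : ∀ s ∈ S, ∀ t ∈ S, (fun j z => s j z + t j z) ∈ S := by
    rintro _ ⟨v, h1, h2, h3, rfl⟩ _ ⟨w, h4, h5, h6, rfl⟩
    refine ⟨fun j z => v j z + w j z, fun j => (h1 j).add (h4 j), fun j => (h2 j).add (h5 j),
      fun j => (tsupport_add _ _).trans (union_subset (h3 j) (h6 j)), ?_⟩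
    funext _ z
    simp only [twDer_add _ (hd (h1 _) z) (hd (h4 _) z), Finset.sum_add_distrib]
    ring
  have hSmul : ∀ (c : ℂ), ∀ s ∈ S, (fun j z => c * s j z) ∈ S := by
    rintro c _ ⟨v, h1, h2, h3, rfl⟩
    refine ⟨fun j z => c * v j z, fun j => contDiff_const.mul (h1 j), fun j => (h2 j).mul_left,
      fun j => (tsupport_mul_subset_right).trans (h3 j), ?_⟩
    funext _ z
    simp only [twDer_const_mul _ c (hd (h1 _) z), ← Finset.mul_sum]
    ring
  have hSL : ∀ s ∈ S, ∀ j, MemLp (s j) 2 := by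
    rintro _ ⟨v, h1, h2, h3, rfl⟩ _
    refine memLp_of_continuousOn hΩ (L := ⋃ j, tsupport (v j)) ?_
      (isCompact_iUnion fun j => h2 j) (iUnion_subset h3) fun z hz => ?_
    · refine hqc.mul (continuousOn_finsetSum _ fun j _ => ?_)
      refine (wder_continuous j ((h1 j).of_le (by norm_num))).continuousOn.sub
        (ContinuousOn.mul ?_ (h1 j).continuous.continuousOn)
      rw [wder_eq_dW]
      exact (dW_contDiffOn (m' := 1) _ _ hΩ (Complex.ofRealCLM.contDiff.comp_contDiffOn hΦ)
        (by norm_num)).continuousOn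
    · simp only [mem_iUnion, not_exists] at hz
      simp [twDer_eq_zero_of_notMem _ (hz _)]
  have ha : MemLp (fun z => q z * χ z) 2 :=
    memLp_halfWeight_mul hΩ hΦ.neg.continuousOn hχ.continuous hχc hχΩ
  obtain ⟨B, s, hsS, hsB, hBo⟩ := exists_l2_projection S hS0 hSadd hSmul hSL
    (fun _ z => q z * χ z) (fun _ => ha)
  have hBm : MemLp (B ()) 2 := (hsB ()).memLp_lim
  refine ⟨B (), hBm, ?_, fun ψ hψ hψc hψΩ j => ?_⟩
  · have hle : ∀ i, ‖∫ z, B () z * (starRingEnd ℂ) (s i () z)‖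
        ≤ (1 / 2) * (A + ∫ z, ‖s i () z‖ ^ 2 * 1) := by
      intro i
      have h0 := hBo _ (hsS i)
      obtain ⟨α, h1, h2, h3, h4⟩ := hsS i
      have hsm : MemLp (s i ()) 2 := (hsB ()).memLp i
      have e1 : ∫ z, (q z * χ z - B () z) * (starRingEnd ℂ) (s i () z)
          = (∫ z, q z * χ z * (starRingEnd ℂ) (s i () z))
            - ∫ z, B () z * (starRingEnd ℂ) (s i () z) := by
        rw [← integral_sub (integrable_mul_conj ha hsm) (integrable_mul_conj hBm hsm)]
        simp only [sub_mul]
      simp only [Finset.univ_unique, PUnit.default_eq_unit, Finset.sum_singleton] at h0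
      rw [e1] at h0
      rw [← sub_eq_zero.1 h0]
      have hL : IsCompact (tsupport χ ∪ ⋃ j, tsupport (α j)) :=
        IsCompact.union hχc (isCompact_iUnion fun j => h2 j)
      obtain ⟨Φ', hΦ', -, eΦ⟩ := exists_contDiff_eventuallyEq hΩ hL
        (union_subset hχΩ (iUnion_subset h3)) hΦ
      have hΦ1 : ContDiff ℝ 1 Φ' := hΦ'.of_le (by norm_num)
      have hχ1 : ContDiff ℝ 1 χ := hχ.of_le (by norm_num)
      have hα1 : ∀ j, ContDiff ℝ 1 (α j) := fun j => (h1 j).of_le (by norm_num)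
      have htw : ∀ j z, χ z * (starRingEnd ℂ) (twDer n Φ j (α j) z) * cexp (-(Φ z : ℂ))
          = χ z * (starRingEnd ℂ) (twDer n Φ' j (α j) z) * cexp (-(Φ' z : ℂ)) := fun j z => by
        by_cases hz : z ∈ tsupport χ
        · rw [twDer_weight_congr (eΦ z (Or.inl hz)), (eΦ z (Or.inl hz)).self_of_nhds]
        · simp [image_eq_zero_of_notMem_tsupport hz]
      have e2 : ∀ j, ∫ z, χ z * (starRingEnd ℂ) (twDer n Φ j (α j) z) * cexp (-(Φ z : ℂ))
          = -(starRingEnd ℂ) (∫ z, α j z * (starRingEnd ℂ) (wderBar n j χ z)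
            * Real.exp (-Φ z)) := fun j => by
        simp only [htw]
        rw [integral_mul_twDer j hΦ1 hχ1 (hα1 j) (h2 j), ← integral_conj]
        congr 2
        funext z
        by_cases hz : z ∈ tsupport χ
        · rw [(eΦ z (Or.inl hz)).self_of_nhds]
          simp only [map_mul, Complex.conj_conj, Complex.conj_ofReal]
          push_cast
          ring
        · simp [wderBar_eq_dW, dW_eq_zero_of_notMem _ _ hz]
      have e3 : ∫ z, q z * χ z * (starRingEnd ℂ) (s i () z)
          = ∑ j, ∫ z, χ z * (starRingEnd ℂ) (twDer n Φ j (α j) z) * cexp (-(Φ z : ℂ)) := by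
        rw [← integral_finsetSum]
        · refine integral_congr_ae (ae_of_all _ fun z => ?_)
          simp only [h4, map_mul, hq1, map_sum, ← Finset.mul_sum, ← Finset.sum_mul, ← hq2]
          ring
        · intro j _
          simp only [htw]
          have c1 : Continuous (twDer n Φ' j (α j)) := (wder_continuous j (hα1 j)).sub
            ((wder_contDiff hΦ' j).continuous.mul (hα1 j).continuous)
          refine Continuous.integrable_of_hasCompactSupport ?_
            (HasCompactSupport.mul_right (hχc.mul_right))
          have := hΦ'.continuous
          have := hχ.continuous
          fun_prop
      rw [e3]
      simp only [e2, Finset.sum_neg_distrib, norm_neg, ← map_sum, RCLike.norm_conj]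
      refine (pairing_estimate hΩ hΦ hΦp hcw h1 h2 h3 hχ hχc hχΩ hG0 hG hGi hGA).trans
        (le_of_eq ?_)
      congr 2
      refine integral_congr_ae (ae_of_all _ fun z => ?_)
      simp only [h4, norm_mul, mul_pow, hq3]
      ring
    have l1 := ((L2Tendsto.const hBm).integral_mul_conj (hsB ())).norm
    have l2 := (((hsB ()).integral_norm_sq (w := fun _ => 1) continuous_const (C := 1)
      (by simp)).const_add A).const_mul (1 / 2)
    have l3 := le_of_tendsto_of_tendsto' l1 l2 hle
    have e4 : ∫ z, B () z * (starRingEnd ℂ) (B () z) = ((∫ z, ‖B () z‖ ^ 2 : ℝ) : ℂ) := by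
      rw [← integral_complex_ofReal]
      refine integral_congr_ae (ae_of_all _ fun z => ?_)
      simp only [Complex.mul_conj, Complex.normSq_eq_norm_sq]
    rw [e4, Complex.norm_real, Real.norm_eq_abs] at l3
    simp only [mul_one] at l3
    have := le_abs_self (∫ z, ‖B () z‖ ^ 2)
    linarith
  · obtain ⟨Φ', hΦ', -, eΦ⟩ := exists_contDiff_eventuallyEq hΩ hψc hψΩ hΦ
    have hψ1 : ContDiff ℝ 1 ψ := hψ.of_le (by norm_num)
    have hcs : HasCompactSupport (fun z => (starRingEnd ℂ) (ψ z)) :=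
      hψc.comp_left (g := starRingEnd ℂ) (by simp)
    have hts : tsupport (fun z => (starRingEnd ℂ) (ψ z) * cexp (Φ' z : ℂ)) ⊆ tsupport ψ :=
      closure_mono fun z hz => by
        simp only [Function.mem_support, ne_eq, mul_eq_zero, not_or] at hz ⊢
        simpa using hz.1
    classical
    have hmem : (fun (_ : Unit) z => q z * ∑ l, twDer n Φ l
        ((fun l => if l = j then fun z => (starRingEnd ℂ) (ψ z) * cexp (Φ' z : ℂ)
          else fun _ => 0) l) z) ∈ S := by
      refine ⟨_, fun l => ?_, fun l => ?_, fun l => ?_, rfl⟩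
      · split_ifs
        · exact (contDiff_conj hψ).mul (contDiff_ofReal_comp hΦ').cexp
        · exact contDiff_const
      · split_ifs
        · exact hcs.mul_right
        · exact HasCompactSupport.zero
      · split_ifs
        · exact hts.trans hψΩ
        · simp [tsupport]
    have h0 := hBo _ hmem
    simp only [Finset.univ_unique, PUnit.default_eq_unit, Finset.sum_singleton] at h0
    rw [← h0]
    refine integral_congr_ae (ae_of_all _ fun z => ?_)
    simp only
    rw [Finset.sum_eq_single j (fun l _ hl => by simp [hl, twDer, wder_eq_dW, dW_const])
      (fun h => absurd (Finset.mem_univ j) h)]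
    simp only [if_true]
    by_cases hz : z ∈ tsupport ψ
    · rw [twDer_weight_congr (eΦ z hz).symm, twDer_mul_exp (hΦ'.of_le (by norm_num))
        (contDiff_conj hψ1), wder_conj, (eΦ z hz).self_of_nhds]
      have h5 : cexp (Φ z : ℂ) = cexp ((Φ z : ℂ) / 2) * cexp ((Φ z : ℂ) / 2) := by
        rw [← Complex.exp_add]
        congr 1
        ring
      have h6 : (starRingEnd ℂ) (cexp (Φ z : ℂ)) = cexp (Φ z : ℂ) := by
        rw [← Complex.exp_conj, Complex.conj_ofReal]
      rw [map_mul, map_mul, Complex.conj_conj, hq1, h6, h5]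
      have h7 := hq4 z
      set a := cexp ((Φ z : ℂ) / 2)
      linear_combination (-(χ z * wderBar n j ψ z * (q z * a + 1)) + B () z * wderBar n j ψ z * a) * h7
    · rw [twDer_eq_zero_of_notMem j fun h => hz (hts h)]
      simp [wderBar_eq_dW, dW_eq_zero_of_notMem _ _ hz]

end WeightedSolution

section MeanValue

variable {n : ℕ} {U : Set (Fin n → ℂ)} {F k : (Fin n → ℂ) → ℂ} {p : Fin n → ℂ}

theorem measurePreserving_smul_of_norm_eq_one {a : ℂ} (ha : ‖a‖ = 1) :
    MeasurePreserving (fun t : Fin n → ℂ => a • t) := by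
  have h := (rotation ⟨a, by simp [Submonoid.unitSphere, ha]⟩).measurePreserving
  exact volume_preserving_pi (f := fun _ : Fin n => fun z : ℂ => a * z) fun _ => h

theorem integral_smul_eq_of_norm_eq_one {a : ℂ} (ha : ‖a‖ = 1) (f : (Fin n → ℂ) → ℂ) :
    ∫ t, f (a • t) = ∫ t, f t := by
  have ha0 : a ≠ 0 := fun h => by simp [h] at ha
  exact (measurePreserving_smul_of_norm_eq_one ha).integral_comp
    (Homeomorph.smulOfNeZero a ha0).measurableEmbedding f

theorem circleAverage_add_smul (hU : IsOpen U) (hF : DifferentiableOn ℂ F U) {t : Fin n → ℂ}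
    (ht : ∀ a : ℂ, ‖a‖ ≤ 1 → p + a • t ∈ U) :
    Real.circleAverage (fun a : ℂ => F (p + a • t)) 0 1 = F p := by
  have hd : ∀ a : ℂ, ‖a‖ ≤ 1 → DifferentiableAt ℂ (fun a : ℂ => F (p + a • t)) a := fun a ha =>
    ((hF.differentiableAt (hU.mem_nhds (ht a ha))).comp a
      (by fun_prop : DifferentiableAt ℂ (fun a : ℂ => p + a • t) a) :)
  have := circleAverage_of_differentiable_on_off_countable (f := fun a : ℂ => F (p + a • t))
    (c := 0) (R := 1) countable_empty
    (fun a ha => (hd a (by simpa using ha)).continuousAt.continuousWithinAt)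
    (fun a ha => hd a (by
      have := ha.1
      simp only [abs_one, Metric.mem_ball, dist_zero_right] at this
      exact this.le))
  simpa using this

/-- Mean value property of holomorphic functions with respect to circle-invariant kernels. -/
theorem integral_circleInvariant_mul (hU : IsOpen U) (hF : DifferentiableOn ℂ F U)
    (hk : Continuous k) (hkc : HasCompactSupport k)
    (hinv : ∀ (a : ℂ) (t : Fin n → ℂ), ‖a‖ = 1 → k (a • t) = k t)
    (hsub : ∀ t ∈ tsupport k, ∀ a : ℂ, ‖a‖ ≤ 1 → p + a • t ∈ U) :
    ∫ t, k t * F (p + t) = (∫ t, k t) * F p := by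
  let H : ℝ → (Fin n → ℂ) → ℂ := fun θ t => k t * F (p + circleMap 0 1 θ • t)
  have hcm : ∀ θ : ℝ, ‖circleMap 0 1 θ‖ = 1 := fun θ => by simp [circleMap]
  have hcont : Continuous (Function.uncurry H) := by
    rw [continuous_iff_continuousAt]
    rintro ⟨θ, t⟩
    by_cases ht : t ∈ tsupport k
    · have h1 : ContinuousAt F (p + circleMap 0 1 θ • t) :=
        (hF.differentiableAt (hU.mem_nhds (hsub t ht _ (hcm θ).le))).continuousAt
      have h2 : ContinuousAt (fun x : ℝ × (Fin n → ℂ) => p + circleMap 0 1 x.1 • x.2) (θ, t) := by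
        have := continuous_circleMap 0 1
        fun_prop
      exact (hk.comp continuous_snd).continuousAt.mul
        (ContinuousAt.comp (g := F) (f := fun x : ℝ × (Fin n → ℂ) => p + circleMap 0 1 x.1 • x.2)
          (x := (θ, t)) h1 h2)
    · have h1 : ∀ᶠ x : ℝ × (Fin n → ℂ) in 𝓝 (θ, t), k x.2 = 0 :=
        continuous_snd.continuousAt.eventually (notMem_tsupport_iff_eventuallyEq.1 ht)
      refine (continuousAt_congr (f := fun _ => (0 : ℂ)) ?_).1 continuousAt_const
      filter_upwards [h1] with x hx
      simp [H, Function.uncurry, hx]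
  have hInt : Integrable (Function.uncurry H)
      ((volume.restrict (Set.uIoc 0 (2 * Real.pi))).prod volume) := by
    have h1 : IntegrableOn (Function.uncurry H) (Icc 0 (2 * Real.pi) ×ˢ tsupport k)
        ((volume : Measure ℝ).prod volume) :=
      hcont.continuousOn.integrableOn_compact (isCompact_Icc.prod hkc)
    have h2 : IntegrableOn (Function.uncurry H) (Icc 0 (2 * Real.pi) ×ˢ univ)
        ((volume : Measure ℝ).prod volume) := by
      refine h1.of_forall_sdiff_eq_zero (measurableSet_Icc.prod MeasurableSet.univ) ?_
      rintro ⟨θ, t⟩ ⟨⟨h3, -⟩, h4⟩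
      have : t ∉ tsupport k := fun h => h4 ⟨h3, h⟩
      simp [H, Function.uncurry, image_eq_zero_of_notMem_tsupport this]
    have h3 := h2.mono_set (prod_mono_left (t := univ)
      (Ioc_subset_Icc_self : Ioc 0 (2 * Real.pi) ⊆ _))
    rw [uIoc_of_le Real.two_pi_pos.le]
    rw [IntegrableOn, ← Measure.prod_restrict, Measure.restrict_univ] at h3
    exact h3
  have hswap := intervalIntegral_integral_swap hInt
  have e1 : ∀ θ, ∫ t, H θ t = ∫ t, k t * F (p + t) := fun θ => by
    have h := integral_smul_eq_of_norm_eq_one (hcm θ) (fun t => k t * F (p + t))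
    simp only [hinv _ _ (hcm θ)] at h
    exact h
  have e2 : ∀ t, ∫ θ in (0 : ℝ)..2 * Real.pi, H θ t = k t * ((2 * Real.pi : ℝ) * F p) := fun t => by
    simp only [H]
    rw [intervalIntegral.integral_const_mul]
    by_cases ht : t ∈ tsupport k
    · have := circleAverage_add_smul hU hF (hsub t ht)
      rw [Real.circleAverage] at this
      rw [← this, Complex.real_smul, Complex.ofReal_inv, mul_inv_cancel_left₀]
      exact_mod_cast Real.two_pi_pos.ne'
    · simp [image_eq_zero_of_notMem_tsupport ht]
  simp only [e1, e2, intervalIntegral.integral_const, sub_zero] at hswap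
  rw [integral_mul_const, Complex.real_smul] at hswap
  have h2 : ((2 * Real.pi : ℝ) : ℂ) ≠ 0 := by exact_mod_cast Real.two_pi_pos.ne'
  refine mul_left_cancel₀ h2 ?_
  rw [hswap]
  ring

end MeanValue

section WeylLemma

variable {n : ℕ} {V Ω : Set (Fin n → ℂ)} {f g : (Fin n → ℂ) → ℂ} {z : Fin n → ℂ}

theorem differentiableAt_of_wderBar_eq_zero (hf : DifferentiableAt ℝ f z)
    (h : ∀ j, wderBar n j f z = 0) : DifferentiableAt ℂ f z := by
  rw [differentiableAt_iff_restrictScalars ℝ hf]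
  refine ⟨∑ j, (fderiv ℝ f z (Pi.single j 1)) •
    (ContinuousLinearMap.proj j : (Fin n → ℂ) →L[ℂ] ℂ), ?_⟩
  ext x
  have h1 : ∀ j, fderiv ℝ f z (Pi.single j (x j)) = fderiv ℝ f z (Pi.single j 1) * x j := by
    intro j
    have h2 := h j
    simp only [wderBar] at h2
    have h3 : fderiv ℝ f z (Pi.single j Complex.I) = Complex.I * fderiv ℝ f z (Pi.single j 1) := by
      linear_combination (-2 * Complex.I) * h2 + fderiv ℝ f z (Pi.single j Complex.I) * Complex.I_sq
    have h4 : (Pi.single j (x j) : Fin n → ℂ)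
        = (x j).re • (Pi.single j 1 : Fin n → ℂ) + (x j).im • (Pi.single j Complex.I : Fin n → ℂ) := by
      rw [← Pi.single_smul, ← Pi.single_smul, ← Pi.single_add]
      congr 1
      simp [Complex.re_add_im]
    rw [h4, map_add, map_smul, map_smul, h3]
    conv_rhs => rw [← Complex.re_add_im (x j)]
    simp only [Complex.real_smul]
    ring
  conv_rhs => rw [← Finset.univ_sum_single x]
  rw [map_sum]
  simp [h1]

theorem IsMollifier.differentiableAt_moll {δ : ℝ} {κ : (Fin n → ℂ) → ℝ} (h : IsMollifier n δ κ)
    (hg : MemLp g 2) (hw : ∀ ψ : (Fin n → ℂ) → ℂ, ContDiff ℝ 2 ψ → HasCompactSupport ψ →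
      tsupport ψ ⊆ V → ∀ j, ∫ z, g z * wderBar n j ψ z = 0)
    (hz : Metric.closedBall z δ ⊆ V) : DifferentiableAt ℂ (moll n κ g) z := by
  have hl : LocallyIntegrable g := hg.locallyIntegrable (by norm_num)
  have hκ : ContDiff ℝ 2 (fun z => (κ z : ℂ)) :=
    (contDiff_ofReal_comp h.contDiff).of_le (by norm_cast)
  refine differentiableAt_of_wderBar_eq_zero
    ((h.contDiff_moll hl).differentiable (by simp) z) fun j => ?_
  rw [wderBar_eq_dW, h.dW_moll hl]
  have hs : Function.support (fun w => (κ (z - w) : ℂ)) ⊆ Metric.closedBall z δ := fun w hw => by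
    by_contra hc
    refine hw ?_
    simp only [Metric.mem_closedBall, dist_comm w z, dist_eq_norm, not_le] at hc
    simp [h.eq_zero _ hc.le]
  have h2 : tsupport (fun w => (κ (z - w) : ℂ)) ⊆ Metric.closedBall z δ :=
    closure_minimal hs Metric.isClosed_closedBall
  have h1 := hw (fun w => (κ (z - w) : ℂ)) (hκ.comp (contDiff_const.sub contDiff_id))
    (HasCompactSupport.intro (isCompact_closedBall z δ) fun w hw => by
      by_contra hc
      exact hw (hs hc)) (h2.trans hz) j
  simp only [wderBar_eq_dW, dW_comp_const_sub Complex.I j (hκ.of_le (by norm_num)) z,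
    mul_neg, integral_neg, neg_eq_zero] at h1
  exact h1

theorem IsMollifier.moll_eq_self {δ ε : ℝ} {κ : (Fin n → ℂ) → ℝ} (h : IsMollifier n ε κ)
    (hf : ∀ w ∈ Metric.ball z δ, DifferentiableAt ℂ f w) (hε : ε < δ) : moll n κ f z = f z := by
  have hs : tsupport (fun t => (κ t : ℂ)) ⊆ Metric.closedBall 0 ε :=
    closure_minimal (fun t ht => by
      by_contra hc
      refine ht ?_
      simp only [Metric.mem_closedBall, dist_zero_right, not_le] at hc
      simp [h.eq_zero _ hc.le]) Metric.isClosed_closedBall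
  have h1 := integral_circleInvariant_mul (p := z) (k := fun t => (κ t : ℂ)) Metric.isOpen_ball
    (fun w hw => (hf w hw).differentiableWithinAt)
    (Complex.continuous_ofReal.comp h.contDiff.continuous)
    (h.hasCompactSupport.comp_left (g := ((↑) : ℝ → ℂ)) (by simp))
    (fun a t ha => by rw [h.circle a t ha]) (fun t ht a ha => by
      have := hs ht
      simp only [Metric.mem_closedBall, dist_zero_right, Metric.mem_ball, dist_self_add_left,
        norm_smul] at this ⊢
      nlinarith [norm_nonneg t])
  rw [integral_complex_ofReal, h.integral_eq_one, Complex.ofReal_one, one_mul] at h1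
  rw [moll_eq, ← h1, ← integral_neg_eq_self]
  simp [h.even]

theorem IsMollifier.norm_moll_le {δ : ℝ} {κ : (Fin n → ℂ) → ℝ} (h : IsMollifier n δ κ)
    (hg : MemLp g 2) : ∃ C, ∀ f, MemLp f 2 → ∀ z : Fin n → ℂ,
      ‖moll n κ f z - moll n κ g z‖ ≤ C * (eLpNorm (fun z => f z - g z) 2).toReal := by
  have hκ : Continuous (fun t => (κ t : ℂ)) := Complex.continuous_ofReal.comp h.contDiff.continuous
  have hκc : HasCompactSupport (fun t => (κ t : ℂ)) :=
    h.hasCompactSupport.comp_left (g := ((↑) : ℝ → ℂ)) (by simp)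
  have hκ2 : MemLp (fun t => (κ t : ℂ)) 2 := hκ.memLp_of_hasCompactSupport hκc
  refine ⟨(eLpNorm (fun t => (κ t : ℂ)) 2).toReal, fun f hf z => ?_⟩
  have hp : MeasurePreserving (fun w : Fin n → ℂ => z - w) :=
    Measure.measurePreserving_sub_left volume z
  have h3 : MemLp (fun w => (κ (z - w) : ℂ)) 2 := hκ2.comp_measurePreserving hp
  have h4 : MemLp (fun w => f w - g w) 2 := hf.sub hg
  have e : ∀ q : (Fin n → ℂ) → ℂ, (fun w => q w * (κ (z - w) : ℂ))
      = fun w => q w * (starRingEnd ℂ) (κ (z - w) : ℂ) := fun q => by simp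
  have e1 : moll n κ f z - moll n κ g z
      = ∫ w, (f w - g w) * (starRingEnd ℂ) (κ (z - w) : ℂ) := by
    rw [moll, moll, e f, e g, ← integral_sub (integrable_mul_conj hf h3) (integrable_mul_conj hg h3)]
    simp only [sub_mul]
  have e2 := inner_toLp_eq h4 h3
  rw [e1, ← e2]
  refine (norm_inner_le_norm _ _).trans (le_of_eq ?_)
  rw [Lp.norm_toLp, Lp.norm_toLp, ← eLpNorm_comp_measurePreserving hκ2.1 hp]
  rfl

theorem exists_holomorphic_ae_eq_ball {r : ℝ} (hr : 0 < r) (hV : Metric.ball z (4 * r) ⊆ V)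
    (hg : MemLp g 2) (hw : ∀ ψ : (Fin n → ℂ) → ℂ, ContDiff ℝ 2 ψ → HasCompactSupport ψ →
      tsupport ψ ⊆ V → ∀ j, ∫ z, g z * wderBar n j ψ z = 0) :
    ∃ F : (Fin n → ℂ) → ℂ, DifferentiableOn ℂ F (Metric.ball z r) ∧
      ∀ᵐ w, w ∈ Metric.ball z r → g w = F w := by
  have hsub : ∀ {δ : ℝ} {w : Fin n → ℂ}, δ ≤ r → w ∈ Metric.ball z (3 * r) →
      Metric.closedBall w δ ⊆ V := fun {δ w} hδ hw' v hv => hV <| by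
    have h1 := dist_triangle v w z
    rw [Metric.mem_ball] at hw' ⊢
    rw [Metric.mem_closedBall] at hv
    linarith
  have hball : ∀ {w v : Fin n → ℂ}, w ∈ Metric.ball z r → v ∈ Metric.ball w (2 * r) →
      v ∈ Metric.ball z (3 * r) := fun {w v} h1 h2 => by
    have := dist_triangle v w z
    rw [Metric.mem_ball] at *
    linarith
  obtain ⟨κ, hκ⟩ := exists_isMollifier n hr
  choose κ' hκ' using fun i : ℕ => exists_isMollifier n (δ := 1 / ((i : ℝ) + 1)) (by positivity)
  have hL := l2Tendsto_moll hκ' hg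
  have hdiff : ∀ w ∈ Metric.ball z r, DifferentiableAt ℂ (moll n κ g) w := fun w hw' =>
    hκ.differentiableAt_moll hg hw (hsub le_rfl (by
      rw [Metric.mem_ball] at hw' ⊢
      linarith))
  refine ⟨moll n κ g, fun w hw' => (hdiff w hw').differentiableWithinAt, ?_⟩
  obtain ⟨C, hC⟩ := hκ.norm_moll_le hg
  have hpt : ∀ w ∈ Metric.ball z r,
      Tendsto (fun i => moll n (κ' i) g w) atTop (𝓝 (moll n κ g w)) := by
    intro w hw'
    rw [tendsto_iff_norm_sub_tendsto_zero]
    have h1 : Tendsto (fun i => C * (eLpNorm (fun z => moll n (κ' i) g z - g z) 2).toReal) atTop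
        (𝓝 0) := by
      simpa using ((ENNReal.tendsto_toReal ENNReal.zero_ne_top).comp hL.tendsto).const_mul C
    refine squeeze_zero' (Eventually.of_forall fun _ => norm_nonneg _) ?_ h1
    have h2 : ∀ᶠ i : ℕ in atTop, 1 / ((i : ℝ) + 1) < r :=
      (tendsto_order.1 tendsto_one_div_add_atTop_nhds_zero_nat).2 r hr
    filter_upwards [h2] with i hi
    have h3 := hC _ (hL.memLp i) w
    rwa [hκ.moll_eq_self (δ := 2 * r) (fun v hv => (hκ' i).differentiableAt_moll hg hw
      (hsub hi.le (hball hw' hv))) (by linarith)] at h3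
  obtain ⟨ns, hns, hae⟩ := (tendstoInMeasure_of_tendsto_eLpNorm two_ne_zero
    (fun i => (hL.memLp i).1) hg.1 hL.tendsto).exists_seq_tendsto_ae
  filter_upwards [hae] with w h1 hw'
  exact tendsto_nhds_unique h1 ((hpt w hw').comp hns.tendsto_atTop)

/-- Weyl's lemma for the Cauchy-Riemann system: a locally square-integrable weak solution agrees
almost everywhere with a holomorphic function. -/
theorem exists_holomorphic_ae_eq (hΩ : IsOpen Ω)
    (hf : ∀ z ∈ Ω, ∃ r > 0, MemLp ((Metric.ball z r).indicator f) 2)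
    (hw : ∀ ψ : (Fin n → ℂ) → ℂ, ContDiff ℝ 2 ψ → HasCompactSupport ψ →
      tsupport ψ ⊆ Ω → ∀ j, ∫ z, f z * wderBar n j ψ z = 0) :
    ∃ F : (Fin n → ℂ) → ℂ, DifferentiableOn ℂ F Ω ∧ ∀ᵐ z, z ∈ Ω → f z = F z := by
  have hloc : ∀ z ∈ Ω, ∃ r > 0, ∃ F : (Fin n → ℂ) → ℂ, DifferentiableOn ℂ F (Metric.ball z r) ∧
      ∀ᵐ w, w ∈ Metric.ball z r → f w = F w := by
    intro z hz
    obtain ⟨r, hr, h1⟩ := hf z hz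
    obtain ⟨s, hs, h2⟩ := Metric.isOpen_iff.1 hΩ z hz
    set t := min r s with ht
    have ht0 : 0 < t := lt_min hr hs
    obtain ⟨F, hF, hFe⟩ := exists_holomorphic_ae_eq_ball (V := Metric.ball z t) (z := z) (r := t / 4)
      (by positivity) (by rw [mul_div_cancel₀ t (by norm_num : (4 : ℝ) ≠ 0)]) h1
      (fun ψ hψ hψc hψs j => by
        rw [← hw ψ hψ hψc (hψs.trans ((Metric.ball_subset_ball (min_le_right _ _)).trans h2)) j]
        refine integral_congr_ae (ae_of_all _ fun w => ?_)
        by_cases hwm : w ∈ Metric.ball z r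
        · simp only [indicator_of_mem hwm]
        · have : w ∉ tsupport ψ := fun h => hwm (Metric.ball_subset_ball (min_le_left _ _) (hψs h))
          simp [wderBar_eq_dW, dW_eq_zero_of_notMem _ _ this])
    refine ⟨t / 4, by positivity, F, hF, ?_⟩
    filter_upwards [hFe] with w h3 h4
    rw [← h3 h4, indicator_of_mem]
    exact Metric.ball_subset_ball (by linarith [min_le_left r s]) h4
  choose! r hr F hF hFe using hloc
  have hkey : ∀ z ∈ Ω, ∀ w ∈ Metric.ball z (r z) ∩ Ω, F w w = F z w := by
    rintro z hz w ⟨hw1, hw2⟩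
    have h1 : F w =ᵐ[volume.restrict (Metric.ball z (r z) ∩ Metric.ball w (r w))] F z := by
      rw [Filter.EventuallyEq, ae_restrict_iff' (measurableSet_ball.inter measurableSet_ball)]
      filter_upwards [hFe z hz, hFe w hw2] with v h2 h3 h4
      rw [← h2 h4.1, ← h3 h4.2]
    exact Measure.eqOn_open_of_ae_eq h1 (Metric.isOpen_ball.inter Metric.isOpen_ball)
      ((hF w hw2).continuousOn.mono inter_subset_right)
      ((hF z hz).continuousOn.mono inter_subset_left) ⟨hw1, Metric.mem_ball_self (hr w hw2)⟩
  refine ⟨fun z => F z z, fun z hz => ?_, ?_⟩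
  · have h1 : (fun w => F w w) =ᶠ[𝓝 z] F z := by
      filter_upwards [Metric.ball_mem_nhds z (hr z hz), hΩ.mem_nhds hz] with w h2 h3
      exact hkey z hz w ⟨h2, h3⟩
    exact (((hF z hz).differentiableAt (Metric.ball_mem_nhds z (hr z hz))).congr_of_eventuallyEq
      h1).differentiableWithinAt
  · rw [ae_iff]
    refine measure_null_of_locally_null _ fun z hz => ?_
    simp only [Classical.not_imp, mem_ofPred_eq] at hz
    refine ⟨{w | ¬(w ∈ Ω → f w = F w w)} ∩ Metric.ball z (r z),
      inter_mem_nhdsWithin _ (Metric.ball_mem_nhds z (hr z hz.1)), ?_⟩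
    refine measure_mono_null ?_ (ae_iff.1 (hFe z hz.1))
    rintro w ⟨h1, h2⟩
    simp only [Classical.not_imp, mem_ofPred_eq] at h1 ⊢
    exact ⟨h2, fun h => h1.2 (by rw [h, hkey z hz.1 w ⟨h2, h1.1⟩])⟩

end WeylLemma

section ChainRule

variable {n : ℕ} {σ : (Fin n → ℂ) → ℝ} {z : Fin n → ℂ} {G G1 : ℝ → ℝ} {g : ℝ}

theorem dW_comp_ofReal (c : ℂ) (j : Fin n) (hσ : DifferentiableAt ℝ σ z)
    (hG : HasDerivAt G g (σ z)) :
    dW n c j (fun v => (G (σ v) : ℂ)) z = g * dW n c j (fun v => (σ v : ℂ)) z := by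
  have h1 : HasFDerivAt (fun v => (σ v : ℂ)) (Complex.ofRealCLM.comp (fderiv ℝ σ z)) z :=
    Complex.ofRealCLM.hasFDerivAt.comp z hσ.hasFDerivAt
  have h2 : HasFDerivAt (fun v => (G (σ v) : ℂ)) (Complex.ofRealCLM.comp (g • fderiv ℝ σ z)) z :=
    Complex.ofRealCLM.hasFDerivAt.comp z (hG.comp_hasFDerivAt z hσ.hasFDerivAt)
  simp only [dW, h1.fderiv, h2.fderiv]
  simp only [ContinuousLinearMap.comp_apply, smul_apply, Complex.ofRealCLM_apply, smul_eq_mul,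
    Complex.ofReal_mul]
  ring

theorem wder_comp_ofReal (j : Fin n) (hσ : DifferentiableAt ℝ σ z) (hG : HasDerivAt G g (σ z)) :
    wder n j (fun v => (G (σ v) : ℂ)) z = g * wder n j (fun v => (σ v : ℂ)) z := by
  simp only [wder_eq_dW]
  exact dW_comp_ofReal _ j hσ hG

theorem cHess_comp (hσ : ContDiffAt ℝ 2 σ z) (hG : ∀ᶠ s in 𝓝 (σ z), HasDerivAt G (G1 s) s)
    (hG1 : HasDerivAt G1 g (σ z)) (j k : Fin n) :
    cHess n (fun v => G (σ v)) z j k = G1 (σ z) * cHess n σ z j k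
      + g * (wder n j (fun v => (σ v : ℂ)) z
        * (starRingEnd ℂ) (wder n k (fun v => (σ v : ℂ)) z)) := by
  have hσ' : ContDiffAt ℝ 2 (fun v => (σ v : ℂ)) z := Complex.ofRealCLM.contDiff.contDiffAt.comp z hσ
  have hd : DifferentiableAt ℝ σ z := hσ.differentiableAt (by norm_num)
  have e : wder n j (fun v => (G (σ v) : ℂ)) =ᶠ[𝓝 z]
      fun w => (G1 (σ w) : ℂ) * wder n j (fun v => (σ v : ℂ)) w := by
    filter_upwards [hσ.continuousAt.eventually hG, hσ.eventually (by norm_num)] with w h1 h2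
    exact wder_comp_ofReal j (h2.differentiableAt (by norm_num)) h1
  have d1 : DifferentiableAt ℝ (fun w => (G1 (σ w) : ℂ)) z :=
    (Complex.ofRealCLM.differentiableAt).comp z (hG1.differentiableAt.comp z hd)
  have d2 : DifferentiableAt ℝ (wder n j (fun v => (σ v : ℂ))) z := by
    rw [wder_eq_dW]
    exact (dW_contDiffAt (m' := 1) _ _ hσ' (by norm_num)).differentiableAt (by norm_num)
  rw [cHess, wderBar_eq_dW, dW_congr _ _ e, dW_mul _ _ d1 d2, dW_comp_ofReal _ _ hd hG1,
    ← wderBar_eq_dW, wderBar_ofReal]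
  simp only [cHess, wderBar_eq_dW]
  ring

theorem hermForm_cHess_comp (hσ : ContDiffAt ℝ 2 σ z)
    (hG : ∀ᶠ s in 𝓝 (σ z), HasDerivAt G (G1 s) s) (hG1 : HasDerivAt G1 g (σ z)) (X : Fin n → ℂ) :
    hermForm n (cHess n (fun v => G (σ v)) z) X X = G1 (σ z) * hermForm n (cHess n σ z) X X
      + g * ‖∑ j, wder n j (fun v => (σ v : ℂ)) z * X j‖ ^ 2 := by
  have e : ((‖∑ j, wder n j (fun v => (σ v : ℂ)) z * X j‖ ^ 2 : ℝ) : ℂ)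
      = ∑ j, ∑ k, wder n j (fun v => (σ v : ℂ)) z
        * (starRingEnd ℂ) (wder n k (fun v => (σ v : ℂ)) z) * X j * (starRingEnd ℂ) (X k) := by
    rw [← Complex.normSq_eq_norm_sq, ← Complex.mul_conj, map_sum, Finset.sum_mul_sum]
    refine Finset.sum_congr rfl fun j _ => Finset.sum_congr rfl fun k _ => ?_
    rw [map_mul]
    ring
  rw [← Complex.ofReal_re (‖∑ j, wder n j (fun v => (σ v : ℂ)) z * X j‖ ^ 2), e]
  simp only [hermForm, cHess_comp hσ hG hG1, ← Complex.re_ofReal_mul, ← Complex.add_re,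
    Finset.mul_sum, ← Finset.sum_add_distrib]
  congr 1
  refine Finset.sum_congr rfl fun j _ => Finset.sum_congr rfl fun k _ => ?_
  ring

end ChainRule

section MaxPow

theorem hasDerivAt_max_zero_pow (m : ℕ) (t : ℝ) :
    HasDerivAt (fun t : ℝ => max t 0 ^ (m + 2)) ((m + 2) * max t 0 ^ (m + 1)) t := by
  have hp : ∀ s : ℝ, HasDerivAt (fun t : ℝ => t ^ (m + 2)) ((m + 2) * s ^ (m + 1)) s := fun s => by
    simpa using hasDerivAt_pow (m + 2) s
  rcases lt_trichotomy t 0 with ht | rfl | ht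
  · have h : (fun t : ℝ => max t 0 ^ (m + 2)) =ᶠ[𝓝 t] fun _ => 0 := by
      filter_upwards [gt_mem_nhds ht] with s hs
      simp [max_eq_right hs.le]
    simpa [max_eq_right ht.le] using (hasDerivAt_const t (0 : ℝ)).congr_of_eventuallyEq h
  · have h1 : HasDerivWithinAt (fun t : ℝ => max t 0 ^ (m + 2)) 0 (Ici 0) 0 := by
      have := (hp 0).hasDerivWithinAt (s := Ici 0)
      refine HasDerivWithinAt.congr (by simpa using this) (fun s hs => ?_) (by simp)
      rw [max_eq_left hs]
    have h2 : HasDerivWithinAt (fun t : ℝ => max t 0 ^ (m + 2)) 0 (Iic 0) 0 := by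
      refine (hasDerivWithinAt_const (0 : ℝ) (Iic 0) (0 : ℝ)).congr (fun s hs => ?_) (by simp)
      simp [max_eq_right (show s ≤ 0 from hs)]
    have h3 := h1.union h2
    rw [Ici_union_Iic, hasDerivWithinAt_univ] at h3
    simpa using h3
  · have h : (fun t : ℝ => max t 0 ^ (m + 2)) =ᶠ[𝓝 t] fun t => t ^ (m + 2) := by
      filter_upwards [lt_mem_nhds ht] with s hs
      simp [max_eq_left hs.le]
    simpa [max_eq_left ht.le] using (hp t).congr_of_eventuallyEq h

theorem hasDerivAt_max_sub_pow (m : ℕ) (c t : ℝ) :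
    HasDerivAt (fun t : ℝ => max (t - c) 0 ^ (m + 2)) ((m + 2) * max (t - c) 0 ^ (m + 1)) t := by
  simpa [Function.comp_def] using
    (hasDerivAt_max_zero_pow m (t - c)).comp t ((hasDerivAt_id t).sub_const c)

theorem contDiff_max_sub_pow (m : ℕ) (c : ℝ) :
    ContDiff ℝ 2 (fun t : ℝ => max (t - c) 0 ^ (m + 3)) := by
  have hd : ∀ m : ℕ, deriv (fun t : ℝ => max (t - c) 0 ^ (m + 2))
      = fun t => (m + 2) * max (t - c) 0 ^ (m + 1) :=
    fun m => funext fun t => (hasDerivAt_max_sub_pow m c t).deriv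
  have h1 : ContDiff ℝ 1 (fun t : ℝ => max (t - c) 0 ^ (m + 2)) := by
    rw [contDiff_one_iff_deriv]
    refine ⟨fun t => (hasDerivAt_max_sub_pow m c t).differentiableAt, ?_⟩
    rw [hd]
    fun_prop
  rw [show (2 : WithTop ℕ∞) = 1 + 1 by norm_num, contDiff_succ_iff_deriv]
  refine ⟨fun t => (hasDerivAt_max_sub_pow (m + 1) c t).differentiableAt, by simp, ?_⟩
  rw [hd (m + 1)]
  exact contDiff_const.mul h1

end MaxPow

section RealCutoff

theorem exists_cutoff_real {a b : ℝ} (hab : a < b) : ∃ (θ : ℝ → ℝ) (B : ℝ),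
    ContDiff ℝ (⊤ : ℕ∞) θ ∧ (∀ s, s ≤ a → θ s = 1) ∧ (∀ s, b ≤ s → θ s = 0) ∧
      (∀ s, θ s ∈ Icc (0 : ℝ) 1) ∧ 0 ≤ B ∧ (∀ s, |deriv θ s| ≤ B) ∧
      ∀ s, |deriv (deriv θ) s| ≤ B := by
  let θ : ℝ → ℝ := fun s => Real.smoothTransition ((b - s) / (b - a))
  have hba : 0 < b - a := sub_pos.2 hab
  have hθ : ContDiff ℝ (⊤ : ℕ∞) θ :=
    Real.smoothTransition.contDiff.comp ((contDiff_const.sub contDiff_id).div_const _)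
  have h1 : ∀ s, s ≤ a → θ s = 1 := fun s hs => Real.smoothTransition.one_of_one_le <| by
    rw [le_div_iff₀ hba]
    linarith
  have h0 : ∀ s, b ≤ s → θ s = 0 := fun s hs => Real.smoothTransition.zero_of_nonpos <|
    div_nonpos_of_nonpos_of_nonneg (by linarith) hba.le
  have hd : ContDiff ℝ 1 (deriv θ) :=
    (contDiff_succ_iff_deriv.1 (hθ.of_le (by norm_cast) : ContDiff ℝ (1 + 1) θ)).2.2
  have hc : HasCompactSupport (deriv θ) := HasCompactSupport.intro (K := Icc a b) isCompact_Icc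
    fun s hs => by
      rw [mem_Icc, not_and_or, not_le, not_le] at hs
      rcases hs with hs | hs
      · have h : θ =ᶠ[𝓝 s] fun _ => 1 := by
          filter_upwards [gt_mem_nhds hs] with t ht using h1 t ht.le
        rw [h.deriv_eq, deriv_const]
      · have h : θ =ᶠ[𝓝 s] fun _ => 0 := by
          filter_upwards [lt_mem_nhds hs] with t ht using h0 t ht.le
        rw [h.deriv_eq, deriv_const]
  obtain ⟨B, hB⟩ := hc.exists_bound_of_continuous hd.continuous
  obtain ⟨B', hB'⟩ := hc.deriv.exists_bound_of_continuous (contDiff_one_iff_deriv.1 hd).2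
  exact ⟨θ, max B B', hθ, h1, h0, fun s => ⟨Real.smoothTransition.nonneg _,
    Real.smoothTransition.le_one _⟩, (norm_nonneg _).trans ((hB 0).trans (le_max_left _ _)),
    fun s => (hB s).trans (le_max_left _ _), fun s => (hB' s).trans (le_max_right _ _)⟩

end RealCutoff

section Exhaustion

variable {n : ℕ} {Ω : Set (Fin n → ℂ)} {σ : (Fin n → ℂ) → ℝ}

theorem exists_cutoffWeights {C : ℝ} (hΩ : IsOpen Ω) (hσ : ContDiffOn ℝ 2 σ Ω)
    (hpsh : PSHOnC2 n σ Ω)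
    (hgrad : ∀ z ∈ Ω, ∑ j, ‖wder n j (fun v => (σ v : ℂ)) z‖ ^ 2 ≤ C * Real.exp (2 * σ z))
    (hcomp : ∀ c, ∃ L, IsCompact L ∧ L ⊆ Ω ∧ ∀ z ∈ Ω, σ z ≤ c → z ∈ L)
    {K : Set (Fin n → ℂ)} (hK : IsCompact K) (hKΩ : K ⊆ Ω) :
    ∃ k T, CutoffWeights n Ω K k T := by
  have hσz : ∀ z ∈ Ω, ContDiffAt ℝ 2 σ z := fun z hz => hσ.contDiffAt (hΩ.mem_nhds hz)
  have hσd : ∀ z ∈ Ω, DifferentiableAt ℝ σ z := fun z hz => (hσz z hz).differentiableAt (by norm_num)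
  obtain ⟨c, hc0, hc⟩ : ∃ c : ℝ, 1 ≤ c ∧ ∀ z ∈ K, σ z < c := by
    obtain ⟨b, hb⟩ := hK.bddAbove_image (hσ.continuousOn.mono hKΩ)
    exact ⟨max (b + 1) 1, le_max_right _ _, fun z hz => by
      have := hb (mem_image_of_mem σ hz)
      have := le_max_left (b + 1) 1
      linarith⟩
  have hnear : ∀ᶠ z in 𝓝ˢ K, z ∈ Ω ∧ σ z < c := by
    rw [eventually_nhdsSet_iff_forall]
    intro z hz
    exact Eventually.and (hΩ.mem_nhds (hKΩ hz))
      (((hσz z (hKΩ hz)).continuousAt).eventually (gt_mem_nhds (hc z hz)))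
  have hk1 := fun t => hasDerivAt_max_sub_pow 1 c t
  have hT1 : ∀ t, HasDerivAt (fun t => 3 / 5 * max (t - c) 0 ^ 6)
      (18 / 5 * max (t - c) 0 ^ 5) t := fun t => by
    refine ((hasDerivAt_max_sub_pow 4 c t).const_mul (3 / 5)).congr_deriv ?_
    push_cast
    ring
  have hT2 : ∀ t, HasDerivAt (fun t => 18 / 5 * max (t - c) 0 ^ 5)
      (18 * max (t - c) 0 ^ 4) t := fun t => by
    refine ((hasDerivAt_max_sub_pow 3 c t).const_mul (18 / 5)).congr_deriv ?_
    push_cast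
    ring
  refine ⟨fun z => max (σ z - c) 0 ^ 3, fun z => 3 / 5 * max (σ z - c) 0 ^ 6,
    (contDiff_max_sub_pow 0 c).comp_contDiffOn hσ,
    contDiffOn_const.mul ((contDiff_max_sub_pow 3 c).comp_contDiffOn hσ), ?_, ?_, ?_⟩
  · filter_upwards [hnear] with z hz
    simp [max_eq_right (sub_nonpos.2 hz.2.le)]
  · intro z hz X
    rw [hermForm_cHess_comp (hσz z hz) (Eventually.of_forall hT1) (hT2 _)]
    simp only [wder_comp_ofReal _ (hσd z hz) (hk1 _), mul_assoc, ← Finset.mul_sum]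
    rw [norm_mul, mul_pow, Complex.norm_real, Real.norm_eq_abs, sq_abs]
    have h1 := mul_nonneg (pow_nonneg (le_max_right (σ z - c) 0) 5) (hpsh z hz X)
    push_cast
    linarith
  · intro ε hε
    obtain ⟨θ, B, hθ, hθ1, hθ0, -, hB0, hB, -⟩ := exists_cutoff_real one_lt_two
    have hθd : ∀ s, HasDerivAt θ (deriv θ s) s := fun s =>
      (hθ.differentiable (by simp) s).hasDerivAt
    set C' := max C 0 with hC'
    set D := B ^ 2 * C' * Real.exp (2 * c + 2) with hD
    have hD0 : 0 ≤ D := by positivity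
    set ν := max c (D / ε + 1) with hν
    have hν1 : 1 ≤ ν := hc0.trans (le_max_left _ _)
    have hν0 : 0 < ν := by linarith
    have hνD : D ≤ ε * ν ^ 2 := by
      have h1 : D / ε ≤ ν := (by linarith : D / ε ≤ D / ε + 1).trans (le_max_right _ _)
      rw [div_le_iff₀ hε] at h1
      nlinarith
    obtain ⟨L, hL, hLΩ, hLs⟩ := hcomp (2 * ν)
    let η : (Fin n → ℂ) → ℝ := Ω.indicator fun z => θ (σ z / ν)
    have hηL : ∀ z, z ∉ L → η z = 0 := fun z hz => by
      by_cases hzΩ : z ∈ Ω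
      · have h1 : 2 ≤ σ z / ν := by
          rw [le_div_iff₀ hν0]
          by_contra hc
          exact hz (hLs z hzΩ (not_le.1 hc).le)
        simp [η, hzΩ, hθ0 _ h1]
      · simp [η, hzΩ]
    have hηe : ∀ z ∈ Ω, η =ᶠ[𝓝 z] fun z => θ (σ z / ν) := fun z hz => by
      filter_upwards [hΩ.mem_nhds hz] with w hw
      simp [η, hw]
    have hη0 : ∀ z, z ∉ Ω → η =ᶠ[𝓝 z] fun _ => 0 := fun z hz => by
      filter_upwards [hL.isClosed.isOpen_compl.mem_nhds fun h => hz (hLΩ h)] with w hw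
      exact hηL w hw
    refine ⟨η, ?_, HasCompactSupport.intro hL hηL, ?_, ?_, fun z => ?_⟩
    · rw [contDiff_iff_contDiffAt]
      intro z
      by_cases hz : z ∈ Ω
      · exact ((hθ.of_le (by norm_cast)).contDiffAt.comp z ((hσz z hz).div_const ν)).congr_of_eventuallyEq
          (hηe z hz)
      · exact contDiffAt_const.congr_of_eventuallyEq (hη0 z hz)
    · refine (closure_minimal (fun z hz => ?_) hL.isClosed).trans hLΩ
      by_contra hc
      exact hz (hηL z hc)
    · filter_upwards [hnear] with z hz
      have h1 : σ z / ν ≤ 1 := by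
        rw [div_le_one hν0]
        exact hz.2.le.trans (le_max_left _ _)
      simp [η, hz.1, hθ1 _ h1]
    · by_cases hz : z ∈ Ω
      · have e1 : ∀ j, wder n j (fun v => (η v : ℂ)) z
            = ((deriv θ (σ z / ν) * ν⁻¹ : ℝ) : ℂ) * wder n j (fun v => (σ v : ℂ)) z := fun j => by
          have h1 : (fun v => (η v : ℂ)) =ᶠ[𝓝 z] fun v => (θ (σ v / ν) : ℂ) :=
            (hηe z hz).mono fun v hv => by simp only [hv]
          rw [wder_congr h1]
          refine wder_comp_ofReal (G := fun s => θ (s / ν)) j (hσd z hz) ?_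
          have h2 := (hθd (σ z / ν)).comp (σ z) ((hasDerivAt_id (σ z)).div_const ν)
          simpa [Function.comp_def] using h2
        simp only [e1, norm_mul, mul_pow, ← Finset.mul_sum, Complex.norm_real, Real.norm_eq_abs,
          sq_abs]
        have h3 : deriv θ (σ z / ν) ^ 2 ≤ B ^ 2 := sq_le_sq' (neg_le_of_abs_le (hB _))
          (le_of_abs_le (hB _))
        have h4 : 2 * σ z ≤ 2 * c + 2 + max (σ z - c) 0 ^ 3 := by
          have h5 := le_max_left (σ z - c) 0
          have h6 := le_max_right (σ z - c) 0
          set m := max (σ z - c) 0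
          nlinarith [sq_nonneg (m - 1), mul_nonneg h6 (sq_nonneg (m - 1))]
        have h7 := hgrad z hz
        calc deriv θ (σ z / ν) ^ 2 * ν⁻¹ ^ 2 * ∑ j, ‖wder n j (fun v => (σ v : ℂ)) z‖ ^ 2
            ≤ B ^ 2 * ν⁻¹ ^ 2 * (C' * (Real.exp (2 * c + 2) * Real.exp (max (σ z - c) 0 ^ 3))) := by
              refine mul_le_mul (mul_le_mul_of_nonneg_right h3 (by positivity)) (h7.trans ?_)
                (Finset.sum_nonneg fun _ _ => by positivity) (by positivity)
              rw [← Real.exp_add]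
              exact mul_le_mul (le_max_left _ _) (Real.exp_le_exp.2 h4) (Real.exp_pos _).le
                (le_max_right _ _)
          _ = D / ν ^ 2 * Real.exp (max (σ z - c) 0 ^ 3) := by
              rw [hD]
              field_simp
          _ ≤ ε * Real.exp (max (σ z - c) 0 ^ 3) := by
              refine mul_le_mul_of_nonneg_right ?_ (Real.exp_pos _).le
              rw [div_le_iff₀ (by positivity)]
              exact hνD
      · have h1 : (fun v => (η v : ℂ)) =ᶠ[𝓝 z] fun v => 0 :=
          (hη0 z hz).mono fun v hv => by simp only [hv, Complex.ofReal_zero]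
        simp only [wder_congr h1]
        simp only [wder_eq_dW, dW_const, norm_zero]
        simp only [ne_eq, OfNat.ofNat_ne_zero, not_false_eq_true, zero_pow, Finset.sum_const_zero]
        positivity

end Exhaustion

section LeviForm

variable {n : ℕ}

theorem abs_hermForm_le {H : Fin n → Fin n → ℂ} {B : ℝ} (hB : ∀ j k, ‖H j k‖ ≤ B)
    (X Y : Fin n → ℂ) : |hermForm n H X Y| ≤ (n : ℝ) ^ 2 * B * ‖X‖ * ‖Y‖ := by
  refine (Complex.abs_re_le_norm _).trans ?_
  calc ‖∑ j, ∑ k, H j k * X j * (starRingEnd ℂ) (Y k)‖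
      ≤ ∑ _j : Fin n, ∑ _k : Fin n, B * ‖X‖ * ‖Y‖ := by
        refine norm_sum_le_of_le _ fun j _ => norm_sum_le_of_le _ fun k _ => ?_
        rw [norm_mul, norm_mul, RCLike.norm_conj]
        exact mul_le_mul (mul_le_mul (hB j k) (norm_le_pi_norm X j) (norm_nonneg _)
          ((norm_nonneg _).trans (hB j k))) (norm_le_pi_norm Y k) (norm_nonneg _)
          (mul_nonneg ((norm_nonneg _).trans (hB j k)) (norm_nonneg _))
    _ = (n : ℝ) ^ 2 * B * ‖X‖ * ‖Y‖ := by simp; ring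

theorem hermForm_add_left (H : Fin n → Fin n → ℂ) (X X' Y : Fin n → ℂ) :
    hermForm n H (X + X') Y = hermForm n H X Y + hermForm n H X' Y := by
  simp only [hermForm, Pi.add_apply, mul_add, add_mul, Finset.sum_add_distrib, Complex.add_re]

theorem hermForm_add_right (H : Fin n → Fin n → ℂ) (X Y Y' : Fin n → ℂ) :
    hermForm n H X (Y + Y') = hermForm n H X Y + hermForm n H X Y' := by
  simp only [hermForm, Pi.add_apply, map_add, mul_add, Finset.sum_add_distrib, Complex.add_re]

theorem norm_sum_mul_le {a : Fin n → ℂ} {B : ℝ} (hB : ∀ j, ‖a j‖ ≤ B) (X : Fin n → ℂ) :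
    ‖∑ j, a j * X j‖ ≤ n * B * ‖X‖ := by
  calc ‖∑ j, a j * X j‖ ≤ ∑ _j : Fin n, B * ‖X‖ := by
        refine norm_sum_le_of_le _ fun j _ => ?_
        rw [norm_mul]
        exact mul_le_mul (hB j) (norm_le_pi_norm X j) (norm_nonneg _) ((norm_nonneg _).trans (hB j))
    _ = n * B * ‖X‖ := by simp; ring

/-- A quantitative perturbation of positive semidefiniteness on the kernel of a linear functional. -/
theorem hermForm_lower_bound_of_near {H H' : Fin n → Fin n → ℂ} {a a' : Fin n → ℂ} {j₀ : Fin n}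
    {M L c d : ℝ} (hc : 0 < c) (hL : 0 ≤ L) (hd : 0 ≤ d) (hM : ∀ j k, ‖H' j k‖ ≤ M) (hMa : ∀ j, ‖a' j‖ ≤ M)
    (hH : ∀ j k, ‖H j k - H' j k‖ ≤ L * d) (ha : ∀ j, ‖a' j - a j‖ ≤ L * d)
    (hca : c ≤ ‖a' j₀‖)
    (hpos : ∀ Y : Fin n → ℂ, ∑ j, a' j * Y j = 0 → 0 ≤ hermForm n H' Y Y) (X : Fin n → ℂ) :
    -((n ^ 2 * M * (2 + n * M / c) / c * (1 + n * L) + n ^ 2 * L)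
        * (d * ‖X‖ ^ 2 + ‖∑ j, a j * X j‖ * ‖X‖)) ≤ hermForm n H X X := by
  have hM0 : 0 ≤ M := (norm_nonneg _).trans (hMa j₀)
  set S := ‖∑ j, a j * X j‖ with hS
  have hS0 : 0 ≤ S := norm_nonneg _
  have hx0 : 0 ≤ ‖X‖ := norm_nonneg _
  set x := ‖X‖ with hx
  have hne : a' j₀ ≠ 0 := norm_pos_iff.1 (hc.trans_le hca)
  set t : ℂ := (∑ j, a' j * X j) / a' j₀ with ht
  set W : Fin n → ℂ := Pi.single j₀ t with hW
  have hWn : ‖W‖ = ‖t‖ := by rw [hW, Pi.norm_single]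
  have ht0 := norm_nonneg t
  have htdiv : ‖t‖ ≤ ‖∑ j, a' j * X j‖ / c := by
    rw [ht, norm_div]
    exact div_le_div_of_nonneg_left (norm_nonneg _) hc hca
  have ht1 : ‖t‖ ≤ n * M / c * x := by
    refine htdiv.trans ((div_le_div_of_nonneg_right (norm_sum_mul_le hMa X) hc.le).trans_eq ?_)
    ring
  have ht2 : ‖t‖ ≤ (S + n * (L * d) * x) / c := by
    refine htdiv.trans (div_le_div_of_nonneg_right ?_ hc.le)
    have h1 : ∑ j, a' j * X j = ∑ j, a j * X j + ∑ j, (a' j - a j) * X j := by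
      rw [← Finset.sum_add_distrib]
      exact Finset.sum_congr rfl fun j _ => by ring
    rw [h1]
    exact (norm_add_le _ _).trans (add_le_add le_rfl (norm_sum_mul_le ha X))
  have hker : ∑ j, a' j * (X - W) j = 0 := by
    simp only [Pi.sub_apply, mul_sub, Finset.sum_sub_distrib, hW]
    simp [Pi.single_apply, ht, mul_div_cancel₀ _ hne]
  have hY := hpos _ hker
  have e1 : hermForm n H' X X = hermForm n H' (X - W) (X - W) + hermForm n H' (X - W) W
      + hermForm n H' W X := by
    rw [← hermForm_add_right, sub_add_cancel, ← hermForm_add_left, sub_add_cancel]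
  have e2 : hermForm n H X X = hermForm n H' X X + hermForm n (fun j k => H j k - H' j k) X X := by
    rw [← hermForm_add]
    simp
  have b1 := neg_le_of_abs_le (abs_hermForm_le hM (X - W) W)
  have b2 := neg_le_of_abs_le (abs_hermForm_le hM W X)
  have b3 := neg_le_of_abs_le (abs_hermForm_le hH X X)
  have b4 : ‖X - W‖ ≤ x + ‖t‖ := (norm_sub_le _ _).trans_eq (by rw [hWn])
  rw [hWn] at b1 b2
  have hA : 0 ≤ (n : ℝ) ^ 2 * M := by positivity
  have b5 : (n : ℝ) ^ 2 * M * ‖X - W‖ * ‖t‖ + n ^ 2 * M * ‖t‖ * x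
      ≤ n ^ 2 * M * (2 + n * M / c) * x * ((S + n * (L * d) * x) / c) := by
    calc (n : ℝ) ^ 2 * M * ‖X - W‖ * ‖t‖ + n ^ 2 * M * ‖t‖ * x
        ≤ (n : ℝ) ^ 2 * M * (x + ‖t‖) * ‖t‖ + n ^ 2 * M * ‖t‖ * x := by gcongr
      _ = (n : ℝ) ^ 2 * M * (2 * x + ‖t‖) * ‖t‖ := by ring
      _ ≤ (n : ℝ) ^ 2 * M * (2 * x + n * M / c * x) * ((S + n * (L * d) * x) / c) := by gcongr
      _ = _ := by ring
  have b6 : (n ^ 2 * M * (2 + n * M / c) / c * (1 + n * L) + n ^ 2 * L) * (d * x ^ 2 + S * x)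
      = n ^ 2 * M * (2 + n * M / c) * x * ((S + n * (L * d) * x) / c) + n ^ 2 * (L * d) * x * x
        + (n ^ 2 * M * (2 + n * M / c) / c * (d * x ^ 2 + n * L * (S * x)) + n ^ 2 * L * (S * x)) := by
    field_simp
    ring
  have b7 : 0 ≤ (n ^ 2 * M * (2 + n * M / c) / c * (d * x ^ 2 + n * L * (S * x))
      + n ^ 2 * L * (S * x)) := by positivity
  rw [b6]
  linarith

variable {Ω : Set (Fin n → ℂ)} {ρ : (Fin n → ℂ) → ℝ} {q z : Fin n → ℂ}

theorem fderiv_ofReal_comp (hρ : DifferentiableAt ℝ ρ z) (x : Fin n → ℂ) :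
    fderiv ℝ (fun v => (ρ v : ℂ)) z x = (fderiv ℝ ρ z x : ℂ) := by
  have h := (Complex.ofRealCLM.hasFDerivAt (x := ρ z)).comp z hρ.hasFDerivAt
  have h' : HasFDerivAt (fun v => (ρ v : ℂ)) (Complex.ofRealCLM.comp (fderiv ℝ ρ z)) z := h
  rw [h'.fderiv]
  simp

theorem exists_wder_ne_zero (hρ : DifferentiableAt ℝ ρ z) (h : fderiv ℝ ρ z ≠ 0) :
    ∃ j, wder n j (fun v => (ρ v : ℂ)) z ≠ 0 := by
  by_contra! hc
  apply h
  have h1 : ∀ j, fderiv ℝ ρ z (Pi.single j 1) = 0 ∧ fderiv ℝ ρ z (Pi.single j Complex.I) = 0 := by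
    intro j
    have h2 := hc j
    rw [wder, fderiv_ofReal_comp hρ, fderiv_ofReal_comp hρ] at h2
    have h3 := congrArg Complex.re h2
    have h4 := congrArg Complex.im h2
    simp at h3 h4
    exact ⟨h3, h4⟩
  ext x
  have h5 : x = ∑ j, ((x j).re • (Pi.single j 1 : Fin n → ℂ)
      + (x j).im • (Pi.single j Complex.I : Fin n → ℂ)) := by
    ext k
    simp [Finset.sum_apply, Pi.single_apply, Finset.sum_add_distrib]
  rw [h5]
  simp [h1]

/-- Points of `Ω` close to a regular boundary point are at distance `O(|ρ|)` from the boundary. -/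
theorem exists_frontier_near (hΩ : IsOpen Ω) (hρ : ContDiff ℝ 1 ρ) (hneg : ∀ z ∈ Ω, ρ z < 0)
    (hq : ρ q = 0) (hd : fderiv ℝ ρ q ≠ 0) {U : Set (Fin n → ℂ)} (hU : U ∈ 𝓝 q) :
    ∃ C, 0 ≤ C ∧ ∀ᶠ z in 𝓝 q, z ∈ Ω → ∃ y ∈ U ∩ frontier Ω, ‖z - y‖ ≤ C * |ρ z| := by
  obtain ⟨v, hv⟩ : ∃ v, 1 < fderiv ℝ ρ q v := by
    obtain ⟨w, hw⟩ : ∃ w, fderiv ℝ ρ q w ≠ 0 := by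
      by_contra! hc
      exact hd (by ext x; exact hc x)
    refine ⟨(2 / fderiv ℝ ρ q w) • w, ?_⟩
    rw [map_smul, smul_eq_mul, div_mul_cancel₀ _ hw]
    norm_num
  have hcont : Continuous fun y => fderiv ℝ ρ y v :=
    (hρ.continuous_fderiv (by norm_num)).clm_apply continuous_const
  obtain ⟨r, hr, hball⟩ := Metric.mem_nhds_iff.1
    (Filter.inter_mem hU (hcont.continuousAt.eventually (lt_mem_nhds hv)))
  have hsmall : ∀ᶠ z in 𝓝 q, dist z q + |ρ z| * ‖v‖ < r := by
    have hc : Continuous fun z => dist z q + |ρ z| * ‖v‖ := by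
      have := hρ.continuous
      fun_prop
    refine hc.continuousAt.eventually (gt_mem_nhds ?_)
    simpa [hq] using hr
  refine ⟨‖v‖, norm_nonneg _, ?_⟩
  filter_upwards [hsmall] with z hz hzΩ
  have hρz := hneg z hzΩ
  have hT : 0 < |ρ z| := abs_pos.2 hρz.ne
  have hseg : ∀ t ∈ Icc 0 |ρ z|, z + t • v ∈ Metric.ball q r := fun t ht => by
    rw [Metric.mem_ball]
    calc dist (z + t • v) q ≤ dist (z + t • v) z + dist z q := dist_triangle _ _ _
      _ ≤ |ρ z| * ‖v‖ + dist z q := by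
        rw [dist_eq_norm, add_sub_cancel_left, norm_smul, Real.norm_of_nonneg ht.1]
        gcongr
        exact ht.2
      _ < r := by linarith
  have hline : ∀ t : ℝ, HasDerivAt (fun t : ℝ => z + t • v) v t := fun t => by
    simpa using ((hasDerivAt_id t).smul_const v).const_add z
  have hg : ∀ t : ℝ, HasDerivAt (fun t : ℝ => ρ (z + t • v)) (fderiv ℝ ρ (z + t • v) v) t :=
    fun t => ((hρ.differentiable (by norm_num)) _).hasFDerivAt.comp_hasDerivAt t (hline t)
  have hmv : 1 * (|ρ z| - 0) ≤ ρ (z + |ρ z| • v) - ρ (z + (0 : ℝ) • v) := by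
    refine (convex_Icc (0 : ℝ) |ρ z|).mul_sub_le_image_sub_of_le_deriv
      (f := fun t : ℝ => ρ (z + t • v)) (fun t _ => (hg t).continuousAt.continuousWithinAt)
      (fun t _ => (hg t).differentiableAt.differentiableWithinAt) (fun t ht => ?_)
      0 ⟨le_rfl, hT.le⟩ |ρ z| ⟨hT.le, le_rfl⟩ hT.le
    rw [(hg t).deriv]
    exact (hball (hseg t (interior_subset ht))).2.le
  have hout : z + |ρ z| • v ∉ Ω := fun hc => by
    have h1 := hneg _ hc
    rw [zero_smul, add_zero, abs_of_neg hρz] at hmv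
    rw [abs_of_neg hρz] at h1
    linarith
  have hpre : IsPreconnected ((fun t : ℝ => z + t • v) '' Icc 0 |ρ z|) :=
    isPreconnected_Icc.image _ (by fun_prop)
  obtain ⟨t, ht, hy⟩ : ∃ t ∈ Icc 0 |ρ z|, z + t • v ∈ frontier Ω := by
    by_contra! hc
    suffices h : (fun t : ℝ => z + t • v) '' Icc 0 |ρ z| ⊆ Ω from
      hout (h ⟨|ρ z|, ⟨hT.le, le_rfl⟩, rfl⟩)
    refine hpre.subset_left_of_subset_union hΩ isClosed_closure.isOpen_compl
      (disjoint_compl_right.mono_left subset_closure) ?_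
      ⟨z, ⟨0, ⟨le_rfl, hT.le⟩, by simp⟩, hzΩ⟩
    rintro _ ⟨t, ht, rfl⟩
    by_cases h : z + t • v ∈ closure Ω
    · left
      by_contra h'
      exact hc t ht (mem_sdiff _ |>.2 ⟨h, fun h'' => h' (interior_subset h'')⟩)
    · exact Or.inr h
  refine ⟨_, ⟨(hball (hseg t ht)).1, hy⟩, ?_⟩
  rw [sub_add_cancel_left, norm_neg, norm_smul, Real.norm_of_nonneg ht.1, mul_comm]
  exact mul_le_mul_of_nonneg_left ht.2 (norm_nonneg _)

theorem exists_local_levi_bound (hΩ : IsOpen Ω) (hρ : IsDefining n Ω ρ)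
    (hlevi : ∀ q ∈ frontier Ω, LeviPSDAt n ρ q) (hq : q ∈ closure Ω) :
    ∃ C, 0 ≤ C ∧ ∀ᶠ z in 𝓝 q, z ∈ Ω → ∀ X : Fin n → ℂ,
      -(C * (|ρ z| * ‖X‖ ^ 2 + ‖∑ j, wder n j (fun v => (ρ v : ℂ)) z * X j‖ * ‖X‖))
        ≤ hermForm n (cHess n ρ z) X X := by
  obtain ⟨hsm, hneg, hzero, hreg⟩ := hρ
  have hρ3 : ContDiff ℝ 3 ρ := hsm.of_le (by norm_cast)
  have ha2 : ∀ j, ContDiff ℝ 2 (wder n j (fun v => (ρ v : ℂ))) := fun j => by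
    rw [wder_eq_dW]
    exact dW_contDiff _ _ (contDiff_ofReal_comp hρ3) (by norm_num)
  have hH1 : ∀ j k, ContDiff ℝ 1 (fun z => cHess n ρ z j k) := fun j k => by
    simp only [cHess, wderBar_eq_dW]
    exact dW_contDiff _ _ (ha2 j) (by norm_num)
  set B : (Fin n → ℂ) → ℝ := fun z => ∑ j, ‖wder n j (fun v => (ρ v : ℂ)) z‖
    + ∑ j, ∑ k, ‖cHess n ρ z j k‖ with hB
  have hBc : Continuous B := by
    refine (continuous_finsetSum _ fun j _ => (ha2 j).continuous.norm).add
      (continuous_finsetSum _ fun j _ => continuous_finsetSum _ fun k _ =>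
        (hH1 j k).continuous.norm)
  have hBH : ∀ z j k, ‖cHess n ρ z j k‖ ≤ B z := fun z j k =>
    ((Finset.single_le_sum (f := fun k => ‖cHess n ρ z j k‖) (fun _ _ => norm_nonneg _)
      (Finset.mem_univ k)).trans (Finset.single_le_sum (f := fun j => ∑ k, ‖cHess n ρ z j k‖)
        (fun _ _ => Finset.sum_nonneg fun _ _ => norm_nonneg _) (Finset.mem_univ j))).trans
      (le_add_of_nonneg_left (Finset.sum_nonneg fun _ _ => norm_nonneg _))
  have hBa : ∀ z j, ‖wder n j (fun v => (ρ v : ℂ)) z‖ ≤ B z := fun z j =>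
    (Finset.single_le_sum (f := fun j => ‖wder n j (fun v => (ρ v : ℂ)) z‖)
      (fun _ _ => norm_nonneg _) (Finset.mem_univ j)).trans (le_add_of_nonneg_right
        (Finset.sum_nonneg fun _ _ => Finset.sum_nonneg fun _ _ => norm_nonneg _))
  have hBev : ∀ᶠ z in 𝓝 q, B z ≤ B q + 1 :=
    hBc.continuousAt.eventually (eventually_le_nhds (by linarith))
  have hB0 : 0 ≤ B q + 1 := by positivity
  by_cases hqΩ : q ∈ Ω
  · have hρq := hneg q hqΩ
    refine ⟨n ^ 2 * (B q + 1) / (|ρ q| / 2), by positivity, ?_⟩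
    have h1 : ∀ᶠ z in 𝓝 q, |ρ q| / 2 ≤ |ρ z| :=
      hρ3.continuous.abs.continuousAt.eventually
        (eventually_ge_nhds (half_lt_self (abs_pos.2 hρq.ne)))
    filter_upwards [hBev, h1] with z hz hz1 _ X
    have h2 := neg_le_of_abs_le (abs_hermForm_le (fun j k => (hBH z j k).trans hz) X X)
    refine le_trans (neg_le_neg ?_) h2
    have h3 : 0 < |ρ q| / 2 := half_pos (abs_pos.2 hρq.ne)
    calc n ^ 2 * (B q + 1) * ‖X‖ * ‖X‖
        = n ^ 2 * (B q + 1) / (|ρ q| / 2) * ((|ρ q| / 2) * ‖X‖ ^ 2) := by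
          have h4 : |ρ q| ≠ 0 := (abs_pos.2 hρq.ne).ne'
          field_simp
      _ ≤ _ := by
          gcongr
          exact le_add_of_le_of_nonneg (by gcongr) (by positivity)
  · have hqf : q ∈ frontier Ω := ⟨hq, by rwa [hΩ.interior_eq]⟩
    have hρd : Differentiable ℝ ρ := hρ3.differentiable (by norm_num)
    obtain ⟨j₀, hj₀⟩ := exists_wder_ne_zero (hρd q) (hreg q hqf)
    choose Ka sa hsa hLa using fun j => (ha2 j).contDiffAt (x := q).of_le
      (m := 1) (by norm_num) |>.exists_lipschitzOnWith
    choose Kh sh hsh hLh using fun j k => (hH1 j k).contDiffAt (x := q).exists_lipschitzOnWith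
    set L : ℝ := ∑ j, (Ka j : ℝ) + ∑ j, ∑ k, (Kh j k : ℝ) with hL
    have hL0 : 0 ≤ L := by positivity
    have hc : 0 < ‖wder n j₀ (fun v => (ρ v : ℂ)) q‖ / 2 := half_pos (norm_pos_iff.2 hj₀)
    have hcev : ∀ᶠ z in 𝓝 q, ‖wder n j₀ (fun v => (ρ v : ℂ)) q‖ / 2
        ≤ ‖wder n j₀ (fun v => (ρ v : ℂ)) z‖ :=
      (ha2 j₀).continuous.norm.continuousAt.eventually
        (eventually_ge_nhds (half_lt_self (norm_pos_iff.2 hj₀)))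
    have hU : ∀ᶠ z in 𝓝 q, B z ≤ B q + 1 ∧ ‖wder n j₀ (fun v => (ρ v : ℂ)) q‖ / 2
        ≤ ‖wder n j₀ (fun v => (ρ v : ℂ)) z‖ ∧ (∀ j, z ∈ sa j) ∧ ∀ j k, z ∈ sh j k :=
      hBev.and (hcev.and ((eventually_all.2 hsa).and
        (eventually_all.2 fun j => eventually_all.2 (hsh j))))
    obtain ⟨c, hcdef⟩ : ∃ c, c = ‖wder n j₀ (fun v => (ρ v : ℂ)) q‖ / 2 := ⟨_, rfl⟩
    rw [← hcdef] at hU hc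
    obtain ⟨C, hC⟩ : ∃ C : ℝ, C = n ^ 2 * (B q + 1) * (2 + n * (B q + 1) / c) / c * (1 + n * L) + n ^ 2 * L :=
      ⟨_, rfl⟩
    have hC0 : 0 ≤ C := by rw [hC]; positivity
    obtain ⟨D, hD0, hD⟩ := exists_frontier_near hΩ (hρ3.of_le (by norm_num)) hneg
      (hzero q hqf) (hreg q hqf) hU
    refine ⟨C * (D + 1), by positivity, ?_⟩
    · filter_upwards [hU, hD] with z hz hzD hzΩ X
      obtain ⟨y, ⟨hyU, hyf⟩, hzy⟩ := hzD hzΩ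
      have h0 : 0 ≤ D * |ρ z| := by positivity
      have hKa : ∀ j, (Ka j : ℝ) ≤ L := fun j =>
        (Finset.single_le_sum (f := fun j => (Ka j : ℝ)) (fun _ _ => by positivity)
          (Finset.mem_univ j)).trans (le_add_of_nonneg_right (by positivity))
      have hKh : ∀ j k, (Kh j k : ℝ) ≤ L := fun j k =>
        ((Finset.single_le_sum (f := fun k => (Kh j k : ℝ)) (fun _ _ => by positivity)
          (Finset.mem_univ k)).trans (Finset.single_le_sum (f := fun j => ∑ k, (Kh j k : ℝ))
            (fun _ _ => by positivity) (Finset.mem_univ j))).trans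
          (le_add_of_nonneg_left (by positivity))
      have key := hermForm_lower_bound_of_near (H := cHess n ρ z) (H' := cHess n ρ y)
        (a := fun j => wder n j (fun v => (ρ v : ℂ)) z)
        (a' := fun j => wder n j (fun v => (ρ v : ℂ)) y) (j₀ := j₀) (M := B q + 1) (L := L)
        (d := D * |ρ z|) hc hL0 h0 (fun j k => (hBH y j k).trans hyU.1)
        (fun j => (hBa y j).trans hyU.1)
        (fun j k => ((hLh j k).norm_sub_le (hz.2.2.2 j k) (hyU.2.2.2 j k)).trans
          (mul_le_mul (hKh j k) hzy (norm_nonneg _) hL0))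
        (fun j => (norm_sub_rev _ _).trans_le
          (((hLa j).norm_sub_le (hz.2.2.1 j) (hyU.2.2.1 j)).trans
            (mul_le_mul (hKa j) hzy (norm_nonneg _) hL0)))
        hyU.2.1 (fun Y hY => hlevi y hyf Y (by
          simpa [cTangent, cTangentMap, dzCoef] using hY)) X
      rw [← hC] at key
      refine le_trans (neg_le_neg ?_) key
      rw [mul_assoc C (D + 1)]
      refine mul_le_mul_of_nonneg_left ?_ hC0
      have h1 : 0 ≤ |ρ z| * ‖X‖ ^ 2 := by positivity
      have h2 : 0 ≤ ‖∑ j, wder n j (fun v => (ρ v : ℂ)) z * X j‖ * ‖X‖ := by positivity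
      nlinarith [mul_nonneg hD0 h2]

end LeviForm

section WeightedSquares

variable {n : ℕ} (w : Fin n → ℝ) (p z : Fin n → ℂ)

theorem dW_coord_sub (c : ℂ) (j k : Fin n) (a : ℂ) :
    dW n c j (fun v => v k - a) z = if k = j then (1 / 2) * (1 + c * Complex.I) else 0 := by
  have h : HasFDerivAt (𝕜 := ℝ) (fun v : Fin n → ℂ => v k - a)
      (ContinuousLinearMap.proj k : (Fin n → ℂ) →L[ℝ] ℂ) z :=
    ((ContinuousLinearMap.proj k : (Fin n → ℂ) →L[ℝ] ℂ).hasFDerivAt).sub_const a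
  rw [dW, h.fderiv]
  simp only [ContinuousLinearMap.proj_apply, Pi.single_apply]
  split_ifs <;> simp

theorem contDiff_weightedSq {m : WithTop ℕ∞} :
    ContDiff ℝ m fun v : Fin n → ℂ => ∑ k, w k * ‖v k - p k‖ ^ 2 := by
  refine ContDiff.sum fun k _ => contDiff_const.mul ?_
  exact ((contDiff_apply ℝ ℂ k).sub contDiff_const).norm_sq ℝ

theorem wder_weightedSq (j : Fin n) :
    wder n j (fun v => ((∑ k, w k * ‖v k - p k‖ ^ 2 : ℝ) : ℂ)) z
      = w j * (starRingEnd ℂ) (z j - p j) := by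
  have e : (fun v : Fin n → ℂ => ((∑ k, w k * ‖v k - p k‖ ^ 2 : ℝ) : ℂ))
      = fun v => ∑ k, (w k : ℂ) * ((v k - p k) * (starRingEnd ℂ) (v k - p k)) := by
    funext v
    push_cast
    refine Finset.sum_congr rfl fun k _ => ?_
    rw [Complex.mul_conj, Complex.normSq_eq_norm_sq]
    push_cast
    rfl
  have hd : ∀ k, DifferentiableAt ℝ (fun v : Fin n → ℂ => v k - p k) z := fun k => by fun_prop
  have hd' : ∀ k, DifferentiableAt ℝ (fun v : Fin n → ℂ => (starRingEnd ℂ) (v k - p k)) z :=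
    fun k => (Complex.conjCLE : ℂ ≃L[ℝ] ℂ).differentiableAt.comp z (hd k)
  rw [e, wder_eq_dW, dW_sum _ _ _ fun k _ => ((hd k).fun_mul (hd' k)).const_mul _]
  have h : ∀ k, dW n (-Complex.I) j
      (fun v => (w k : ℂ) * ((v k - p k) * (starRingEnd ℂ) (v k - p k))) z
      = if k = j then (w j : ℂ) * (starRingEnd ℂ) (z j - p j) else 0 := fun k => by
    rw [dW_mul _ _ (differentiableAt_const _) ((hd k).fun_mul (hd' k)), dW_const,
      dW_mul _ _ (hd k) (hd' k), dW_conj, dW_coord_sub, dW_coord_sub]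
    split_ifs with hk
    · subst hk
      simp
      left
      ring
    · simp
  simp only [h, Finset.sum_ite_eq', Finset.mem_univ, if_true]

theorem cHess_weightedSq (j k : Fin n) :
    cHess n (fun v => ∑ k, w k * ‖v k - p k‖ ^ 2) z j k = if j = k then (w j : ℂ) else 0 := by
  have e : wder n j (fun v => ((∑ k, w k * ‖v k - p k‖ ^ 2 : ℝ) : ℂ))
      = fun v => (w j : ℂ) * (starRingEnd ℂ) (v j - p j) := funext fun v => wder_weightedSq w p v j
  have hd' : DifferentiableAt ℝ (fun v : Fin n → ℂ => (starRingEnd ℂ) (v j - p j)) z :=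
    (Complex.conjCLE : ℂ ≃L[ℝ] ℂ).differentiableAt.comp z (by fun_prop)
  rw [cHess, e, wderBar_eq_dW, dW_mul _ _ (differentiableAt_const _) hd', dW_const, dW_conj,
    dW_coord_sub]
  split_ifs with h
  · have h2 : (starRingEnd ℂ) 2 = 2 := Complex.conj_ofReal 2
    simp [h2]
    norm_num
  · simp

theorem hermForm_cHess_weightedSq (X : Fin n → ℂ) :
    hermForm n (cHess n (fun v => ∑ k, w k * ‖v k - p k‖ ^ 2) z) X X
      = ∑ j, w j * ‖X j‖ ^ 2 := by
  have h : ∀ j k, cHess n (fun v => ∑ k, w k * ‖v k - p k‖ ^ 2) z j k * X j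
      * (starRingEnd ℂ) (X k) = if j = k then ((w j * ‖X j‖ ^ 2 : ℝ) : ℂ) else 0 := fun j k => by
    rw [cHess_weightedSq]
    split_ifs with hjk
    · subst hjk
      rw [mul_assoc, Complex.mul_conj, Complex.normSq_eq_norm_sq]
      push_cast
      rfl
    · simp
  simp only [hermForm, h, Finset.sum_ite_eq, Finset.mem_univ, if_true]
  rw [← Complex.ofReal_sum, Complex.ofReal_re]

theorem norm_sq_le_sum_norm_sq (X : Fin n → ℂ) : ‖X‖ ^ 2 ≤ ∑ j, ‖X j‖ ^ 2 := by
  refine Real.le_sqrt (norm_nonneg _) (by positivity) |>.1 ?_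
  refine (pi_norm_le_iff_of_nonneg (Real.sqrt_nonneg _)).2 fun j => Real.le_sqrt_of_sq_le ?_
  exact Finset.single_le_sum (f := fun j => ‖X j‖ ^ 2) (fun _ _ => by positivity)
    (Finset.mem_univ j)

end WeightedSquares

section Pseudoconvex

variable {n : ℕ} {Ω K : Set (Fin n → ℂ)} {ρ : (Fin n → ℂ) → ℝ}

theorem exists_levi_bound (hΩ : IsOpen Ω) (hb : Bornology.IsBounded Ω) (hρ : IsDefining n Ω ρ)
    (hlevi : ∀ q ∈ frontier Ω, LeviPSDAt n ρ q) :
    ∃ C, 0 ≤ C ∧ ∀ z ∈ Ω, ∀ X : Fin n → ℂ,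
      -(C * (|ρ z| * ‖X‖ ^ 2 + ‖∑ j, wder n j (fun v => (ρ v : ℂ)) z * X j‖ * ‖X‖))
        ≤ hermForm n (cHess n ρ z) X X := by
  have hK : IsCompact (closure Ω) := hb.isCompact_closure
  have h := fun q (hq : q ∈ closure Ω) => exists_local_levi_bound hΩ hρ hlevi hq
  choose! C hC0 hC using h
  obtain ⟨t, ht, hcov⟩ := hK.elim_nhds_subcover _ hC
  refine ⟨∑ q ∈ t, C q, Finset.sum_nonneg fun q hq => hC0 q (ht q hq), fun z hz X => ?_⟩
  obtain ⟨q, hq, hzq⟩ := mem_iUnion₂.1 (hcov (subset_closure hz))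
  refine le_trans (neg_le_neg ?_) (hzq hz X)
  exact mul_le_mul_of_nonneg_right (Finset.single_le_sum (fun q hq => hC0 q (ht q hq)) hq)
    (by positivity)

/-- A bounded smoothly bounded Levi pseudoconvex domain carries enough cut-off weights. -/
theorem exists_cutoffWeights_of_levi (hΩ : IsOpen Ω) (hb : Bornology.IsBounded Ω)
    (hρ : IsDefining n Ω ρ) (hlevi : ∀ q ∈ frontier Ω, LeviPSDAt n ρ q) (hK : IsCompact K)
    (hKΩ : K ⊆ Ω) : ∃ k T, CutoffWeights n Ω K k T := by
  obtain ⟨C, hC0, hC⟩ := exists_levi_bound hΩ hb hρ hlevi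
  obtain ⟨hsm, hneg, hzero, -⟩ := hρ
  have hρ2 : ContDiff ℝ 2 ρ := hsm.of_le (by norm_cast)
  have hcl : IsCompact (closure Ω) := hb.isCompact_closure
  set A : ℝ := C + C ^ 2 / 4 with hA
  have hA0 : 0 ≤ A := by positivity
  set Q : (Fin n → ℂ) → ℝ := fun z => ∑ k, A * ‖z k - (0 : Fin n → ℂ) k‖ ^ 2 with hQ
  have hQ2 : ContDiff ℝ 2 Q := contDiff_weightedSq (fun _ => A) 0
  have hQ0 : ∀ z, 0 ≤ Q z := fun z => Finset.sum_nonneg fun _ _ => by positivity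
  set G : ℝ → ℝ := fun s => -Real.log (-s) with hG
  have hGd : ∀ s, s < 0 → HasDerivAt G (-s⁻¹) s := fun s hs => by
    have h := ((hasDerivAt_neg s).log (by linarith)).fun_neg
    have e : -s⁻¹ = -(-1 / -s) := by rw [neg_div_neg_eq, one_div]
    rw [e]
    exact h
  have hGd2 : ∀ s, s < 0 → HasDerivAt (fun s : ℝ => -s⁻¹) (s ^ 2)⁻¹ s := fun s hs => by
    simpa using (hasDerivAt_inv hs.ne).fun_neg
  have hGc : ∀ z ∈ Ω, ContDiffAt ℝ 2 (fun v => G (ρ v)) z := fun z hz =>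
    (hρ2.contDiffAt.neg.log (by have := hneg z hz; linarith)).neg
  have hw : ∀ z ∈ Ω, ∀ j, wder n j (fun v => ((G (ρ v) + Q v : ℝ) : ℂ)) z
      = ((-(ρ z)⁻¹ : ℝ) : ℂ) * wder n j (fun v => (ρ v : ℂ)) z + A * (starRingEnd ℂ) (z j) := by
    intro z hz j
    rw [wder_add_ofReal ((hGc z hz).of_le (by norm_num)) (hQ2.contDiffAt.of_le (by norm_num)),
      wder_comp_ofReal j (hρ2.differentiable (by norm_num) z) (hGd _ (hneg z hz)), hQ,
      wder_weightedSq]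
    simp
  have hexp : ∀ z ∈ Ω, (ρ z ^ 2)⁻¹ ≤ Real.exp (2 * (G (ρ z) + Q z)) := fun z hz => by
    have h1 := hneg z hz
    calc (ρ z ^ 2)⁻¹ = Real.exp (2 * G (ρ z)) := by
          rw [hG, mul_neg, Real.exp_neg, mul_comm, Real.exp_mul, Real.exp_log (by linarith)]
          norm_num
      _ ≤ _ := Real.exp_le_exp.2 (by linarith [hQ0 z])
  obtain ⟨D, hD⟩ := hcl.exists_bound_of_continuousOn
    (f := fun z => ∑ j, ‖wder n j (fun v => (ρ v : ℂ)) z‖ ^ 2 + A ^ 2 * (∑ j, ‖z j‖ ^ 2) * ρ z ^ 2)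
    (by
      have h1 : ∀ j, Continuous (wder n j (fun v => (ρ v : ℂ))) := fun j =>
        wder_continuous j (contDiff_ofReal_comp (hρ2.of_le (by norm_num)))
      have h2 := hρ2.continuous
      exact Continuous.continuousOn (by fun_prop))
  refine exists_cutoffWeights (σ := fun z => G (ρ z) + Q z) (C := 2 * D) hΩ
    (fun z hz => ((hGc z hz).add hQ2.contDiffAt).contDiffWithinAt) (fun z hz X => ?_)
    (fun z hz => ?_) (fun c => ?_) hK hKΩ
  · have e : cHess n (fun z => G (ρ z) + Q z) z
        = fun j l => cHess n (fun v => G (ρ v)) z j l + cHess n Q z j l := by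
      funext j l
      exact cHess_add (hGc z hz) hQ2.contDiffAt j l
    have h1 := hneg z hz
    rw [e, hermForm_add, hermForm_cHess_comp hρ2.contDiffAt
      ((eventually_lt_nhds h1).mono fun s hs => hGd s hs) (hGd2 _ h1), hQ,
      hermForm_cHess_weightedSq, ← Finset.mul_sum]
    have h2 := hC z hz X
    have h3 := norm_sq_le_sum_norm_sq X
    set l := ‖∑ j, wder n j (fun v => (ρ v : ℂ)) z * X j‖
    set x := ‖X‖
    set H := hermForm n (cHess n ρ z) X X
    obtain ⟨r, hr⟩ : ∃ r, r = -(ρ z) := ⟨_, rfl⟩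
    have hr0 : 0 < r := by linarith
    have h4 : |ρ z| = r := by rw [abs_of_neg h1, hr]
    have h5 : ρ z = -r := by linarith
    rw [h4] at h2
    rw [h5]
    have h6 : r⁻¹ * -(C * (r * x ^ 2 + l * x)) ≤ r⁻¹ * H :=
      mul_le_mul_of_nonneg_left h2 (by positivity)
    have h7 : r⁻¹ * -(C * (r * x ^ 2 + l * x)) = -(C * x ^ 2) - C * x * (r⁻¹ * l) := by
      field_simp
      ring
    have h8 : A * x ^ 2 ≤ A * ∑ i, ‖X i‖ ^ 2 := mul_le_mul_of_nonneg_left h3 hA0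
    have h9 : ((-r) ^ 2)⁻¹ * l ^ 2 = (r⁻¹ * l) ^ 2 := by field_simp
    rw [h9, inv_neg, neg_neg]
    nlinarith [sq_nonneg (r⁻¹ * l - C * x / 2)]
  · have h1 := hneg z hz
    simp only [hw z hz]
    calc ∑ j, ‖((-(ρ z)⁻¹ : ℝ) : ℂ) * wder n j (fun v => (ρ v : ℂ)) z
          + A * (starRingEnd ℂ) (z j)‖ ^ 2
        ≤ ∑ j, (2 * ‖((-(ρ z)⁻¹ : ℝ) : ℂ) * wder n j (fun v => (ρ v : ℂ)) z‖ ^ 2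
          + 2 * ‖A * (starRingEnd ℂ) (z j)‖ ^ 2) :=
          Finset.sum_le_sum fun j _ => norm_add_sq_le_two_mul _ _
      _ = 2 * (∑ j, ‖wder n j (fun v => (ρ v : ℂ)) z‖ ^ 2 + A ^ 2 * (∑ j, ‖z j‖ ^ 2) * ρ z ^ 2)
          * (ρ z ^ 2)⁻¹ := by
          simp only [norm_mul, Complex.norm_real, Real.norm_eq_abs, RCLike.norm_conj, mul_pow,
            sq_abs, Finset.sum_add_distrib, ← Finset.mul_sum]
          have : ρ z ≠ 0 := h1.ne
          field_simp
          try ring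
      _ ≤ 2 * D * Real.exp (2 * (G (ρ z) + Q z)) := by
          have h3 := (le_abs_self _).trans (hD z (subset_closure hz))
          have h4 : 0 ≤ ∑ j, ‖wder n j (fun v => (ρ v : ℂ)) z‖ ^ 2
            + A ^ 2 * (∑ j, ‖z j‖ ^ 2) * ρ z ^ 2 := by positivity
          exact mul_le_mul (mul_le_mul_of_nonneg_left h3 (by norm_num)) (hexp z hz)
            (by positivity) (by linarith)
  · refine ⟨closure Ω ∩ {z | ρ z ≤ -Real.exp (-c)},
      hcl.inter_right (isClosed_le hρ2.continuous continuous_const), fun z hz => ?_,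
      fun z hz hzc => ⟨subset_closure hz, ?_⟩⟩
    · by_contra h
      have h1 := hzero z (mem_sdiff _ |>.2 ⟨hz.1, fun h' => h (interior_subset h')⟩)
      have h2 : ρ z ≤ -Real.exp (-c) := hz.2
      linarith [Real.exp_pos (-c)]
    · have h1 := hneg z hz
      have h2 : -Real.log (-ρ z) ≤ c := by
        have := hQ0 z
        have h3 : G (ρ z) + Q z ≤ c := hzc
        simp only [hG] at h3
        linarith
      have h3 : Real.exp (-c) ≤ -ρ z := by
        rw [← Real.le_log_iff_exp_le (by linarith)]
        linarith
      show ρ z ≤ -Real.exp (-c)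
      linarith

end Pseudoconvex

section MeanValue

variable {n : ℕ} {p : Fin n → ℂ} {β : Fin n → ℝ}

theorem polydisc_eq_pi (p : Fin n → ℂ) (β : Fin n → ℝ) :
    polydisc n p β = Set.univ.pi fun j => Metric.ball (p j) (β j) := by
  ext z
  simp [polydisc, dist_eq_norm]

theorem volume_real_polydisc (p : Fin n → ℂ) (hβ : ∀ j, 0 < β j) :
    volume.real (polydisc n p β) = ∏ j, (Real.pi * β j ^ 2) := by
  rw [polydisc_eq_pi, Measure.real, volume_pi_pi, ENNReal.toReal_prod]
  refine Finset.prod_congr rfl fun j _ => ?_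
  rw [Complex.volume_ball, ENNReal.toReal_mul, ENNReal.toReal_pow,
    ENNReal.toReal_ofReal (hβ j).le, mul_comm]
  rfl

theorem volume_polydisc_lt_top (p : Fin n → ℂ) (β : Fin n → ℝ) :
    volume (polydisc n p β) < ⊤ := by
  rw [polydisc_eq_pi, volume_pi_pi]
  exact ENNReal.prod_lt_top fun j _ => measure_ball_lt_top

theorem isOpen_polydisc (p : Fin n → ℂ) (β : Fin n → ℝ) : IsOpen (polydisc n p β) := by
  rw [polydisc_eq_pi]
  exact isOpen_set_pi finite_univ fun j _ => Metric.isOpen_ball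

theorem mem_polydisc_of_sum_lt {r : ℝ} (hβ : ∀ j, 0 < β j) {z : Fin n → ℂ} (hr : 0 < r)
    (hz : ∑ j, (β j ^ 2)⁻¹ * ‖z j - p j‖ ^ 2 < r ^ 2) :
    z ∈ polydisc n p fun j => r * β j := by
  intro j
  have h1 : (β j ^ 2)⁻¹ * ‖z j - p j‖ ^ 2 < r ^ 2 :=
    (Finset.single_le_sum (f := fun j => (β j ^ 2)⁻¹ * ‖z j - p j‖ ^ 2)
      (fun _ _ => by positivity) (Finset.mem_univ j)).trans_lt hz
  have h2 := hβ j
  rw [inv_mul_lt_iff₀ (by positivity)] at h1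
  refine lt_of_pow_lt_pow_left₀ 2 (by positivity) ?_
  linarith [mul_pow r (β j) 2]

theorem isCompact_setOf_sum_le (p : Fin n → ℂ) (hβ : ∀ j, 0 < β j) (c : ℝ) :
    IsCompact {z : Fin n → ℂ | ∑ j, (β j ^ 2)⁻¹ * ‖z j - p j‖ ^ 2 ≤ c} := by
  refine Metric.isCompact_of_isClosed_isBounded
    (isClosed_le (contDiff_weightedSq (m := 0) _ p).continuous continuous_const) ?_
  have h : Bornology.IsBounded (polydisc n p fun j => (|c| + 1) * β j) := by
    rw [polydisc_eq_pi]
    exact Bornology.IsBounded.pi fun j => Metric.isBounded_ball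
  refine h.subset fun z hz => mem_polydisc_of_sum_lt hβ (by positivity) (lt_of_le_of_lt hz ?_)
  nlinarith [abs_nonneg c, le_abs_self c]

theorem norm_sq_mul_le_integral {U : Set (Fin n → ℂ)} {F : (Fin n → ℂ) → ℂ} {r : ℝ}
    (hβ : ∀ j, 0 < β j) (hU : IsOpen U) (hPU : polydisc n p β ⊆ U) (hF : DifferentiableOn ℂ F U)
    (hr : 0 < r) (hr1 : r < 1) :
    (∏ j, (Real.pi * (r / (2 * (n + 1)) * β j) ^ 2)) * ‖F p‖ ^ 2
      ≤ ∫ z in {z | ∑ j, (β j ^ 2)⁻¹ * ‖z j - p j‖ ^ 2 ≤ r ^ 2}, ‖F z‖ ^ 2 := by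
  obtain ⟨θ, -, hθs, hθ1, hθ0, hθI, -⟩ := exists_cutoff_real (a := 1 / 4) (b := 1) (by norm_num)
  set B : Set (Fin n → ℂ) := {z | ∑ j, (β j ^ 2)⁻¹ * ‖z j - p j‖ ^ 2 ≤ r ^ 2} with hB
  have hBc : IsCompact B := isCompact_setOf_sum_le p hβ _
  have hBU : B ⊆ U := fun z hz => hPU fun j => by
    have := mem_polydisc_of_sum_lt hβ one_pos (lt_of_le_of_lt hz (by nlinarith)) j
    simpa using this
  set s : (Fin n → ℂ) → ℝ := fun t => ∑ j, (β j ^ 2)⁻¹ * ‖t j‖ ^ 2 with hs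
  have hsc : Continuous s := by
    have := contDiff_weightedSq (m := 0) (fun j => (β j ^ 2)⁻¹) (0 : Fin n → ℂ)
    simpa [hs] using this.continuous
  set k : (Fin n → ℂ) → ℝ := fun t => θ (s t / r ^ 2) with hk
  have hkc : Continuous k := hθs.continuous.comp (hsc.div_const _)
  have hk0 : ∀ t, r ^ 2 < s t → k t = 0 := fun t ht =>
    hθ0 _ ((one_le_div (by positivity)).2 ht.le)
  have hkK : IsCompact {t | s t ≤ r ^ 2} := by
    have := isCompact_setOf_sum_le (0 : Fin n → ℂ) hβ (r ^ 2)
    simpa [hs] using this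
  have hkcs : HasCompactSupport k := HasCompactSupport.intro hkK fun t ht => hk0 t (not_le.1 ht)
  have hkts : tsupport (fun t => (k t : ℂ)) ⊆ {t | s t ≤ r ^ 2} := by
    refine closure_minimal (fun t ht => ?_) hkK.isClosed
    by_contra h
    exact ht (by simp [hk0 t (not_le.1 h)])
  have hkint : Integrable k := hkc.integrable_of_hasCompactSupport hkcs
  have hmv := integral_circleInvariant_mul (F := fun z => F z ^ 2) (k := fun t => (k t : ℂ))
    (p := p) hU (hF.pow 2) (by fun_prop) (hkcs.comp_left (g := ((↑) : ℝ → ℂ)) (by simp))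
    (fun a t ha => by simp [hk, hs, ha]) (fun t ht a ha => hBU (by
      have h1 : s t ≤ r ^ 2 := hkts ht
      refine le_trans (Finset.sum_le_sum fun j _ => ?_) h1
      simp only [Pi.add_apply, add_sub_cancel_left, Pi.smul_apply, smul_eq_mul, norm_mul]
      gcongr
      exact mul_le_of_le_one_left (norm_nonneg _) ha))
  have hvol : ∏ j, (Real.pi * (r / (2 * (n + 1)) * β j) ^ 2) ≤ ∫ t, k t := by
    rw [← volume_real_polydisc (0 : Fin n → ℂ) (fun j => mul_pos (by positivity) (hβ j)),
      ← integral_indicator_one (isOpen_polydisc _ _).measurableSet]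
    refine integral_mono_of_nonneg (ae_of_all _ fun t => indicator_nonneg (by simp) _) hkint
      (ae_of_all _ fun t => ?_)
    by_cases ht : t ∈ polydisc n (0 : Fin n → ℂ) fun j => r / (2 * (n + 1)) * β j
    · have h1 : s t ≤ r ^ 2 / 4 := by
        calc s t ≤ ∑ _j : Fin n, r ^ 2 / (4 * (n + 1) ^ 2) := by
              refine Finset.sum_le_sum fun j _ => ?_
              have h2 : ‖t j‖ ≤ r / (2 * (n + 1)) * β j := by simpa using (ht j).le
              have h3 := hβ j
              rw [inv_mul_le_iff₀ (by positivity)]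
              calc ‖t j‖ ^ 2 ≤ (r / (2 * (n + 1)) * β j) ^ 2 := by gcongr
                _ = _ := by
                  field_simp
                  ring
          _ = n * (r ^ 2 / (4 * (n + 1) ^ 2)) := by simp
          _ ≤ (n + 1) ^ 2 * (r ^ 2 / (4 * (n + 1) ^ 2)) := by
              gcongr
              nlinarith [(Nat.cast_nonneg n : (0 : ℝ) ≤ n)]
          _ = r ^ 2 / 4 := by field_simp
      have h4 : k t = 1 := hθ1 _ (by
        rw [div_le_iff₀ (by positivity)]
        linarith)
      simp [ht, h4]
    · simp only [indicator_of_notMem ht]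
      exact (hθI _).1
  have hFi : IntegrableOn (fun z => ‖F z‖ ^ 2) B :=
    ((hF.continuousOn.mono hBU).norm.pow 2).integrableOn_compact hBc
  have hBm : MeasurableSet B := hBc.isClosed.measurableSet
  calc (∏ j, (Real.pi * (r / (2 * (n + 1)) * β j) ^ 2)) * ‖F p‖ ^ 2
      ≤ (∫ t, k t) * ‖F p‖ ^ 2 := by gcongr
    _ = ‖(∫ t, (k t : ℂ)) * F p ^ 2‖ := by
        rw [integral_complex_ofReal, norm_mul, norm_pow, Complex.norm_real,
          Real.norm_of_nonneg (integral_nonneg fun t => (hθI _).1)]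
    _ = ‖∫ t, (k t : ℂ) * F (p + t) ^ 2‖ := by rw [hmv]
    _ ≤ ∫ t, B.indicator (fun z => ‖F z‖ ^ 2) (p + t) := by
        refine norm_integral_le_of_norm_le
          (((integrable_indicator_iff hBm).2 hFi).comp_add_left p) (ae_of_all _ fun t => ?_)
        rw [norm_mul, norm_pow, Complex.norm_real, Real.norm_of_nonneg (hθI _).1]
        by_cases ht : p + t ∈ B
        · rw [indicator_of_mem ht]
          exact mul_le_of_le_one_left (by positivity) (hθI _).2
        · have : r ^ 2 < s t := by simpa [hB] using ht
          rw [indicator_of_notMem ht, mul_eq_zero_of_left (hk0 t this)]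
    _ = ∫ z in B, ‖F z‖ ^ 2 := by
        rw [integral_add_left_eq_self (fun z => B.indicator (fun z => ‖F z‖ ^ 2) z) p,
          integral_indicator hBm]

end MeanValue

section LogCutoff

/-- A localized logarithm `s ↦ ξ s * log (ε + s)` which is almost plurisubharmonic when composed
with a squared norm, uniformly in `ε`. -/
theorem exists_log_cutoff : ∃ B : ℝ, 0 ≤ B ∧ ∀ ε : ℝ, 0 < ε → ε ≤ 1 / 2 →
    ∃ g g₁ g₂ : ℝ → ℝ, (∀ s, 0 ≤ s → ContDiffAt ℝ 2 g s) ∧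
      (∀ s, 0 ≤ s → ∀ᶠ t in 𝓝 s, HasDerivAt g (g₁ t) t) ∧
      (∀ s, 0 ≤ s → HasDerivAt g₁ (g₂ s) s) ∧
      (∀ s, s ≤ 1 / 16 → g s = Real.log (ε + s)) ∧ (∀ s, 0 ≤ s → g s ≤ 0) ∧
      (∀ s, 1 / 4 ≤ s → g s = 0) ∧ (∀ s, 1 / 4 < s → g₁ s = 0 ∧ g₂ s = 0) ∧
      ∀ s N D, 0 ≤ s → 0 ≤ N → 0 ≤ D → D ≤ s * N → -(B * N) ≤ g₁ s * N + g₂ s * D := by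
  obtain ⟨ξ, B, hξs, hξ1, hξ0, hξI, hB0, hB1, hB2⟩ :=
    exists_cutoff_real (a := 1 / 16) (b := 1 / 4) (by norm_num)
  have hd0 : ∀ s, s < 1 / 16 ∨ 1 / 4 < s → deriv ξ s = 0 := by
    rintro s (hs | hs)
    · have : ξ =ᶠ[𝓝 s] fun _ => 1 := (eventually_lt_nhds hs).mono fun t ht => hξ1 t ht.le
      rw [this.deriv_eq, deriv_const]
    · have : ξ =ᶠ[𝓝 s] fun _ => 0 := (eventually_gt_nhds hs).mono fun t ht => hξ0 t ht.le
      rw [this.deriv_eq, deriv_const]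
  have hdd0 : ∀ s, s < 1 / 16 ∨ 1 / 4 < s → deriv (deriv ξ) s = 0 := by
    rintro s (hs | hs)
    · have : deriv ξ =ᶠ[𝓝 s] fun _ => 0 :=
        (eventually_lt_nhds hs).mono fun t ht => hd0 t (Or.inl ht)
      rw [this.deriv_eq, deriv_const]
    · have : deriv ξ =ᶠ[𝓝 s] fun _ => 0 :=
        (eventually_gt_nhds hs).mono fun t ht => hd0 t (Or.inr ht)
      rw [this.deriv_eq, deriv_const]
  have hξd : ∀ s, HasDerivAt ξ (deriv ξ s) s := fun s =>
    (hξs.differentiable (by simp) s).hasDerivAt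
  have hξdd : ∀ s, HasDerivAt (deriv ξ) (deriv (deriv ξ) s) s := fun s =>
    ((contDiff_infty_iff_deriv.1 hξs).2.differentiable (by simp) s).hasDerivAt
  refine ⟨28 * B, by positivity, fun ε hε hε2 => ⟨fun s => ξ s * Real.log (ε + s),
    fun s => deriv ξ s * Real.log (ε + s) + ξ s * (ε + s)⁻¹,
    fun s => deriv (deriv ξ) s * Real.log (ε + s) + deriv ξ s * (ε + s)⁻¹
      + (deriv ξ s * (ε + s)⁻¹ + ξ s * -((ε + s) ^ 2)⁻¹), ?_, ?_, ?_, ?_, ?_, ?_, ?_, ?_⟩⟩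
  · intro s hs
    exact (hξs.of_le (by norm_cast)).contDiffAt.mul
      ((contDiffAt_const.add contDiffAt_id).log (by simp; linarith))
  · intro s hs
    filter_upwards [eventually_gt_nhds (show -ε < s by linarith)] with t ht
    have h1 : HasDerivAt (fun s => Real.log (ε + s)) (ε + t)⁻¹ t := by
      simpa using ((hasDerivAt_id t).const_add ε).log (by simp; linarith)
    exact (hξd t).mul h1
  · intro t ht
    have h1 : HasDerivAt (fun s => Real.log (ε + s)) (ε + t)⁻¹ t := by
      simpa using ((hasDerivAt_id t).const_add ε).log (by simp; linarith)
    have h2 : HasDerivAt (fun s => (ε + s)⁻¹) (-((ε + t) ^ 2)⁻¹) t := by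
      simpa [neg_div] using ((hasDerivAt_id t).const_add ε).fun_inv (by simp; linarith)
    exact ((hξdd t).mul h1).add ((hξd t).mul h2)
  · intro s hs
    simp [hξ1 s hs]
  · intro s hs
    rcases le_or_gt (1 / 4) s with h | h
    · simp [hξ0 s h]
    · exact mul_nonpos_of_nonneg_of_nonpos (hξI s).1
        (Real.log_nonpos (by linarith) (by linarith))
  · intro s hs
    simp [hξ0 s hs]
  · intro s hs
    simp [hξ0 s hs.le, hd0 s (Or.inr hs), hdd0 s (Or.inr hs)]
  · intro s N D hs hN hD hDN
    obtain ⟨y, hy⟩ : ∃ y, y = ε + s := ⟨_, rfl⟩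
    have hy0 : 0 < y := by linarith
    have hmain : 0 ≤ ξ s * y⁻¹ * N + ξ s * -(y ^ 2)⁻¹ * D := by
      have h1 : D ≤ y * N := hDN.trans (by gcongr; linarith)
      have h2 : ξ s * y⁻¹ * N + ξ s * -(y ^ 2)⁻¹ * D = ξ s * ((y ^ 2)⁻¹ * (y * N - D)) := by
        field_simp
        ring
      rw [h2]
      exact mul_nonneg (hξI s).1 (mul_nonneg (by positivity) (by linarith))
    simp only [← hy]
    by_cases hcase : s < 1 / 16 ∨ 1 / 4 < s
    · rw [hd0 s hcase, hdd0 s hcase]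
      have : 0 ≤ 28 * B * N := by positivity
      linarith
    · push Not at hcase
      obtain ⟨hs1, hs2⟩ := hcase
      have hyi : y⁻¹ ≤ 16 := by
        rw [inv_le_comm₀ hy0 (by norm_num)]
        linarith
      have hyi0 : 0 < y⁻¹ := inv_pos.2 hy0
      have hL : |Real.log y| ≤ 16 := by
        rw [abs_le]
        have h1 := Real.one_sub_inv_le_log_of_pos hy0
        have h2 := Real.log_nonpos hy0.le (by linarith)
        constructor <;> linarith
      have hDq : D ≤ 1 / 4 * N := hDN.trans (by gcongr)
      have e1 : |deriv ξ s * Real.log y * N| ≤ B * 16 * N := by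
        rw [abs_mul, abs_mul, abs_of_nonneg hN]
        have := hB1 s
        gcongr
      have e2 : |deriv (deriv ξ) s * Real.log y * D| ≤ B * 16 * (1 / 4 * N) := by
        rw [abs_mul, abs_mul, abs_of_nonneg hD]
        have := hB2 s
        gcongr
      have e3 : |deriv ξ s * y⁻¹ * D| ≤ B * 16 * (1 / 4 * N) := by
        rw [abs_mul, abs_mul, abs_of_nonneg hD, abs_of_pos hyi0]
        have := hB1 s
        gcongr
      have f1 := (abs_le.1 e1).1
      have f2 := (abs_le.1 e2).1
      have f3 := (abs_le.1 e3).1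
      linarith

end LogCutoff

section PeakWeight

variable {n : ℕ} {w : Fin n → ℝ} {p z : Fin n → ℂ} {β : Fin n → ℝ} {Ω : Set (Fin n → ℂ)}
  {φ : (Fin n → ℂ) → ℝ}

theorem norm_sum_wder_weightedSq_sq_le (hw : ∀ j, 0 ≤ w j) (X : Fin n → ℂ) :
    ‖∑ j, wder n j (fun v => ((∑ k, w k * ‖v k - p k‖ ^ 2 : ℝ) : ℂ)) z * X j‖ ^ 2
      ≤ (∑ j, w j * ‖z j - p j‖ ^ 2) * ∑ j, w j * ‖X j‖ ^ 2 := by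
  have h := norm_sum_mul_sq_le (fun j => (√(w j) : ℂ) * (starRingEnd ℂ) (z j - p j))
    (fun j => (√(w j) : ℂ) * X j)
  have e : ∀ (j : Fin n) (a : ℂ), ‖(√(w j) : ℂ) * a‖ ^ 2 = w j * ‖a‖ ^ 2 := fun j a => by
    rw [norm_mul, mul_pow, Complex.norm_real, Real.norm_eq_abs, sq_abs, Real.sq_sqrt (hw j)]
  simp only [e, RCLike.norm_conj] at h
  refine le_trans (le_of_eq ?_) h
  congr 2
  refine Finset.sum_congr rfl fun j _ => ?_
  rw [wder_weightedSq]
  have : (w j : ℂ) = (√(w j) : ℂ) * (√(w j) : ℂ) := by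
    rw [← Complex.ofReal_mul, Real.mul_self_sqrt (hw j)]
  rw [this]
  ring

theorem hermForm_cHess_const_mul (K : ℝ) (hφ : ContDiffAt ℝ 2 φ z) (X : Fin n → ℂ) :
    hermForm n (cHess n (fun v => K * φ v) z) X X = K * hermForm n (cHess n φ z) X X := by
  have h := hermForm_cHess_comp (G := fun s => K * s) (G1 := fun _ => K) (g := 0) hφ
    (Eventually.of_forall fun s => by simpa using (hasDerivAt_id s).const_mul K)
    (hasDerivAt_const _ _) X
  simpa using h

/-- The weight `K φ + (n + 1) log (ε + S)`, localized near `p`, where `S` is the squared norm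
adapted to the polydisc. -/
theorem exists_peak_weight (n : ℕ) {Ct : ℝ} (hCt : 0 < Ct) : ∃ K : ℝ, 0 ≤ K ∧
    ∀ (M : ℝ) (Ω : Set (Fin n → ℂ)) (p : Fin n → ℂ) (β : Fin n → ℝ) (φ : (Fin n → ℂ) → ℝ),
    IsOpen Ω → (∀ j, 0 < β j) → ContDiffOn ℝ 2 φ Ω → (∀ z ∈ Ω, |φ z| ≤ M) → PSHOnC2 n φ Ω →
    (∀ z ∈ polydisc n p β, ∀ X : Fin n → ℂ,
      Ct * ∑ j, ‖X j‖ ^ 2 / (β j) ^ 2 ≤ hermForm n (cHess n φ z) X X) →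
    ∀ ε : ℝ, 0 < ε → ε ≤ 1 / 16 → ∃ Φ : (Fin n → ℂ) → ℝ, ContDiffOn ℝ 2 Φ Ω ∧ PSHOnC2 n Φ Ω ∧
      (∀ z ∈ Ω, Φ z ≤ K * M) ∧
      (∀ z ∈ Ω, 1 / 4 ≤ ∑ j, (β j ^ 2)⁻¹ * ‖z j - p j‖ ^ 2 → -(K * M) ≤ Φ z) ∧
      (∀ z ∈ Ω, ∑ j, (β j ^ 2)⁻¹ * ‖z j - p j‖ ^ 2 ≤ ε →
        Real.exp (Φ z) ≤ Real.exp (K * M) * (2 * ε) ^ (n + 1)) ∧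
      ∀ z ∈ polydisc n p β ∩ Ω, ∀ X : Fin n → ℂ,
        ∑ j, (β j ^ 2)⁻¹ * ‖X j‖ ^ 2 ≤ hermForm n (cHess n Φ z) X X := by
  obtain ⟨B, hB0, hB⟩ := exists_log_cutoff
  refine ⟨((n + 1) * B + 1) / Ct, by positivity, fun M Ω p β φ hΩ hβ hφ hφM hφp hφC ε hε hε2 => ?_⟩
  obtain ⟨K, hK⟩ : ∃ K, K = ((n + 1) * B + 1) / Ct := ⟨_, rfl⟩
  have hK0 : 0 ≤ K := by rw [hK]; positivity
  have hKCt : K * Ct = (n + 1) * B + 1 := by rw [hK]; field_simp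
  rw [← hK]
  obtain ⟨g, g₁, g₂, hg, hgd, hgdd, hglog, hgneg, hg0, hgd0, hgB⟩ := hB ε hε (by linarith)
  obtain ⟨S, hS⟩ : ∃ S : (Fin n → ℂ) → ℝ, S = fun z => ∑ j, (β j ^ 2)⁻¹ * ‖z j - p j‖ ^ 2 :=
    ⟨_, rfl⟩
  have hw : ∀ j, 0 ≤ (β j ^ 2)⁻¹ := fun j => by positivity
  have hS0 : ∀ z, 0 ≤ S z := fun z => by
    rw [hS]
    exact Finset.sum_nonneg fun j _ => mul_nonneg (hw j) (by positivity)
  have hSd : ContDiff ℝ 2 S := by rw [hS]; exact contDiff_weightedSq _ _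
  have hSz : ∀ z, ∑ j, (β j ^ 2)⁻¹ * ‖z j - p j‖ ^ 2 = S z := fun z => by rw [hS]
  simp only [hSz]
  have hgS : ContDiff ℝ 2 fun z => g (S z) :=
    contDiff_iff_contDiffAt.2 fun z => (hg (S z) (hS0 z)).comp z hSd.contDiffAt
  have hφz : ∀ z ∈ Ω, ContDiffAt ℝ 2 φ z := fun z hz => hφ.contDiffAt (hΩ.mem_nhds hz)
  have hn0 : (0 : ℝ) ≤ n + 1 := by positivity
  have hH : ∀ z ∈ Ω, ∀ X, hermForm n (cHess n (fun v => K * φ v + (n + 1) * g (S v)) z) X X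
      = K * hermForm n (cHess n φ z) X X + (n + 1) * (g₁ (S z) * ∑ j, (β j ^ 2)⁻¹ * ‖X j‖ ^ 2
        + g₂ (S z) * ‖∑ j, wder n j (fun v => (S v : ℂ)) z * X j‖ ^ 2) := by
    intro z hz X
    have e : cHess n (fun v => K * φ v + (n + 1) * g (S v)) z = fun j l =>
        cHess n (fun v => K * φ v) z j l + cHess n (fun v => (n + 1) * g (S v)) z j l := by
      funext j l
      exact cHess_add (contDiffAt_const.mul (hφz z hz)) (contDiffAt_const.mul hgS.contDiffAt) j l
    rw [e, hermForm_add, hermForm_cHess_const_mul _ (hφz z hz),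
      hermForm_cHess_const_mul _ hgS.contDiffAt,
      hermForm_cHess_comp hSd.contDiffAt (hgd _ (hS0 z)) (hgdd _ (hS0 z))]
    congr 4
    rw [hS]
    exact hermForm_cHess_weightedSq _ _ _ X
  have hlow : ∀ z ∈ polydisc n p β ∩ Ω, ∀ X, ∑ j, (β j ^ 2)⁻¹ * ‖X j‖ ^ 2
      ≤ hermForm n (cHess n (fun v => K * φ v + (n + 1) * g (S v)) z) X X := by
    intro z hz X
    rw [hH z hz.2]
    have h1 := hφC z hz.1 X
    have h2 : ∑ j, ‖X j‖ ^ 2 / (β j) ^ 2 = ∑ j, (β j ^ 2)⁻¹ * ‖X j‖ ^ 2 :=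
      Finset.sum_congr rfl fun j _ => by rw [div_eq_inv_mul]
    rw [h2] at h1
    have hN0 : 0 ≤ ∑ j, (β j ^ 2)⁻¹ * ‖X j‖ ^ 2 :=
      Finset.sum_nonneg fun j _ => mul_nonneg (hw j) (by positivity)
    have h3 : ‖∑ j, wder n j (fun v => (S v : ℂ)) z * X j‖ ^ 2
        ≤ S z * ∑ j, (β j ^ 2)⁻¹ * ‖X j‖ ^ 2 := by
      have := norm_sum_wder_weightedSq_sq_le (p := p) (z := z) hw X
      rw [hS]
      exact this
    have h4 := mul_le_mul_of_nonneg_left (hgB (S z) _ _ (hS0 z) hN0 (sq_nonneg _) h3) hn0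
    have h5 := mul_le_mul_of_nonneg_left h1 hK0
    rw [← mul_assoc, hKCt] at h5
    linarith
  refine ⟨fun z => K * φ z + (n + 1) * g (S z),
    (contDiffOn_const.mul hφ).add (contDiffOn_const.mul hgS.contDiffOn), ?_, ?_, ?_, ?_, hlow⟩
  · intro z hz X
    by_cases hzp : z ∈ polydisc n p β
    · exact (Finset.sum_nonneg fun j _ => mul_nonneg (hw j) (by positivity)).trans
        (hlow z ⟨hzp, hz⟩ X)
    · have hSz1 : 1 / 4 < S z := by
        by_contra hcon
        push Not at hcon
        have := mem_polydisc_of_sum_lt (r := 1) hβ one_pos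
          (show ∑ j, (β j ^ 2)⁻¹ * ‖z j - p j‖ ^ 2 < 1 ^ 2 by rw [hSz]; linarith)
        simp only [one_mul] at this
        exact hzp this
      rw [hH z hz, (hgd0 _ hSz1).1, (hgd0 _ hSz1).2]
      have := mul_nonneg hK0 (hφp z hz X)
      linarith
  · intro z hz
    have h1 := mul_le_mul_of_nonneg_left (abs_le.1 (hφM z hz)).2 hK0
    have h2 := mul_nonpos_of_nonneg_of_nonpos hn0 (hgneg _ (hS0 z))
    linarith
  · intro z hz hs
    have h1 := mul_le_mul_of_nonneg_left (abs_le.1 (hφM z hz)).1 hK0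
    simp only [hg0 _ hs]
    linarith
  · intro z hz hs
    have h1 := mul_le_mul_of_nonneg_left (abs_le.1 (hφM z hz)).2 hK0
    have hpos : 0 < ε + S z := by linarith [hS0 z]
    simp only [hglog _ (hs.trans hε2)]
    rw [Real.exp_add]
    have h2 : Real.exp (((n : ℝ) + 1) * Real.log (ε + S z)) = (ε + S z) ^ (n + 1) := by
      rw [← Real.exp_log (pow_pos hpos _), Real.log_pow]
      push_cast
      rfl
    rw [h2]
    gcongr
    linarith

end PeakWeight

section PeakFunction

variable {n : ℕ} {p : Fin n → ℂ} {β : Fin n → ℝ} {Ω : Set (Fin n → ℂ)} {Φ : (Fin n → ℂ) → ℝ}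

/-- A cutoff function adapted to a polydisc, with scale-invariant control of its gradient. -/
theorem exists_polydisc_cutoff (n : ℕ) : ∃ B : ℝ, 0 ≤ B ∧
    ∀ (p : Fin n → ℂ) (β : Fin n → ℝ), (∀ j, 0 < β j) → ∃ χ : (Fin n → ℂ) → ℂ, ContDiff ℝ 2 χ ∧
      HasCompactSupport χ ∧ tsupport χ ⊆ polydisc n p β ∧ (∀ z, ‖χ z‖ ≤ 1) ∧
      (∀ z, ∑ j, (β j ^ 2)⁻¹ * ‖z j - p j‖ ^ 2 ≤ 1 / 4 → χ z = 1) ∧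
      ∀ z (X : Fin n → ℂ), ‖∑ j, X j * (starRingEnd ℂ) (wderBar n j χ z)‖ ^ 2
        ≤ {z | ∑ j, (β j ^ 2)⁻¹ * ‖z j - p j‖ ^ 2 ∈ Icc (1 / 4) (1 / 2)}.indicator
          (fun _ => B) z * ∑ j, (β j ^ 2)⁻¹ * ‖X j‖ ^ 2 := by
  obtain ⟨θ, B, hθs, hθ1, hθ0, hθI, hB0, hB1, -⟩ :=
    exists_cutoff_real (a := 1 / 4) (b := 1 / 2) (by norm_num)
  have hd0 : ∀ s, s < 1 / 4 ∨ 1 / 2 < s → deriv θ s = 0 := by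
    rintro s (hs | hs)
    · have : θ =ᶠ[𝓝 s] fun _ => 1 := (eventually_lt_nhds hs).mono fun t ht => hθ1 t ht.le
      rw [this.deriv_eq, deriv_const]
    · have : θ =ᶠ[𝓝 s] fun _ => 0 := (eventually_gt_nhds hs).mono fun t ht => hθ0 t ht.le
      rw [this.deriv_eq, deriv_const]
  refine ⟨B ^ 2, by positivity, fun p β hβ => ?_⟩
  obtain ⟨S, hS⟩ : ∃ S : (Fin n → ℂ) → ℝ, S = fun z => ∑ j, (β j ^ 2)⁻¹ * ‖z j - p j‖ ^ 2 :=
    ⟨_, rfl⟩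
  have hw : ∀ j, 0 ≤ (β j ^ 2)⁻¹ := fun j => by positivity
  have hSd : ContDiff ℝ 2 S := by rw [hS]; exact contDiff_weightedSq _ _
  have hSz : ∀ z, ∑ j, (β j ^ 2)⁻¹ * ‖z j - p j‖ ^ 2 = S z := fun z => by rw [hS]
  have hts : tsupport (fun z => (θ (S z) : ℂ))
      ⊆ {z | ∑ j, (β j ^ 2)⁻¹ * ‖z j - p j‖ ^ 2 ≤ 1 / 2} := by
    refine closure_minimal (fun z hz => ?_) (isCompact_setOf_sum_le p hβ _).isClosed
    by_contra hcon
    simp only [mem_ofPred_eq, hSz, not_le] at hcon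
    exact hz (by simp [hθ0 _ hcon.le])
  refine ⟨fun z => (θ (S z) : ℂ), ?_, ?_, ?_, ?_, ?_, ?_⟩
  · exact contDiff_ofReal_comp ((hθs.of_le (by norm_cast)).comp hSd)
  · exact (isCompact_setOf_sum_le p hβ _).of_isClosed_subset (isClosed_tsupport _) hts
  · intro z hz
    have := mem_polydisc_of_sum_lt (r := 1) hβ one_pos (z := z) (p := p)
      ((hts hz).trans_lt (by norm_num))
    simpa using this
  · intro z
    rw [Complex.norm_real, Real.norm_eq_abs, abs_of_nonneg (hθI _).1]
    exact (hθI _).2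
  · intro z hz
    rw [hSz] at hz
    simp [hθ1 _ hz]
  · intro z X
    have hN0 : 0 ≤ ∑ j, (β j ^ 2)⁻¹ * ‖X j‖ ^ 2 :=
      Finset.sum_nonneg fun j _ => mul_nonneg (hw j) (by positivity)
    have e : ∑ j, X j * (starRingEnd ℂ) (wderBar n j (fun z => (θ (S z) : ℂ)) z)
        = deriv θ (S z) * ∑ j, wder n j (fun v => (S v : ℂ)) z * X j := by
      rw [Finset.mul_sum]
      refine Finset.sum_congr rfl fun j _ => ?_
      rw [wderBar_ofReal j (fun z => θ (S z)) z, Complex.conj_conj,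
        wder_comp_ofReal j (hSd.differentiable (by simp) z)
          (hθs.differentiable (by simp) _).hasDerivAt]
      ring
    rw [e, norm_mul, mul_pow, Complex.norm_real, Real.norm_eq_abs]
    simp only [hSz]
    by_cases hz : S z ∈ Icc (1 / 4) (1 / 2)
    · rw [indicator_of_mem (show z ∈ {z | S z ∈ Icc (1 / 4) (1 / 2)} from hz)]
      have h3 : ‖∑ j, wder n j (fun v => (S v : ℂ)) z * X j‖ ^ 2
          ≤ S z * ∑ j, (β j ^ 2)⁻¹ * ‖X j‖ ^ 2 := by
        have := norm_sum_wder_weightedSq_sq_le (p := p) (z := z) hw X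
        rw [hS]
        exact this
      have h4 : S z * ∑ j, (β j ^ 2)⁻¹ * ‖X j‖ ^ 2 ≤ 1 * ∑ j, (β j ^ 2)⁻¹ * ‖X j‖ ^ 2 :=
        mul_le_mul_of_nonneg_right (hz.2.trans (by norm_num)) hN0
      rw [one_mul] at h4
      have h5 := hB1 (S z)
      gcongr
      exact h3.trans h4
    · rw [indicator_of_notMem (show z ∉ {z | S z ∈ Icc (1 / 4) (1 / 2)} from hz), hd0]
      · simp
      · by_contra hcon
        push Not at hcon
        exact hz hcon

/-- The `L²` construction of a holomorphic function close to `1` near the centre of a polydisc. -/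
theorem exists_peak_function (n : ℕ) : ∃ B : ℝ, 0 ≤ B ∧
    ∀ (Ω : Set (Fin n → ℂ)) (p : Fin n → ℂ) (β : Fin n → ℝ) (Φ : (Fin n → ℂ) → ℝ) (κ : ℝ),
    IsOpen Ω → (∀ K : Set (Fin n → ℂ), IsCompact K → K ⊆ Ω → ∃ k T, CutoffWeights n Ω K k T) →
    (∀ j, 0 < β j) → polydisc n p β ⊆ Ω → ContDiffOn ℝ 2 Φ Ω → PSHOnC2 n Φ Ω →
    (∀ z ∈ Ω, Φ z ≤ κ) →
    (∀ z ∈ Ω, 1 / 4 ≤ ∑ j, (β j ^ 2)⁻¹ * ‖z j - p j‖ ^ 2 → -κ ≤ Φ z) →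
    (∀ z ∈ polydisc n p β, ∀ X : Fin n → ℂ,
      ∑ j, (β j ^ 2)⁻¹ * ‖X j‖ ^ 2 ≤ hermForm n (cHess n Φ z) X X) →
    ∃ F : (Fin n → ℂ) → ℂ, InBergman n Ω F ∧
      l2sq n Ω F ≤ (2 + 2 * Real.exp κ * (B * Real.exp κ)) * ∏ j, (Real.pi * β j ^ 2) ∧
      ∀ ε δ, ε ≤ 1 / 4 → 0 ≤ δ →
        (∀ z ∈ Ω, ∑ j, (β j ^ 2)⁻¹ * ‖z j - p j‖ ^ 2 ≤ ε → Real.exp (Φ z) ≤ δ) →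
        ∫ z in {z | ∑ j, (β j ^ 2)⁻¹ * ‖z j - p j‖ ^ 2 ≤ ε}, ‖F z - 1‖ ^ 2
          ≤ δ * (B * Real.exp κ * ∏ j, (Real.pi * β j ^ 2)) := by
  obtain ⟨B, hB0, hB⟩ := exists_polydisc_cutoff n
  refine ⟨B, hB0, fun Ω p β Φ κ hΩ hcw hβ hP hΦ hΦp hΦκ hΦκ' hΦH => ?_⟩
  obtain ⟨χ, hχ, hχc, hχP, hχ1, hχe, hχG⟩ := hB p β hβ
  obtain ⟨S, hS⟩ : ∃ S : (Fin n → ℂ) → ℝ, S = fun z => ∑ j, (β j ^ 2)⁻¹ * ‖z j - p j‖ ^ 2 :=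
    ⟨_, rfl⟩
  have hSz : ∀ z, ∑ j, (β j ^ 2)⁻¹ * ‖z j - p j‖ ^ 2 = S z := fun z => by rw [hS]
  have hSc : Continuous S := by
    rw [hS]
    exact (contDiff_weightedSq (m := 0) _ _).continuous
  have hSP : ∀ z, S z < 1 → z ∈ polydisc n p β := fun z hz => by
    have := mem_polydisc_of_sum_lt (r := 1) hβ one_pos (z := z) (p := p)
      (by rw [hSz]; linarith)
    simpa using this
  have hScpt : ∀ c, IsCompact {z | S z ≤ c} := fun c => by
    rw [hS]
    exact isCompact_setOf_sum_le p hβ c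
  simp only [hSz] at hχe hχG hΦκ' ⊢
  obtain ⟨A, hA⟩ : ∃ A, A = B * Real.exp κ * ∏ j, (Real.pi * β j ^ 2) := ⟨_, rfl⟩
  have hA0 : 0 ≤ A := by
    rw [hA]
    exact mul_nonneg (mul_nonneg hB0 (Real.exp_pos _).le)
      (Finset.prod_nonneg fun j _ => by have := Real.pi_pos; positivity)
  obtain ⟨Q, hQ⟩ : ∃ Q : Set (Fin n → ℂ), Q = {z | S z ∈ Icc (1 / 4) (1 / 2)} := ⟨_, rfl⟩
  have hQc : IsCompact Q := by
    rw [hQ]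
    exact (hScpt (1 / 2)).of_isClosed_subset (isClosed_Icc.preimage hSc) fun z hz => hz.2
  have hQP : Q ⊆ polydisc n p β := fun z hz => by
    rw [hQ] at hz
    exact hSP z (hz.2.trans_lt (by norm_num))
  rw [← hQ] at hχG
  have hGe : ∀ z, Q.indicator (fun _ => B) z * Real.exp (-Φ z)
      = Q.indicator (fun z => B * Real.exp (-Φ z)) z := fun z => by
    by_cases hz : z ∈ Q <;> simp [hz]
  have hGi : IntegrableOn (fun z => B * Real.exp (-Φ z)) Q := by
    refine ContinuousOn.integrableOn_compact hQc ?_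
    have := hΦ.continuousOn.mono (hQP.trans hP)
    fun_prop
  obtain ⟨u, hu, huA, hu0⟩ := exists_l2_solution (χ := χ) (G := Q.indicator fun _ => B) (A := A)
    hΩ hΦ hΦp hcw hχ hχc (hχP.trans hP) (fun z => indicator_nonneg (fun _ _ => hB0) z)
    (fun z hz X => by
      refine (hχG z X).trans ?_
      by_cases hzQ : z ∈ Q
      · simp only [hzQ, indicator_of_mem]
        exact mul_le_mul_of_nonneg_left (hΦH z (hQP hzQ) X) hB0
      · simp [hzQ])
    (by
      simp only [hGe]
      exact (integrable_indicator_iff hQc.measurableSet).2 hGi)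
    (by
      simp only [hGe]
      rw [integral_indicator hQc.measurableSet]
      have hfin : volume Q ≠ ⊤ := hQc.measure_lt_top.ne
      calc ∫ z in Q, B * Real.exp (-Φ z) ≤ ∫ z in Q, B * Real.exp κ := by
            refine setIntegral_mono_on hGi (integrableOn_const hfin) hQc.measurableSet
              fun z hz => ?_
            have h1 : S z ∈ Icc (1 / 4) (1 / 2) := by rw [hQ] at hz; exact hz
            have := hΦκ' z (hP (hQP hz)) h1.1
            gcongr
            linarith
        _ = volume.real Q * (B * Real.exp κ) := by
            rw [setIntegral_const, smul_eq_mul]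
        _ ≤ volume.real (polydisc n p β) * (B * Real.exp κ) := by
            refine mul_le_mul_of_nonneg_right
              (measureReal_mono hQP (volume_polydisc_lt_top p β).ne) ?_
            exact mul_nonneg hB0 (Real.exp_pos _).le
        _ = A := by rw [volume_real_polydisc p hβ, hA]; ring)
  have hexp : ∀ z, ‖cexp ((Φ z : ℂ) / 2) * u z‖ ^ 2 = Real.exp (Φ z) * ‖u z‖ ^ 2 := fun z => by
    rw [norm_mul, mul_pow, Complex.norm_exp, ← Real.exp_nat_mul]
    congr 2
    simp
    ring
  have hχL : MemLp χ 2 := hχ.continuous.memLp_of_hasCompactSupport hχc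
  have hfL : MemLp (fun z => χ z - cexp ((Φ z : ℂ) / 2) * u z) 2 (volume.restrict Ω) := by
    refine (hχL.restrict Ω).sub (MemLp.of_le_mul (c := Real.exp (κ / 2)) (hu.restrict Ω) ?_ ?_)
    · have hc : ContinuousOn (fun z => cexp ((Φ z : ℂ) / 2)) Ω := by
        have : ContinuousOn (fun z => (Φ z : ℂ)) Ω :=
          Complex.continuous_ofReal.comp_continuousOn hΦ.continuousOn
        fun_prop
      exact (hc.aestronglyMeasurable hΩ.measurableSet).mul hu.1.restrict
    · refine (ae_restrict_iff' hΩ.measurableSet).2 (Eventually.of_forall fun z hz => ?_)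
      rw [norm_mul, Complex.norm_exp]
      have := hΦκ z hz
      gcongr
      simp
      linarith
  obtain ⟨F, hF, hFe⟩ := exists_holomorphic_ae_eq hΩ (fun z hz => by
    obtain ⟨r, hr, hrΩ⟩ := Metric.isOpen_iff.1 hΩ z hz
    exact ⟨r, hr, (memLp_indicator_iff_restrict measurableSet_ball).2
      (hfL.mono_measure (Measure.restrict_mono hrΩ le_rfl))⟩) hu0
  have hu2 : Integrable fun z => ‖u z‖ ^ 2 := hu.integrable_norm_pow (by norm_num)
  have hPi : Integrable ((polydisc n p β).indicator fun _ => (1 : ℝ)) :=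
    (integrable_indicator_iff (isOpen_polydisc p β).measurableSet).2
      (integrableOn_const (volume_polydisc_lt_top p β).ne)
  have hbi : Integrable fun z => 2 * (polydisc n p β).indicator (fun _ => (1 : ℝ)) z
      + 2 * Real.exp κ * ‖u z‖ ^ 2 := (hPi.const_mul 2).add (hu2.const_mul _)
  have hbd : ∀ᵐ z ∂(volume.restrict Ω), ‖F z‖ ^ 2
      ≤ 2 * (polydisc n p β).indicator (fun _ => (1 : ℝ)) z + 2 * Real.exp κ * ‖u z‖ ^ 2 := by
    filter_upwards [(ae_restrict_iff' hΩ.measurableSet).2 hFe,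
      ae_restrict_mem hΩ.measurableSet] with z hz hzΩ
    rw [← hz]
    have h1 := norm_add_sq_le_two_mul (χ z) (-(cexp ((Φ z : ℂ) / 2) * u z))
    rw [norm_neg, hexp, ← sub_eq_add_neg] at h1
    have h2 : ‖χ z‖ ^ 2 ≤ (polydisc n p β).indicator (fun _ => (1 : ℝ)) z := by
      by_cases hzP : z ∈ polydisc n p β
      · simp only [hzP, indicator_of_mem]
        exact pow_le_one₀ (norm_nonneg _) (hχ1 z)
      · rw [image_eq_zero_of_notMem_tsupport fun h => hzP (hχP h)]
        simp [hzP]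
    have h3 : Real.exp (Φ z) * ‖u z‖ ^ 2 ≤ Real.exp κ * ‖u z‖ ^ 2 := by
      have := hΦκ z hzΩ
      gcongr
    linarith
  have hFi : IntegrableOn (fun z => ‖F z‖ ^ 2) Ω := by
    refine hbi.integrableOn.mono'
      ((hF.continuousOn.norm.pow 2).aestronglyMeasurable hΩ.measurableSet) ?_
    filter_upwards [hbd] with z hz
    rwa [Real.norm_of_nonneg (by positivity)]
  refine ⟨F, ⟨hF, hFi⟩, ?_, ?_⟩
  · calc l2sq n Ω F ≤ ∫ z in Ω, (2 * (polydisc n p β).indicator (fun _ => (1 : ℝ)) z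
          + 2 * Real.exp κ * ‖u z‖ ^ 2) := integral_mono_ae hFi hbi.integrableOn hbd
      _ ≤ ∫ z, (2 * (polydisc n p β).indicator (fun _ => (1 : ℝ)) z
          + 2 * Real.exp κ * ‖u z‖ ^ 2) := by
          refine setIntegral_le_integral hbi (Eventually.of_forall fun z => ?_)
          have : 0 ≤ (polydisc n p β).indicator (fun _ => (1 : ℝ)) z :=
            indicator_nonneg (fun _ _ => zero_le_one) z
          simp only [Pi.zero_apply]
          positivity
      _ = 2 * volume.real (polydisc n p β) + 2 * Real.exp κ * ∫ z, ‖u z‖ ^ 2 := by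
          rw [integral_add (hPi.const_mul 2) (hu2.const_mul _), integral_const_mul,
            integral_const_mul, integral_indicator_const _ (isOpen_polydisc p β).measurableSet]
          simp
      _ ≤ 2 * volume.real (polydisc n p β) + 2 * Real.exp κ * A := by gcongr
      _ = _ := by rw [volume_real_polydisc p hβ, hA]; ring
  · intro ε δ hε hδ0 hδ
    have hsub : {z | S z ≤ ε} ⊆ Ω := fun z hz =>
      hP (hSP z (lt_of_le_of_lt (le_trans hz hε) (by norm_num)))
    have hm : MeasurableSet {z | S z ≤ ε} := (hScpt ε).measurableSet
    have hae : ∀ᵐ z ∂(volume.restrict {z | S z ≤ ε}), ‖F z - 1‖ ^ 2 ≤ δ * ‖u z‖ ^ 2 := by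
      filter_upwards [ae_restrict_of_ae hFe, ae_restrict_mem hm] with z hz hzS
      rw [← hz (hsub hzS), hχe z (le_trans hzS hε)]
      have : (1 : ℂ) - cexp ((Φ z : ℂ) / 2) * u z - 1 = -(cexp ((Φ z : ℂ) / 2) * u z) := by ring
      rw [this, norm_neg, hexp]
      exact mul_le_mul_of_nonneg_right (hδ z (hsub hzS) hzS) (by positivity)
    have hi : IntegrableOn (fun z => ‖F z - 1‖ ^ 2) {z | S z ≤ ε} :=
      ContinuousOn.integrableOn_compact (hScpt ε)
        (((hF.continuousOn.mono hsub).sub continuousOn_const).norm.pow 2)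
    rw [← hA]
    calc ∫ z in {z | S z ≤ ε}, ‖F z - 1‖ ^ 2 ≤ ∫ z in {z | S z ≤ ε}, δ * ‖u z‖ ^ 2 :=
          integral_mono_ae hi (hu2.const_mul δ).integrableOn hae
      _ ≤ ∫ z, δ * ‖u z‖ ^ 2 :=
          setIntegral_le_integral (hu2.const_mul δ) (Eventually.of_forall fun z => by
            simp only [Pi.zero_apply]; positivity)
      _ = δ * ∫ z, ‖u z‖ ^ 2 := integral_const_mul _ _
      _ ≤ δ * A := by gcongr

end PeakFunction

section KernelBounds

variable {n : ℕ} {Ω : Set (Fin n → ℂ)} {p : Fin n → ℂ} {β : Fin n → ℝ}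

theorem InBergman.norm_sq_mul_le {f : (Fin n → ℂ) → ℂ} (hf : InBergman n Ω f) (hΩ : IsOpen Ω)
    (hβ : ∀ j, 0 < β j) (hP : polydisc n p β ⊆ Ω) :
    (∏ j, (Real.pi * ((1 / 2) / (2 * (n + 1)) * β j) ^ 2)) * ‖f p‖ ^ 2 ≤ l2sq n Ω f := by
  refine (norm_sq_mul_le_integral hβ hΩ hP hf.1 (by norm_num) (by norm_num)).trans ?_
  refine setIntegral_mono_set hf.2 (Eventually.of_forall fun z => by positivity)
    (LE.le.eventuallyLE fun z hz => hP ?_)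
  have := mem_polydisc_of_sum_lt (r := 1) hβ one_pos (z := z) (p := p)
    (lt_of_le_of_lt hz (by norm_num))
  simpa using this

theorem prod_pi_mul_sq (c : ℝ) :
    ∏ j, (Real.pi * (c * β j) ^ 2) = (Real.pi * c ^ 2) ^ n * ∏ j, (β j) ^ 2 := by
  simp only [mul_pow, ← mul_assoc, Finset.prod_mul_distrib, Finset.prod_const, Finset.card_univ,
    Fintype.card_fin]

/-- A Bergman space function that is not small at the centre of a polydisc, with norm controlled by
the volume of the polydisc. -/
theorem exists_inBergman_peak (n : ℕ) {M Ct : ℝ} (hCt : 0 < Ct) : ∃ V > (0 : ℝ),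
    ∀ (Ω : Set (Fin n → ℂ)) (p : Fin n → ℂ) (β : Fin n → ℝ) (φ : (Fin n → ℂ) → ℝ), IsOpen Ω →
    (∀ K : Set (Fin n → ℂ), IsCompact K → K ⊆ Ω → ∃ k T, CutoffWeights n Ω K k T) →
    (∀ j, 0 < β j) → polydisc n p β ⊆ Ω → ContDiffOn ℝ 2 φ Ω → (∀ z ∈ Ω, |φ z| ≤ M) →
    PSHOnC2 n φ Ω →
    (∀ z ∈ polydisc n p β, ∀ X : Fin n → ℂ,
      Ct * ∑ j, ‖X j‖ ^ 2 / (β j) ^ 2 ≤ hermForm n (cHess n φ z) X X) →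
    ∃ F, InBergman n Ω F ∧ l2sq n Ω F ≤ V * ∏ j, (β j) ^ 2 ∧ 1 / 2 ≤ ‖F p‖ := by
  obtain ⟨B, hB0, hB⟩ := exists_peak_function n
  obtain ⟨K, hK0, hK⟩ := exists_peak_weight n hCt
  obtain ⟨e, he⟩ : ∃ e, e = Real.exp (K * M) := ⟨_, rfl⟩
  have he0 : 0 < e := by rw [he]; exact Real.exp_pos _
  obtain ⟨a, ha⟩ : ∃ a : ℝ, a = 1 / (2 * (n + 1)) := ⟨_, rfl⟩
  have ha0 : 0 < a := by rw [ha]; positivity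
  have hpi := Real.pi_pos
  obtain ⟨D, hD⟩ : ∃ D, D = e * 2 ^ (n + 1) * (B * e) * Real.pi ^ n / (Real.pi * a ^ 2) ^ n :=
    ⟨_, rfl⟩
  have hD0 : 0 ≤ D := by rw [hD]; positivity
  refine ⟨(2 + 2 * e * (B * e)) * Real.pi ^ n, by positivity,
    fun Ω p β φ hΩ hcw hβ hP hφ hφM hφp hφC => ?_⟩
  obtain ⟨r, hr⟩ : ∃ r, r = 1 / (4 * (D + 1)) := ⟨_, rfl⟩
  have hr0 : 0 < r := by rw [hr]; positivity
  have hr1 : r ≤ 1 / 4 := by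
    rw [hr]
    gcongr
    linarith
  have hDr : D * r ≤ 1 / 4 := by
    rw [hr, mul_one_div, div_le_div_iff₀ (by positivity) (by norm_num)]
    linarith
  have hrr : r ^ 2 ≤ 1 / 16 := by nlinarith
  obtain ⟨Φ, hΦ, hΦp, hΦκ, hΦκ', hΦε, hΦH⟩ :=
    hK M Ω p β φ hΩ hβ hφ hφM hφp hφC (r ^ 2) (by positivity) hrr
  obtain ⟨F, hF, hFV, hF1⟩ := hB Ω p β Φ (K * M) hΩ hcw hβ hP hΦ hΦp hΦκ hΦκ'
    fun z hz => hΦH z ⟨hz, hP hz⟩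
  rw [← he] at hFV hF1 hΦε
  have hprod : ∏ j, (Real.pi * β j ^ 2) = Real.pi ^ n * ∏ j, (β j) ^ 2 := by
    simpa using prod_pi_mul_sq (β := β) 1
  have hβ0 : 0 < ∏ j, (β j) ^ 2 := Finset.prod_pos fun j _ => pow_pos (hβ j) 2
  refine ⟨F, hF, by rw [mul_assoc, ← hprod]; exact hFV, ?_⟩
  have h1 := hF1 (r ^ 2) (e * (2 * r ^ 2) ^ (n + 1)) (by linarith) (by positivity) hΦε
  have h2 := norm_sq_mul_le_integral hβ hΩ hP (hF.1.sub_const 1) hr0 (by linarith)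
  have h3 : r / (2 * (n + 1)) = r * a := by rw [ha]; ring
  rw [h3, prod_pi_mul_sq] at h2
  have h4 := h2.trans h1
  rw [hprod] at h4
  have h5 : (Real.pi * (r * a) ^ 2) ^ n = (Real.pi * a ^ 2) ^ n * (r ^ 2) ^ n := by
    rw [← mul_pow]
    ring
  have h6 : e * (2 * r ^ 2) ^ (n + 1) * (B * e * (Real.pi ^ n * ∏ j, (β j) ^ 2))
      = ((Real.pi * a ^ 2) ^ n * (r ^ 2) ^ n * ∏ j, (β j) ^ 2) * (D * r ^ 2) := by
    rw [hD, mul_pow, pow_succ (r ^ 2)]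
    have : (Real.pi * a ^ 2) ^ n ≠ 0 := by positivity
    field_simp
  rw [h5, h6] at h4
  have h7 : ‖F p - 1‖ ^ 2 ≤ D * r ^ 2 := le_of_mul_le_mul_left h4 (by positivity)
  have h8 : ‖F p - 1‖ ≤ 1 / 2 := by
    have : D * r ^ 2 ≤ (1 / 2) ^ 2 := by nlinarith
    exact (pow_le_pow_iff_left₀ (norm_nonneg _) (by norm_num) two_ne_zero).1 (h7.trans this)
  have h9 := norm_sub_norm_le (1 : ℂ) (1 - F p)
  rw [sub_sub_cancel, norm_one, norm_sub_rev] at h9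
  linarith

end KernelBounds

/-- **(Catlin)** Given positive constants `M`, `C̃`, `C_α`, there is `C > 0` (depending
only on these constants) such that for every bounded pseudoconvex domain `Ω ⊂ ℂⁿ` with
smooth boundary, every `p ∈ Ω`, every polyradius `β` with `P(p,β) ⊆ Ω`, and every
`φ ∈ C³(Ω̄)` which is bounded by `M`, plurisubharmonic on `Ω`, has complex Hessian
`≥ C̃ Σ_j |X_j|²/β_j²` on `P(p,β)`, and has mixed derivatives of order `≤ 3` bounded by
`C_α ∏_j β_j^{−α_j}` on `P(p,β)`, one has
`C⁻¹ ∏_j β_j⁻² ≤ K_Ω(p,p̄) ≤ C ∏_j β_j⁻²`. -/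
theorem catlin_bergman_kernel_estimate
    (n : ℕ) (M Ct : ℝ) (Cα : (Fin n → ℕ) → ℝ)
    (hM : 0 < M) (hCt : 0 < Ct) (hCα : ∀ α, 0 < Cα α) :
    ∃ C > (0:ℝ), ∀ Ω : Set (Fin n → ℂ), IsOpen Ω → Bornology.IsBounded Ω →
      IsPreconnected Ω → ∀ ρ : (Fin n → ℂ) → ℝ, IsDefining n Ω ρ →
      (∀ q ∈ frontier Ω, LeviPSDAt n ρ q) →
      ∀ p ∈ Ω, ∀ β : Fin n → ℝ, (∀ j, 0 < β j) →
      ∀ φ : (Fin n → ℂ) → ℝ, ContDiffOn ℝ 3 φ (closure Ω) →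
      (∀ z ∈ Ω, |φ z| ≤ M) →
      PSHOnC2 n φ Ω →
      polydisc n p β ⊆ Ω →
      (∀ z ∈ polydisc n p β, ∀ X : Fin n → ℂ,
        Ct * ∑ j, ‖X j‖ ^ 2 / (β j) ^ 2 ≤ hermForm n (cHess n φ z) X X) →
      MixedDerivBound n φ (polydisc n p β) 3 (fun α => Cα α * ∏ j, ((β j)⁻¹) ^ (α j)) →
      C⁻¹ * ∏ j, ((β j) ^ 2)⁻¹ ≤ bergmanKernel n Ω p ∧
        bergmanKernel n Ω p ≤ C * ∏ j, ((β j) ^ 2)⁻¹ := by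
  obtain ⟨V, hV, hpeak⟩ := exists_inBergman_peak n (M := M) hCt
  obtain ⟨c, hc⟩ : ∃ c, c = (Real.pi * ((1 / 2) / (2 * ((n : ℝ) + 1))) ^ 2) ^ n := ⟨_, rfl⟩
  have hc0 : 0 < c := by
    have := Real.pi_pos
    rw [hc]
    positivity
  refine ⟨4 * V + c⁻¹, by positivity, ?_⟩
  intro Ω hΩ hb _ ρ hρ hlevi p hp β hβ φ hφ hφM hφp hP hφC _
  have hβ0 : 0 < ∏ j, (β j) ^ 2 := Finset.prod_pos fun j _ => pow_pos (hβ j) 2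
  rw [Finset.prod_inv_distrib]
  have hupper : ∀ r ∈ {r | ∃ f, InBergman n Ω f ∧ l2sq n Ω f ≤ 1 ∧ r = ‖f p‖ ^ 2},
      r ≤ c⁻¹ * (∏ j, (β j) ^ 2)⁻¹ := by
    rintro r ⟨f, hf, hf1, rfl⟩
    have h := (hf.norm_sq_mul_le hΩ hβ hP).trans hf1
    rw [prod_pi_mul_sq, ← hc] at h
    rw [← mul_inv, ← one_div, le_div_iff₀ (by positivity)]
    linarith
  constructor
  · obtain ⟨F, hF, hFV, hFp⟩ := hpeak Ω p β φ hΩ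
      (fun K hK hKΩ => exists_cutoffWeights_of_levi hΩ hb hρ hlevi hK hKΩ) hβ hP
      ((hφ.of_le (by norm_num)).mono subset_closure) hφM hφp hφC
    obtain ⟨W, hW⟩ : ∃ W, W = V * ∏ j, (β j) ^ 2 := ⟨_, rfl⟩
    have hW0 : 0 < W := by rw [hW]; positivity
    rw [← hW] at hFV
    have hn : ∀ z, ‖((√W)⁻¹ : ℝ) * F z‖ ^ 2 = W⁻¹ * ‖F z‖ ^ 2 := fun z => by
      rw [norm_mul, mul_pow, Complex.norm_real, Real.norm_eq_abs, sq_abs, inv_pow,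
        Real.sq_sqrt hW0.le]
    have hmem : W⁻¹ * ‖F p‖ ^ 2 ∈ {r | ∃ f, InBergman n Ω f ∧ l2sq n Ω f ≤ 1 ∧ r = ‖f p‖ ^ 2} := by
      refine ⟨fun z => ((√W)⁻¹ : ℝ) * F z, ⟨hF.1.const_mul _, ?_⟩, ?_, (hn p).symm⟩
      · simp only [hn]
        exact hF.2.const_mul _
      · simp only [l2sq, hn]
        rw [integral_const_mul, inv_mul_le_iff₀ hW0, mul_one]
        exact hFV
    refine le_trans ?_ (le_csSup ⟨_, hupper⟩ hmem)
    have h1 : (1 / 2) ^ 2 ≤ ‖F p‖ ^ 2 := by gcongr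
    calc (4 * V + c⁻¹)⁻¹ * (∏ j, (β j) ^ 2)⁻¹ ≤ (4 * V)⁻¹ * (∏ j, (β j) ^ 2)⁻¹ := by
          gcongr
          linarith [inv_pos.2 hc0]
      _ = W⁻¹ * (1 / 2) ^ 2 := by
          rw [hW, mul_inv, mul_inv]
          ring
      _ ≤ W⁻¹ * ‖F p‖ ^ 2 := by gcongr
  · have hne : ({r | ∃ f, InBergman n Ω f ∧ l2sq n Ω f ≤ 1 ∧ r = ‖f p‖ ^ 2} : Set ℝ).Nonempty :=
      ⟨0, fun _ => 0, ⟨differentiableOn_const _, by simp⟩, by simp [l2sq], by simp⟩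
    refine (csSup_le hne hupper).trans ?_
    gcongr
    linarith
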